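/- arXiv:2308.01242 — 2 statements merged into one kernel-verified Lean document; each statement's English description precedes it below -/
import Mathlib

section
/- For every t ≥ 2, the complete graph K_{2t-2} has no even-odd-K_t-minor; consequently f_eo(t) ≥ 2t-2, where f_eo(t) is the smallest integer such that every even-odd-K_t-minor-free graph is f_eo(t)-colorable. -/
/-- A signed (multi)graph: an edge set with endpoints (an unordered pair,
possibly a loop) and a sign for each edge (`neg e = true` means `e` is negative). -/
structure SGraph (V : Type) where
  E : Type
  ends : E → Sym2 V
  neg : E → Bool

namespace SGraph

variable {V W : Type}

/-- Walks in a signed multigraph, recorded as sequences of edges. -/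
inductive Walk (G : SGraph V) : V → V → Type where
  | nil {v : V} : Walk G v v
  | cons {u v w : V} (e : G.E) (h : G.ends e = s(u, v)) (p : Walk G v w) : Walk G u w

namespace Walk

variable {G : SGraph V}

/-- The list of edges of a walk. -/
def edges : {u v : V} → G.Walk u v → List G.E
  | _, _, .nil => []
  | _, _, .cons e _ p => e :: p.edges

/-- The list of vertices visited by a walk (in order, with repetitions). -/
def support : {u v : V} → G.Walk u v → List V
  | u, _, .nil => [u]
  | u, _, .cons _ _ p => u :: p.support

/-- A walk is negative if it uses an odd number of negative edges
(its sign, the product of the signs of its edges with multiplicity, is `-1`). -/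
def isNeg {u v : V} (p : G.Walk u v) : Bool :=
  (p.edges.map G.neg).foldr Bool.xor false

/-- A closed walk is a cycle if it has at least one edge, no repeated edge,
and no repeated vertex (except the initial vertex which is also final). -/
def IsCycle {v : V} (p : G.Walk v v) : Prop :=
  p.edges ≠ [] ∧ p.edges.Nodup ∧ p.support.tail.Nodup

/-- The internal vertices of a walk. -/
def inner {u v : V} (p : G.Walk u v) : List V :=
  p.support.tail.dropLast

end Walk

/-- A set of vertices is balanced if it induces no negative cycle. -/
def BalancedSet (G : SGraph V) (X : Set V) : Prop :=
  ∀ (v : V) (p : G.Walk v v), p.IsCycle → (∀ u ∈ p.support, u ∈ X) → p.isNeg = false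

/-- A signed graph is balanced if it contains no negative cycle. -/
def IsBalanced (G : SGraph V) : Prop := G.BalancedSet Set.univ

/-- The signed graph has a negative loop. -/
def HasNegLoop (G : SGraph V) : Prop :=
  ∃ e : G.E, (∃ v : V, G.ends e = s(v, v)) ∧ G.neg e = true

/-- The signed graph has a positive loop. -/
def HasPosLoop (G : SGraph V) : Prop :=
  ∃ e : G.E, (∃ v : V, G.ends e = s(v, v)) ∧ G.neg e = false

/-- A balanced `k`-coloring: a partition of the vertices into `k` balanced color classes. -/
def ColorableB (G : SGraph V) (k : ℕ) : Prop :=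
  ∃ c : V → Fin k, ∀ i : Fin k, G.BalancedSet {v | c v = i}

/-- The balanced chromatic number. -/
noncomputable def chromNumB (G : SGraph V) : ℕ∞ :=
  ⨅ n ∈ {n : ℕ | G.ColorableB n}, (n : ℕ∞)

/-- Switching at the set of vertices where `s` is `true`: the sign of an edge is
multiplied by `-1` once for each of its endpoints (with multiplicity) in the set;
thus an edge with exactly one endpoint in the set changes sign, and loops are unchanged. -/
def switch (G : SGraph V) (s : V → Bool) : SGraph V where
  E := G.E
  ends := G.ends
  neg e := Bool.xor (G.neg e)
    (Sym2.lift ⟨fun u v => Bool.xor (s u) (s v), fun u v => Bool.xor_comm _ _⟩ (G.ends e))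

/-- The negation of a signature. -/
def negate (G : SGraph V) : SGraph V where
  E := G.E
  ends := G.ends
  neg e := !(G.neg e)

/-- A set of vertices is connected via positive edges inside itself. -/
def PosConnected (G : SGraph V) (B : Set V) : Prop :=
  B.Nonempty ∧ ∀ u ∈ B, ∀ v ∈ B, ∃ p : G.Walk u v,
    (∀ x ∈ p.support, x ∈ B) ∧ ∀ e ∈ p.edges, G.neg e = false

/-- `H` is a minor of `G`: after a suitable switching of `G`, there are disjoint
branch sets (each connected via positive edges) for the vertices of `H`, and
distinct edges of `G`, with the correct signs, realizing the edges of `H`. -/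
def IsMinor (H : SGraph W) (G : SGraph V) : Prop :=
  ∃ s : V → Bool, ∃ B : W → Set V,
    (∀ x : W, (G.switch s).PosConnected (B x)) ∧
    (Pairwise fun x y => Disjoint (B x) (B y)) ∧
    ∃ η : H.E → G.E, Function.Injective η ∧
      ∀ (e : H.E) (x y : W), H.ends e = s(x, y) →
        (G.switch s).neg (η e) = H.neg e ∧
        ∃ u v : V, G.ends (η e) = s(u, v) ∧ u ∈ B x ∧ v ∈ B y

/-- A homomorphism of signed graphs: after a suitable switching of the source,
a map of vertices and edges preserving incidences and signs. -/
def HomTo (G : SGraph V) (H : SGraph W) : Prop :=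
  ∃ s : V → Bool, ∃ f : V → W, ∃ g : G.E → H.E,
    ∀ (e : G.E) (u v : V), G.ends e = s(u, v) →
      H.ends (g e) = s(f u, f v) ∧ H.neg (g e) = (G.switch s).neg e

/-- A subdivision of `H` is isomorphic to a subgraph of `G` (signs ignored):
an injection of the vertices of `H` together with internally disjoint,
edge-disjoint paths of `G` realizing the edges of `H`. -/
def IsSubdivisionOf (H : SGraph W) (G : SGraph V) : Prop :=
  ∃ (φ : W → V) (ep : H.E → W × W),
    Function.Injective φ ∧
    (∀ e : H.E, H.ends e = s((ep e).1, (ep e).2)) ∧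
    ∃ P : (e : H.E) → G.Walk (φ (ep e).1) (φ (ep e).2),
      (∀ e, (P e).support.Nodup) ∧
      (∀ e f, e ≠ f → ∀ x ∈ (P e).inner, x ∉ (P f).support) ∧
      (∀ e, ∀ x ∈ (P e).inner, x ∉ Set.range φ) ∧
      (∀ e f, e ≠ f → ∀ g ∈ (P e).edges, g ∉ (P f).edges)

/-- `H` is a total topological minor of `G`: a subdivision of `H` occurs as a
subgraph of `G` in which the path representing each edge `e` of `H` has sign
exactly the sign of `e`. -/
def IsTotalTopMinor (H : SGraph W) (G : SGraph V) : Prop :=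
  ∃ (φ : W → V) (ep : H.E → W × W),
    Function.Injective φ ∧
    (∀ e : H.E, H.ends e = s((ep e).1, (ep e).2)) ∧
    ∃ P : (e : H.E) → G.Walk (φ (ep e).1) (φ (ep e).2),
      (∀ e, (P e).support.Nodup) ∧
      (∀ e f, e ≠ f → ∀ x ∈ (P e).inner, x ∉ (P f).support) ∧
      (∀ e, ∀ x ∈ (P e).inner, x ∉ Set.range φ) ∧
      (∀ e f, e ≠ f → ∀ g ∈ (P e).edges, g ∉ (P f).edges) ∧
      (∀ e, (P e).isNeg = H.neg e)

/-- `H` is a topological minor of `G`: some subdivision of `H` occurs as a subgraph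
of `G` in which every cycle of `H` keeps its sign; equivalently, after a suitable
switching of `H`, `H` is a total topological minor of `G`. -/
def IsTopMinor (H : SGraph W) (G : SGraph V) : Prop :=
  ∃ s : W → Bool, (H.switch s).IsTotalTopMinor G

end SGraph

open SGraph

/-- The signed graph `G̃` obtained from a graph `G` by replacing each edge by a
pair of parallel edges, one positive and one negative. -/
def SimpleGraph.tildeS {V : Type} (G : SimpleGraph V) : SGraph V where
  E := G.edgeSet × Bool
  ends e := (e.1 : Sym2 V)
  neg e := e.2

/-- The all-negative signed graph `(G, -)` on a graph `G`. -/
def SimpleGraph.allNeg {V : Type} (G : SimpleGraph V) : SGraph V where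
  E := G.edgeSet
  ends e := (e : Sym2 V)
  neg _ := true

/-- `K̃_k`: the signed graph on `k` vertices with a positive and a negative edge
between each pair of distinct vertices. -/
def tildeK (k : ℕ) : SGraph (Fin k) := (⊤ : SimpleGraph (Fin k)).tildeS

/-- `(K_k, -)`: the all-negative complete signed graph on `k` vertices. -/
def allNegK (k : ℕ) : SGraph (Fin k) := (⊤ : SimpleGraph (Fin k)).allNeg

/-- `K̃_k⁺`: as `K̃_k`, with in addition a positive loop at every vertex. -/
def tildeKplus (k : ℕ) : SGraph (Fin k) where
  E := ((⊤ : SimpleGraph (Fin k)).edgeSet × Bool) ⊕ Fin k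
  ends := Sum.elim (fun e => (e.1 : Sym2 (Fin k))) (fun i => s(i, i))
  neg := Sum.elim (fun e => e.2) (fun _ => false)

/-- `G` has a `K_k`-minor: `k` disjoint connected branch sets, pairwise joined by an edge. -/
def SimpleGraph.HasCliqueMinor {V : Type} (G : SimpleGraph V) (k : ℕ) : Prop :=
  ∃ T : Fin k → G.Subgraph,
    (∀ i, (T i).coe.Connected) ∧
    (Pairwise fun i j => Disjoint (T i).verts (T j).verts) ∧
    ∀ i j, i ≠ j → ∃ u v, G.Adj u v ∧ u ∈ (T i).verts ∧ v ∈ (T j).verts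

/-- `G` has an odd-`K_k`-minor: a 2-coloring of the vertices together with `k`
disjoint trees, all of whose edges are properly colored, pairwise joined by a
monochromatic edge. -/
def SimpleGraph.HasOddCliqueMinor {V : Type} (G : SimpleGraph V) (k : ℕ) : Prop :=
  ∃ c : V → Bool, ∃ T : Fin k → G.Subgraph,
    (∀ i, (T i).coe.IsTree) ∧
    (Pairwise fun i j => Disjoint (T i).verts (T j).verts) ∧
    (∀ i, ∀ u v, (T i).Adj u v → c u ≠ c v) ∧
    ∀ i j, i ≠ j →
      ∃ u v, G.Adj u v ∧ u ∈ (T i).verts ∧ v ∈ (T j).verts ∧ c u = c v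

/-- `G` has an even-odd-`K_k`-minor: as an odd-`K_k`-minor, with in addition a
properly colored edge between each pair of distinct trees. -/
def SimpleGraph.HasEvenOddCliqueMinor {V : Type} (G : SimpleGraph V) (k : ℕ) : Prop :=
  ∃ c : V → Bool, ∃ T : Fin k → G.Subgraph,
    (∀ i, (T i).coe.IsTree) ∧
    (Pairwise fun i j => Disjoint (T i).verts (T j).verts) ∧
    (∀ i, ∀ u v, (T i).Adj u v → c u ≠ c v) ∧
    ∀ i j, i ≠ j →
      (∃ u v, G.Adj u v ∧ u ∈ (T i).verts ∧ v ∈ (T j).verts ∧ c u = c v) ∧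
      (∃ u v, G.Adj u v ∧ u ∈ (T i).verts ∧ v ∈ (T j).verts ∧ c u ≠ c v)

/-- The fractional chromatic number of a finite graph: the infimum total weight of
a system of nonnegative weights on independent sets covering every vertex with
total weight at least 1. -/
noncomputable def SimpleGraph.fracChrom {V : Type} [Fintype V] [DecidableEq V]
    (G : SimpleGraph V) : ℝ :=
  sInf {r : ℝ | ∃ w : Finset V → ℝ, (∀ A, 0 ≤ w A) ∧
    (∀ A : Finset V, w A ≠ 0 → (∀ u ∈ A, ∀ v ∈ A, ¬G.Adj u v)) ∧
    (∀ v : V, 1 ≤ ∑ A : Finset V, if v ∈ A then w A else 0) ∧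
    ∑ A : Finset V, w A ≤ r}

/-- The fractional balanced chromatic number of a finite signed graph: the infimum
total weight of a system of nonnegative weights on balanced sets covering every
vertex with total weight at least 1. -/
noncomputable def SGraph.fracChromB {V : Type} [Fintype V] [DecidableEq V]
    (G : SGraph V) : ℝ :=
  sInf {r : ℝ | ∃ w : Finset V → ℝ, (∀ A, 0 ≤ w A) ∧
    (∀ A : Finset V, w A ≠ 0 → G.BalancedSet ↑A) ∧
    (∀ v : V, 1 ≤ ∑ A : Finset V, if v ∈ A then w A else 0) ∧
    ∑ A : Finset V, w A ≤ r}

/-- `f_eo(t)`: the smallest `n` such that every even-odd-`K_t`-minor-free graph is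
`n`-colorable. -/
noncomputable def feo (t : ℕ) : ℕ :=
  sInf {n : ℕ | ∀ (m : ℕ) (G : SimpleGraph (Fin m)),
    ¬ G.HasEvenOddCliqueMinor t → G.Colorable n}

/-- The graph of properly colored edges of `H`. -/
def properPart {V : Type} (H : SimpleGraph V) (c : V → Bool) : SimpleGraph V where
  Adj u v := H.Adj u v ∧ c u ≠ c v
  symm := ⟨fun _ _ h => ⟨h.1.symm, h.2.symm⟩⟩
  loopless := ⟨fun _ h => h.2 rfl⟩

/-- The graph of edges of `H` inside `S`. -/
def edgesIn {V : Type} (H : SimpleGraph V) (S : Set V) : SimpleGraph V where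
  Adj u v := H.Adj u v ∧ u ∈ S ∧ v ∈ S
  symm := ⟨fun _ _ h => ⟨h.1.symm, h.2.2, h.2.1⟩⟩
  loopless := ⟨fun _ h => H.loopless.irrefl _ h.1⟩

/-- A strong form of an even-odd minor: branch sets that are connected through
properly colored edges, and that all contain vertices of both colors. -/
def StrongMinor {V : Type} (H : SimpleGraph V) (t : ℕ) : Prop :=
  ∃ c : V → Bool, ∃ B : Fin t → Set V,
    (∀ i, ((properPart H c).induce (B i)).Connected) ∧
    (∀ i, ∀ b, ∃ v ∈ B i, c v = b) ∧
    (∀ i j, i ≠ j → Disjoint (B i) (B j)) ∧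
    ∀ i j, i ≠ j → ∀ b, ∃ u v, H.Adj u v ∧ u ∈ B i ∧ v ∈ B j ∧ (c u ^^ c v) = b

theorem mem_support_of_conn {V : Type} (H : SimpleGraph V) (c : V → Bool) (B : Set V)
    (hB : ((properPart H c).induce B).Connected) (hb : ∀ b, ∃ v ∈ B, c v = b)
    (v : V) (hv : v ∈ B) : ∃ u, H.Adj v u := by
  obtain ⟨u, hu, huc⟩ := hb (!(c v))
  obtain ⟨p⟩ := hB.preconnected ⟨v, hv⟩ ⟨u, hu⟩
  cases p with
  | nil => simp at huc
  | cons h p => exact ⟨_, h.1⟩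

theorem exists_levels {V : Type} (H : SimpleGraph V) :
    ∃ (ρ : V → V) (l : V → ℕ),
      (∀ u v, H.Adj u v → ρ u = ρ v ∧ l u ≤ l v + 1) ∧
      (∀ v, l v = 0 → v = ρ v) ∧
      (∀ v k, l v = k + 1 → ∃ u, H.Adj u v ∧ ρ u = ρ v ∧ l u = k) ∧
      (∀ v, ρ (ρ v) = ρ v ∧ l (ρ v) = 0) := by
  set ρ : V → V := fun v => (H.connectedComponentMk v).out with hρ
  have hr : ∀ v, H.Reachable (ρ v) v := fun v =>
    SimpleGraph.ConnectedComponent.exact (Quot.out_eq _)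
  have hρe : ∀ u v, H.Reachable u v → ρ u = ρ v := by
    intro u v h
    simp only [hρ]
    rw [SimpleGraph.ConnectedComponent.sound h]
  refine ⟨ρ, fun v => H.dist (ρ v) v, ?_, ?_, ?_, ?_⟩
  · intro u v h
    have e := hρe u v h.reachable
    refine ⟨e, ?_⟩
    simp only [e]
    obtain ⟨p, hp⟩ := (hr v).exists_walk_length_eq_dist
    have := SimpleGraph.dist_le (p.append h.symm.toWalk)
    simp at this
    omega
  · intro v hv
    exact ((hr v).dist_eq_zero_iff.1 hv).symm
  · intro v k hk
    obtain ⟨p, hp⟩ := (hr v).symm.exists_walk_length_eq_dist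
    rw [SimpleGraph.dist_comm] at hp
    simp only at hk
    rw [hk] at hp
    have key : ∀ (r : V) (p : H.Walk v r), p.length = k + 1 → ρ v = r →
        ∃ u, H.Adj u v ∧ ρ u = ρ v ∧ H.dist (ρ u) u = k := by
      intro r p hp hrr
      cases p with
      | nil => simp at hp
      | @cons _ u _ h q =>
        refine ⟨u, h.symm, (hρe _ _ h.reachable).symm, ?_⟩
        have e := hρe _ _ h.reachable
        rw [← e]
        simp at hp
        have h1 := SimpleGraph.dist_le q
        rw [SimpleGraph.dist_comm] at h1
        rw [hrr]
        rw [hrr] at hk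
        have hrv := hr v
        rw [hrr] at hrv
        obtain ⟨p', hp'⟩ := (hrv.trans h.reachable).exists_walk_length_eq_dist
        have := SimpleGraph.dist_le (p'.append h.symm.toWalk)
        simp at this
        omega
    exact key _ p hp rfl
  · intro v
    have : ρ (ρ v) = ρ v := hρe _ _ (hr v)
    exact ⟨this, by simp [this]⟩

theorem strong_step {V : Type} (t N : ℕ) (hN : 1 ≤ N)
    (ih : ∀ H : SimpleGraph V, ¬ H.Colorable N → StrongMinor H t)
    (H : SimpleGraph V) (hH : ¬ H.Colorable (2 * (N + 1))) : StrongMinor H (t + 1) := by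
  classical
  obtain ⟨ρ, l, h1, h2, h3, h4⟩ := exists_levels H
  -- a piece with large chromatic number
  have hex : ∃ r i, ¬ (edgesIn H {v | ρ v = r ∧ l v = i}).Colorable (N + 1) := by
    by_contra! hcon
    have hcon' : ∀ r i, Nonempty ((edgesIn H {v | ρ v = r ∧ l v = i}).Coloring (Fin (N+1))) := hcon
    let C := fun r i => Classical.choice (hcon' r i)
    apply hH
    have col : H.Coloring (Fin 2 × Fin (N + 1)) := SimpleGraph.Coloring.mk
      (fun v => (⟨l v % 2, Nat.mod_lt _ (by norm_num)⟩, C (ρ v) (l v) v)) (by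
        intro u v huv he
        simp only [Prod.mk.injEq, Fin.mk.injEq] at he
        obtain ⟨ha, hb⟩ := he
        have e1 := h1 u v huv
        have e2 := h1 v u huv.symm
        have el : l u = l v := by omega
        rw [e1.1, el] at hb
        exact (C (ρ v) (l v)).valid (v := u) (w := v) ⟨huv, ⟨e1.1, el⟩, ⟨rfl, rfl⟩⟩ hb)
    have := col.colorable
    simpa using this
  obtain ⟨r, i, hri⟩ := hex
  set S : Set V := {v | ρ v = r ∧ l v = i} with hS
  have hedge : ∃ w w', (edgesIn H S).Adj w w' := by
    by_contra! hcon
    exact hri ⟨SimpleGraph.Coloring.mk (fun _ => 0) (fun {u v} huv => (hcon u v huv).elim)⟩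
  obtain ⟨w, w', hww, hwS, hwS'⟩ := hedge
  have hi : i ≠ 0 := by
    intro h0
    have a := h2 w (hwS.2.trans h0)
    have b := h2 w' (hwS'.2.trans h0)
    rw [hwS.1] at a
    rw [hwS'.1] at b
    exact hww.ne (a.trans b.symm)
  set S' : Set V := S \ {w} with hS'
  have hnc : ¬ (edgesIn H S').Colorable N := by
    rintro ⟨C⟩
    apply hri
    have col : (edgesIn H S).Coloring (Option (Fin N)) := SimpleGraph.Coloring.mk
      (fun v => if v = w then none else some (C v)) (by
        intro u v huv he
        by_cases hu : u = w <;> by_cases hv : v = w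
        · exact huv.1.ne (hu.trans hv.symm)
        · simp [hu, hv] at he
        · simp [hu, hv] at he
        · simp [hu, hv] at he
          exact C.valid (v := u) (w := v) ⟨huv.1, ⟨huv.2.1, hu⟩, ⟨huv.2.2, hv⟩⟩ he)
    have := col.colorable
    simpa using this
  obtain ⟨c, B, b1, b2, b3, b4⟩ := ih _ hnc
  have hBS : ∀ j, ∀ v ∈ B j, v ∈ S' := by
    intro j v hv
    obtain ⟨u, hu⟩ := mem_support_of_conn _ c (B j) (b1 j) (b2 j) v hv
    exact hu.2.1
  set A : Set V := {v | (ρ v = r ∧ l v < i) ∨ v = w} with hA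
  have hAS : ∀ v ∈ A, v ∉ S' := by
    rintro v (⟨_, hv⟩ | hv) ⟨hv1, hv2⟩
    · exact absurd hv1.2 (by omega)
    · exact hv2 hv
  set c' : V → Bool := fun v => if v ∈ S' then c v else decide (Even (l v)) with hc'
  have cS : ∀ v ∈ S', c' v = c v := fun v hv => by simp [hc', hv]
  have cA : ∀ v ∈ A, c' v = decide (Even (l v)) := fun v hv => by
    simp [hc', hAS v hv]
  have hAρ : ∀ v ∈ A, ρ v = r ∧ l v ≤ i := by
    rintro v (⟨ha, hb⟩ | rfl)
    · exact ⟨ha, hb.le⟩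
    · exact ⟨hwS.1, hwS.2.le⟩
  have hrA : r ∈ A ∧ l r = 0 := by
    have := h4 w
    rw [hwS.1] at this
    exact ⟨Or.inl ⟨this.1, by omega⟩, this.2⟩
  have hdown : ∀ v, ρ v = r → ∀ k, l v = k + 1 → k < i →
      ∃ u ∈ A, H.Adj u v ∧ l u = k := by
    intro v hv k hk hki
    obtain ⟨u, a, b, d⟩ := h3 v k hk
    exact ⟨u, Or.inl ⟨b.trans hv, by omega⟩, a, d⟩
  have Aconn : ((properPart H c').induce A).Connected := by
    have key : ∀ k, ∀ v (hv : v ∈ A), l v = k →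
        ((properPart H c').induce A).Reachable ⟨r, hrA.1⟩ ⟨v, hv⟩ := by
      intro k
      induction k with
      | zero =>
        intro v hv hk
        have : v = r := (h2 v hk).trans (hAρ v hv).1
        subst this
        exact SimpleGraph.Reachable.refl _
      | succ k ihk =>
        intro v hv hk
        obtain ⟨u, hu, huv, hl⟩ := hdown v (hAρ v hv).1 k hk (by have := (hAρ v hv).2; omega)
        refine (ihk u hu hl).trans (SimpleGraph.Adj.reachable ?_)
        refine ⟨huv, ?_⟩
        show c' u ≠ c' v
        rw [cA u hu, cA v hv, hl, hk]
        by_cases hk : Even k <;> simp [hk, Nat.even_add_one, -Nat.not_even_iff_odd]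
    rw [SimpleGraph.connected_iff_exists_forall_reachable]
    exact ⟨⟨r, hrA.1⟩, fun v => key _ v.1 v.2 rfl⟩
  obtain ⟨k, rfl⟩ : ∃ k, i = k + 1 := ⟨i - 1, by omega⟩
  have Abi : ∀ b, ∃ v ∈ A, c' v = b := by
    intro b
    obtain ⟨u, hu, huw, hl⟩ := hdown w hwS.1 k hwS.2 (by omega)
    have e1 := cA u hu
    have e2 := cA w (Or.inr rfl)
    rw [hl] at e1
    rw [hwS.2] at e2
    by_cases hk : Even k <;> simp [hk, Nat.even_add_one] at e1 e2 <;> cases b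
    exacts [⟨w, Or.inr rfl, e2⟩, ⟨u, hu, e1⟩, ⟨u, hu, e1⟩, ⟨w, Or.inr rfl, e2⟩]
  have Alink : ∀ j b, ∃ u v, H.Adj u v ∧ u ∈ A ∧ v ∈ B j ∧ (c' u ^^ c' v) = b := by
    intro j b
    obtain ⟨v, hv, hvc⟩ := b2 j (decide (Even k) ^^ b)
    have hvS := hBS j v hv
    obtain ⟨u, hu, huv, hl⟩ := hdown v hvS.1.1 k hvS.1.2 (by omega)
    refine ⟨u, v, huv, hu, hv, ?_⟩
    rw [cA u hu, cS v hvS, hvc, hl]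
    simp
  have Adis : ∀ j, Disjoint A (B j) := fun j =>
    Set.disjoint_left.2 fun v hv hv' => hAS v hv (hBS j v hv')
  refine ⟨c', Fin.cons A B, ?_, ?_, ?_, ?_⟩
  · intro j
    refine Fin.cases ?_ (fun j => ?_) j
    · exact Aconn
    · change ((properPart H c').induce (B j)).Connected
      refine (b1 j).mono ?_
      rintro ⟨u, hu⟩ ⟨v, hv⟩ huv
      obtain ⟨p, q⟩ := huv
      refine ⟨p.1, ?_⟩
      show c' u ≠ c' v
      rw [cS u (hBS j u hu), cS v (hBS j v hv)]
      exact q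
  · intro j
    refine Fin.cases ?_ (fun j => ?_) j
    · exact Abi
    · intro b
      obtain ⟨v, hv, hvb⟩ := b2 j b
      exact ⟨v, hv, by rw [cS v (hBS j v hv), hvb]⟩
  · intro j j'
    refine Fin.cases ?_ (fun j => ?_) j <;> refine Fin.cases ?_ (fun j' => ?_) j' <;> intro hne
    · exact absurd rfl hne
    · exact Adis j'
    · exact (Adis j).symm
    · exact b3 j j' (fun h => hne (by rw [h]))
  · intro j j'
    refine Fin.cases ?_ (fun j => ?_) j <;> refine Fin.cases ?_ (fun j' => ?_) j' <;> intro hne b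
    · exact absurd rfl hne
    · exact Alink j' b
    · obtain ⟨u, v, x, y, z, e⟩ := Alink j b
      exact ⟨v, u, x.symm, z, y, by rw [Bool.xor_comm]; exact e⟩
    · obtain ⟨u, v, x, y, z, e⟩ := b4 j j' (fun h => hne (by rw [h])) b
      exact ⟨u, v, x.1, y, z, by rw [cS u (hBS _ u y), cS v (hBS _ v z)]; exact e⟩

theorem exists_strong (t : ℕ) : ∃ N, 1 ≤ N ∧ ∀ (V : Type) (H : SimpleGraph V),
    ¬ H.Colorable N → StrongMinor H t := by
  induction t with
  | zero =>
    exact ⟨1, le_rfl, fun V H _ => ⟨fun _ => true, fun i => i.elim0, fun i => i.elim0,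
      fun i => i.elim0, fun i => i.elim0, fun i => i.elim0⟩⟩
  | succ t ih =>
    obtain ⟨N, hN, h⟩ := ih
    exact ⟨2 * (N + 1), by omega, fun V H hH => strong_step t N hN (h V) H hH⟩

theorem StrongMinor.toMinor {V : Type} [Finite V] (G : SimpleGraph V) (t : ℕ)
    (h : StrongMinor G t) : G.HasEvenOddCliqueMinor t := by
  obtain ⟨c, B, b1, b2, b3, b4⟩ := h
  choose T hT hT' using fun i => (b1 i).exists_isTree_le
  refine ⟨c, fun i => 
    { verts := B i
      Adj := fun u v => ∃ (hu : u ∈ B i) (hv : v ∈ B i), (T i).Adj ⟨u, hu⟩ ⟨v, hv⟩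
      adj_sub := fun {u v} ⟨hu, hv, h⟩ => (hT i h).1
      edge_vert := fun {u v} ⟨hu, hv, h⟩ => hu
      symm := ⟨fun u v ⟨hu, hv, h⟩ => ⟨hv, hu, h.symm⟩⟩ }, ?_, ?_, ?_, ?_⟩
  · intro i
    convert hT' i using 1
    ext u v
    exact ⟨fun ⟨_, _, h⟩ => h, fun h => ⟨u.2, v.2, h⟩⟩
  · exact fun i j hij => b3 i j hij
  · rintro i u v ⟨hu, hv, h⟩
    exact (hT i h).2
  · intro i j hij
    obtain ⟨u, v, x, y, z, e⟩ := b4 i j hij false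
    obtain ⟨u', v', x', y', z', e'⟩ := b4 i j hij true
    exact ⟨⟨u, v, x, y, z, by simpa using e⟩, ⟨u', v', x', y', z', by simpa using e'⟩⟩

theorem complete_no_minor (t : ℕ) (ht : 2 ≤ t) :
    ¬ (⊤ : SimpleGraph (Fin (2 * t - 2))).HasEvenOddCliqueMinor t := by
  classical
  rintro ⟨c, T, hT, hd, -, hl⟩
  have hne : ∀ i, 1 ≤ (T i).verts.toFinset.card := by
    intro i
    obtain ⟨⟨v, hv⟩⟩ := (hT i).1.nonempty
    exact Finset.card_pos.2 ⟨v, by simpa using hv⟩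
  have hone : ∀ i j, i ≠ j → (T i).verts.toFinset.card = 1 → (T j).verts.toFinset.card ≠ 1 := by
    intro i j hij h1 h2
    obtain ⟨a, ha⟩ := Finset.card_eq_one.1 h1
    obtain ⟨b, hb⟩ := Finset.card_eq_one.1 h2
    have ha' : ∀ x ∈ (T i).verts, x = a := fun x hx => by
      have : x ∈ (T i).verts.toFinset := by simpa using hx
      simpa [ha] using this
    have hb' : ∀ x ∈ (T j).verts, x = b := fun x hx => by
      have : x ∈ (T j).verts.toFinset := by simpa using hx
      simpa [hb] using this
    obtain ⟨⟨u, v, -, hu, hv, e⟩, ⟨u', v', -, hu', hv', e'⟩⟩ := hl i j hij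
    rw [ha' _ hu, hb' _ hv] at e
    rw [ha' _ hu', hb' _ hv'] at e'
    exact e' e
  have hsum : ∑ i, (T i).verts.toFinset.card ≤ 2 * t - 2 := by
    rw [← Finset.card_biUnion]
    · exact (Finset.card_le_univ _).trans (by simp)
    · intro i _ j _ hij
      simpa [Set.disjoint_toFinset] using hd hij
  have hex : ∃ i0 : Fin t, ∀ j, j ≠ i0 → 2 ≤ (T j).verts.toFinset.card := by
    by_cases h : ∃ i, (T i).verts.toFinset.card = 1
    · obtain ⟨i, hi⟩ := h
      exact ⟨i, fun j hj => by have := hone i j hj.symm hi; have := hne j; omega⟩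
    · push Not at h
      exact ⟨⟨0, by omega⟩, fun j _ => by have := h j; have := hne j; omega⟩
  obtain ⟨i0, h0⟩ := hex
  rw [← Finset.add_sum_erase _ _ (Finset.mem_univ i0)] at hsum
  have h2 : (Finset.univ.erase i0).card • 2 ≤
      ∑ j ∈ Finset.univ.erase i0, (T j).verts.toFinset.card :=
    Finset.card_nsmul_le_sum _ _ _ (fun j hj => h0 j (Finset.ne_of_mem_erase hj))
  rw [Finset.card_erase_of_mem (Finset.mem_univ _), Finset.card_univ, Fintype.card_fin] at h2
  simp only [smul_eq_mul] at h2
  have := hne i0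
  omega

/-- for `t ≥ 2`, `K_{2t-2}` has no even-odd-`K_t`-minor, and
consequently `f_eo(t) ≥ 2t - 2`. -/
theorem stmt12 (t : ℕ) (ht : 2 ≤ t) :
    ¬ (⊤ : SimpleGraph (Fin (2 * t - 2))).HasEvenOddCliqueMinor t ∧
    2 * t - 2 ≤ feo t := by
  refine ⟨complete_no_minor t ht, ?_⟩
  have hmem : feo t ∈ {n : ℕ | ∀ (m : ℕ) (G : SimpleGraph (Fin m)),
      ¬ G.HasEvenOddCliqueMinor t → G.Colorable n} := by
    apply Nat.sInf_mem
    obtain ⟨N, -, hN⟩ := exists_strong t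
    refine ⟨N, fun m G hG => ?_⟩
    by_contra hc
    exact hG (StrongMinor.toMinor G t (hN _ G hc))
  have hcol := hmem _ _ (complete_no_minor t ht)
  obtain ⟨C⟩ := hcol
  have hinj : Function.Injective C := fun u v huv => by
    by_contra hne
    exact C.valid (v := u) (w := v) hne huv
  simpa using Fintype.card_le_of_injective C hinj
end

section
/- For every positive integer t, TT(t) ≥ √(2t/79); that is, every signed graph with no negative loop and balanced chromatic number at least t contains a subdivision of K̃_k with k ≥ √(2t/79). -/
open SGraph

/-- `TT(t)`: the largest `k` such that every signed graph with no negative loop and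
balanced chromatic number at least `t` contains `K̃_k` as a topological minor. -/
noncomputable def TT (t : ℕ) : ℕ :=
  sSup {k : ℕ | ∀ (m : ℕ) (G : SGraph (Fin m)),
    ¬ G.HasNegLoop → (t : ℕ∞) ≤ G.chromNumB → (tildeK k).IsTopMinor G}

namespace SGP

set_option linter.unusedSectionVars false

/-- signed paths, recorded with their end vertices, sign and vertex set -/
inductive SP {V : Type} [DecidableEq V] (g : V → V → Bool → Prop) : V → V → Bool → Finset V → Prop
  | nil (a : V) : SP g a a false {a}
  | cons {a b c : V} {σ τ : Bool} {S : Finset V} : g a b σ → SP g b c τ S → a ∉ S →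
      SP g a c (xor σ τ) (insert a S)

section
variable {V : Type} [DecidableEq V] {g g' : V → V → Bool → Prop}

theorem SP.left_mem {a b : V} {σ : Bool} {S : Finset V} (h : SP g a b σ S) : a ∈ S := by
  cases h <;> simp

theorem SP.right_mem {a b : V} {σ : Bool} {S : Finset V} (h : SP g a b σ S) : b ∈ S := by
  induction h with
  | nil a => simp
  | cons _ _ _ ih => exact Finset.mem_insert_of_mem ih

theorem SP.mono {a b : V} {σ : Bool} {S : Finset V} (hg : ∀ u v σ, g u v σ → g' u v σ)
    (h : SP g a b σ S) : SP g' a b σ S := by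
  induction h with
  | nil a => exact .nil a
  | cons h1 _ h3 ih => exact .cons (hg _ _ _ h1) ih h3

theorem SP.append {a b c : V} {σ τ : Bool} {S T : Finset V} (h : SP g a b σ S)
    (h2 : SP g b c τ T) (hd : ∀ z, z ∈ S → z ∈ T → z = b) :
    SP g a c (xor σ τ) (S ∪ T) := by
  induction h with
  | nil a =>
    have : ({a} : Finset V) ∪ T = T := by
      have := h2.left_mem
      ext z; simp; rintro rfl; exact this
    rw [this]; simpa using h2
  | cons h1 hp h3 ih =>
    rw [Finset.insert_union, Bool.xor_assoc]
    refine .cons h1 (ih h2 (fun z hz hz' => hd z (Finset.mem_insert_of_mem hz) hz')) ?_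
    rw [Finset.mem_union, not_or]
    refine ⟨h3, fun h => ?_⟩
    have := hd _ (Finset.mem_insert_self _ _) h
    subst this
    exact h3 hp.right_mem

theorem SP.single {a b : V} {σ : Bool} (h : g a b σ) (hab : a ≠ b) : SP g a b σ {a, b} := by
  have := SP.cons h (SP.nil b) (by simpa using hab)
  simpa using this

theorem SP.snoc {a b c : V} {σ τ : Bool} {S : Finset V} (h : SP g a b σ S) (h2 : g b c τ)
    (hc : c ∉ S) : SP g a c (xor σ τ) (insert c S) := by
  have hbc : b ≠ c := fun e => hc (e ▸ h.right_mem)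
  have := h.append (SP.single h2 hbc) (by
    intro z hz hz'
    simp at hz'
    rcases hz' with rfl | rfl
    · rfl
    · exact absurd hz hc)
  have e : S ∪ {b, c} = insert c S := by
    have := h.right_mem
    ext z; simp; rintro rfl; exact .inr this
  rwa [e] at this

theorem SP.reverse (hs : ∀ u v σ, g u v σ → g v u σ) {a b : V} {σ : Bool} {S : Finset V}
    (h : SP g a b σ S) : SP g b a σ S := by
  induction h with
  | nil a => exact .nil a
  | cons h1 hp h3 ih =>
    rw [Bool.xor_comm]
    exact ih.snoc (hs _ _ _ h1) h3

theorem SP.sub_of_sep {A B : Finset V} (he : ∀ u v σ, g u v σ → (u ∈ A ∧ v ∈ A) ∨ (u ∈ B ∧ v ∈ B))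
    {a b : V} {σ : Bool} {S : Finset V} (h : SP g a b σ S) (ha : a ∈ A)
    (hS : ∀ z ∈ S, z ∈ A → z ∈ B → z = b) : S ⊆ A := by
  induction h with
  | nil a => simpa using ha
  | @cons a a' b _ _ S' h1 hp h3 ih =>
    have haB : a ∉ B := by
      intro hB
      have := hS a (Finset.mem_insert_self _ _) ha hB
      exact h3 (this ▸ hp.right_mem)
    have : a' ∈ A := by
      rcases he _ _ _ h1 with h | h
      · exact h.2
      · exact absurd h.1 haB
    have := ih this (fun z hz => hS z (Finset.mem_insert_of_mem hz))
    exact Finset.insert_subset ha this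

theorem SP.trunc {a b : V} {σ : Bool} {S : Finset V} (h : SP g a b σ S) (Y : Finset V)
    (hb : b ∈ Y) : ∃ b' τ S', S' ⊆ S ∧ SP g a b' τ S' ∧ b' ∈ Y ∧ ∀ z ∈ S', z ∈ Y → z = b' := by
  induction h with
  | nil a => exact ⟨a, _, {a}, subset_rfl, .nil a, hb, by simp⟩
  | @cons a a' b _ _ S' h1 hp h3 ih =>
    by_cases haY : a ∈ Y
    · exact ⟨a, _, {a}, by simp, .nil a, haY, by simp⟩
    · obtain ⟨b', τ, S1, hs, hp', hb', hz⟩ := ih hb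
      refine ⟨b', _, insert a S1, Finset.insert_subset_insert _ hs, .cons h1 hp' (fun h => h3 (hs h)), hb', ?_⟩
      intro z hz1 hzY
      rw [Finset.mem_insert] at hz1
      rcases hz1 with rfl | hz1
      · exact absurd hzY haY
      · exact hz z hz1 hzY

theorem SP.suffix {a b : V} {σ : Bool} {S : Finset V} (h : SP g a b σ S) {w : V} (hw : w ∈ S) :
    ∃ τ S', S' ⊆ S ∧ SP g w b τ S' := by
  induction h with
  | nil a => simp at hw; subst hw; exact ⟨_, _, subset_rfl, .nil w⟩
  | @cons a a' b _ _ S' h1 hp h3 ih =>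
    rw [Finset.mem_insert] at hw
    rcases hw with rfl | hw
    · exact ⟨_, _, subset_rfl, .cons h1 hp h3⟩
    · obtain ⟨τ, S1, hs, hp'⟩ := ih hw
      exact ⟨τ, S1, hs.trans (Finset.subset_insert _ _), hp'⟩

/-- if every edge comes with both signs, every path between distinct vertices has any sign -/
theorem SP.anysign (hD : ∀ u v σ τ, g u v σ → g u v τ) {a b : V} {σ : Bool} {S : Finset V}
    (h : SP g a b σ S) (hab : a ≠ b) (τ : Bool) : SP g a b τ S := by
  cases h with
  | nil => exact absurd rfl hab
  | @cons _ a' _ σ1 σ2 S' h1 hp h3 =>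
    have := SP.cons (hD _ _ _ (xor τ σ2) h1) hp h3
    simpa [Bool.xor_assoc] using this

structure Sep (g : V → V → Bool → Prop) (A B : Finset V) : Prop where
  cover : ∀ v, v ∈ A ∨ v ∈ B
  edge : ∀ u v σ, g u v σ → (u ∈ A ∧ v ∈ A) ∨ (u ∈ B ∧ v ∈ B)

theorem Sep.symm {A B : Finset V} (h : Sep g A B) : Sep g B A :=
  ⟨fun v => (h.cover v).symm, fun u v σ h' => (h.edge u v σ h').symm⟩

/-- disjoint paths from every vertex of `X` to `Y`, meeting `Y` only at the end -/
def Links (g : V → V → Bool → Prop) (X Y : Finset V) : Prop :=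
  ∃ (S : V → Finset V) (b : V → V) (τ : V → Bool),
    (∀ x ∈ X, SP g x (b x) (τ x) (S x) ∧ b x ∈ Y ∧ ∀ z ∈ S x, z ∈ Y → z = b x) ∧
    ∀ x ∈ X, ∀ x' ∈ X, x ≠ x' → Disjoint (S x) (S x')

theorem Links.mono (hg : ∀ u v σ, g u v σ → g' u v σ) {X Y : Finset V} (h : Links g X Y) :
    Links g' X Y := by
  obtain ⟨S, b, τ, h1, h2⟩ := h
  exact ⟨S, b, τ, fun x hx => ⟨(h1 x hx).1.mono hg, (h1 x hx).2⟩, h2⟩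

/-- without truncation -/
theorem links_of {X Y : Finset V} (S : V → Finset V) (b : V → V) (τ : V → Bool)
    (h1 : ∀ x ∈ X, SP g x (b x) (τ x) (S x) ∧ b x ∈ Y)
    (h2 : ∀ x ∈ X, ∀ x' ∈ X, x ≠ x' → Disjoint (S x) (S x')) : Links g X Y := by
  have : ∀ x, ∃ b' τ' S', x ∈ X → (S' ⊆ S x ∧ SP g x b' τ' S' ∧ b' ∈ Y ∧ ∀ z ∈ S', z ∈ Y → z = b') := by
    intro x
    by_cases hx : x ∈ X
    · obtain ⟨b', τ', S', h⟩ := (h1 x hx).1.trunc Y (h1 x hx).2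
      exact ⟨b', τ', S', fun _ => h⟩
    · exact ⟨x, false, ∅, fun h => absurd h hx⟩
  choose b' τ' S' h using this
  exact ⟨S', b', τ', fun x hx => (h x hx).2, fun x hx x' hx' hne =>
    Finset.disjoint_of_subset_left (h x hx).1 (Finset.disjoint_of_subset_right (h x' hx').1 (h2 x hx x' hx' hne))⟩

end

theorem menger_aux {V : Type} [Fintype V] [DecidableEq V] (n : ℕ) :
    ∀ (g : V → V → Bool → Prop), (∀ u v σ, g u v σ → g v u σ) →
    {p : V × V × Bool | g p.1 p.2.1 p.2.2}.ncard ≤ n →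
    ∀ (X Y : Finset V) (k : ℕ),
    (∀ A B, Sep g A B → X ⊆ A → Y ⊆ B → k ≤ (A ∩ B).card) →
    ∃ X' ⊆ X, X'.card = k ∧ Links g X' Y := by
  induction n with
  | zero =>
    intro g hsym hn X Y k hk
    have hno : ∀ u v σ, ¬ g u v σ := by
      intro u v σ h
      have h0 : {p : V × V × Bool | g p.1 p.2.1 p.2.2}.ncard = 0 := by omega
      rw [Set.ncard_eq_zero] at h0
      have : (u, v, σ) ∈ {p : V × V × Bool | g p.1 p.2.1 p.2.2} := h
      rw [h0] at this; exact this
    have := hk X (Xᶜ ∪ Y) ⟨fun v => by by_cases h : v ∈ X <;> simp [h], fun u v σ h => absurd h (hno _ _ _)⟩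
      subset_rfl Finset.subset_union_right
    obtain ⟨X', hX', hc⟩ := Finset.exists_subset_card_eq this
    refine ⟨X', hX'.trans Finset.inter_subset_left, hc, fun x => {x}, id, fun _ => false, ?_, ?_⟩
    · intro x hx
      have := hX' hx
      simp at this
      refine ⟨.nil x, this.2.resolve_left (fun h => h this.1), by simp⟩
    · intro x _ x' _ h
      simpa using h
  | succ n ih =>
    intro g hsym hn X Y k hk
    by_cases hne : ∃ x y σ, x ≠ y ∧ g x y σ
    swap
    · have := hk X (Xᶜ ∪ Y) ⟨fun v => by by_cases h : v ∈ X <;> simp [h], fun u v σ h => by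
        have : u = v := by by_contra hh; exact hne ⟨u, v, σ, hh, h⟩
        subst this
        by_cases h : u ∈ X <;> simp [h]⟩
        subset_rfl Finset.subset_union_right
      obtain ⟨X', hX', hc⟩ := Finset.exists_subset_card_eq this
      refine ⟨X', hX'.trans Finset.inter_subset_left, hc, fun x => {x}, id, fun _ => false, ?_, ?_⟩
      · intro x hx
        have := hX' hx
        simp at this
        refine ⟨.nil x, this.2.resolve_left (fun h => h this.1), by simp⟩
      · intro x _ x' _ h
        simpa using h
    obtain ⟨x0, y0, σ0, hxy0, hg0⟩ := hne
    let g' : V → V → Bool → Prop := fun u v σ => g u v σ ∧ s(u, v) ≠ s(x0, y0)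
    have hg' : ∀ u v σ, g' u v σ → g u v σ := fun u v σ h => h.1
    have hsym' : ∀ u v σ, g' u v σ → g' v u σ := fun u v σ h => ⟨hsym _ _ _ h.1, by
      rw [Sym2.eq_swap]; exact h.2⟩
    have hn' : {p : V × V × Bool | g' p.1 p.2.1 p.2.2}.ncard ≤ n := by
      have : {p : V × V × Bool | g' p.1 p.2.1 p.2.2}.ncard < {p : V × V × Bool | g p.1 p.2.1 p.2.2}.ncard := by
        apply Set.ncard_lt_ncard _ (Set.toFinite _)
        refine ⟨fun p hp => hp.1, fun h => ?_⟩
        have := @h (x0, y0, σ0) hg0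
        exact this.2 rfl
      omega
    by_cases hk' : ∀ A B, Sep g' A B → X ⊆ A → Y ⊆ B → k ≤ (A ∩ B).card
    · obtain ⟨X', h1, h2, h3⟩ := ih g' hsym' hn' X Y k hk'
      exact ⟨X', h1, h2, h3.mono hg'⟩
    push Not at hk'
    obtain ⟨A, B, hsep, hXA, hYB, hlt⟩ := hk'
    have key : ∃ x y, x ∈ A ∧ x ∉ B ∧ y ∈ B ∧ y ∉ A ∧ g x y σ0 ∧ s(x0, y0) = s(x, y) := by
      by_contra hcon
      have : Sep g A B := by
        refine ⟨hsep.cover, fun u v σ h => ?_⟩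
        by_cases he : s(u, v) = s(x0, y0)
        · have h1 := hsep.cover x0
          have h2 := hsep.cover y0
          have h3 := fun h1 h2 h3 h4 => hcon ⟨x0, y0, h1, h2, h3, h4, hg0, rfl⟩
          have h4 := fun h1 h2 h3 h4 => hcon ⟨y0, x0, h1, h2, h3, h4, hsym _ _ _ hg0, Sym2.eq_swap⟩
          rw [Sym2.eq_iff] at he
          rcases he with ⟨rfl, rfl⟩ | ⟨rfl, rfl⟩ <;> tauto
        · exact hsep.edge u v σ ⟨h, he⟩
      have := hk A B this hXA hYB
      omega
    obtain ⟨x, y, hxA, hxB, hyB, hyA, hgxy, hexy⟩ := key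
    have hcard : (A ∩ B).card + 1 = k := by
      have : Sep g A (insert x B) := by
        refine ⟨fun v => (hsep.cover v).imp_right (Finset.mem_insert_of_mem), fun u v σ h => ?_⟩
        by_cases he : s(u, v) = s(x0, y0)
        · rw [hexy, Sym2.eq_iff] at he
          right
          rcases he with ⟨rfl, rfl⟩ | ⟨rfl, rfl⟩ <;> simp [hyB]
        · rcases hsep.edge u v σ ⟨h, he⟩ with h | h
          · exact .inl h
          · exact .inr ⟨Finset.mem_insert_of_mem h.1, Finset.mem_insert_of_mem h.2⟩
      have := hk _ _ this hXA (hYB.trans (Finset.subset_insert _ _))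
      have h2 : (A ∩ insert x B).card ≤ (A ∩ B).card + 1 := by
        rw [Finset.inter_insert_of_mem hxA]; exact Finset.card_insert_le _ _
      omega
    -- two families
    obtain ⟨X1, hX1, hX1c, S1, b1, τ1, hP1, hd1⟩ := ih g' hsym' hn' X (insert x (A ∩ B)) k (by
      intro A' B' hs' hXA' hB'
      have hABB : ∀ z, z ∈ A → z ∈ B → z ∈ B' := fun z h1 h2 => hB' (by simp [h1, h2])
      have hxB' : x ∈ B' := hB' (by simp)
      have : Sep g (A' ∩ A) (B' ∪ B) := by
        refine ⟨fun v => ?_, fun u v σ h => ?_⟩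
        · have := hsep.cover v
          have := hs'.cover v
          simp; tauto
        · by_cases he : s(u, v) = s(x0, y0)
          · rw [hexy, Sym2.eq_iff] at he
            right
            rcases he with ⟨rfl, rfl⟩ | ⟨rfl, rfl⟩ <;> simp [hyB, hxB']
          · have := hsep.edge u v σ ⟨h, he⟩
            have := hs'.edge u v σ ⟨h, he⟩
            simp; tauto
      refine (hk _ _ this (Finset.subset_inter hXA' hXA) (hYB.trans Finset.subset_union_right)).trans ?_
      apply Finset.card_le_card
      intro z hz
      have := hABB z
      simp at hz ⊢; tauto)
    obtain ⟨X2, hX2, hX2c, S2, b2, τ2, hP2, hd2⟩ := ih g' hsym' hn' (insert y (A ∩ B)) Y k (by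
      intro A' B' hs' hXA' hB'
      have hABB : ∀ z, z ∈ A → z ∈ B → z ∈ A' := fun z h1 h2 => hXA' (by simp [h1, h2])
      have hyA' : y ∈ A' := hXA' (by simp)
      have : Sep g (A' ∪ A) (B' ∩ B) := by
        refine ⟨fun v => ?_, fun u v σ h => ?_⟩
        · have := hsep.cover v
          have := hs'.cover v
          simp; tauto
        · by_cases he : s(u, v) = s(x0, y0)
          · rw [hexy, Sym2.eq_iff] at he
            left
            rcases he with ⟨rfl, rfl⟩ | ⟨rfl, rfl⟩ <;> simp [hxA, hyA']
          · have := hsep.edge u v σ ⟨h, he⟩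
            have := hs'.edge u v σ ⟨h, he⟩
            simp; tauto
      refine (hk _ _ this (hXA.trans Finset.subset_union_right) (Finset.subset_inter hB' hYB)).trans ?_
      apply Finset.card_le_card
      intro z hz
      have := hABB z
      simp at hz ⊢; tauto)
    have hX2e : X2 = insert y (A ∩ B) := by
      apply Finset.eq_of_subset_of_card_le hX2
      rw [hX2c, ← hcard]; exact Finset.card_insert_le _ _
    subst hX2e
    have hS1A : ∀ z ∈ X1, S1 z ⊆ A := by
      intro z hz
      apply (hP1 z hz).1.sub_of_sep hsep.edge (hXA (hX1 hz))
      intro w hw h1 h2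
      exact (hP1 z hz).2.2 w hw (by simp [h1, h2])
    have hself : ∀ z ∈ insert y (A ∩ B), ∀ w ∈ S2 z, w ∈ insert y (A ∩ B) → w = z := by
      intro z hz w hw hw2
      by_contra hne
      have h1 := (hP2 w hw2).1.left_mem
      exact Finset.disjoint_left.1 (hd2 z hz w hw2 (Ne.symm hne)) hw h1
    have hS2B : ∀ z ∈ insert y (A ∩ B), S2 z ⊆ B := by
      intro z hz
      apply ((hP2 z hz).1.reverse hsym').sub_of_sep hsep.symm.edge (hYB (hP2 z hz).2.1)
      intro w hw h1 h2
      exact hself z hz w hw (by simp [h1, h2])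
    let r : V → V := fun z => if b1 z = x then y else b1 z
    have hr : ∀ z ∈ X1, r z ∈ insert y (A ∩ B) := by
      intro z hz
      have := (hP1 z hz).2.1
      by_cases h : b1 z = x
      · simp [r, h]
      · simp [r, h] at this ⊢; tauto
    have hb1inj : ∀ z ∈ X1, ∀ z' ∈ X1, z ≠ z' → b1 z ≠ b1 z' := by
      intro z hz z' hz' hne h
      have h1 := (hP1 z hz).1.right_mem
      have h2 := (hP1 z' hz').1.right_mem
      rw [← h] at h2
      exact Finset.disjoint_left.1 (hd1 z hz z' hz' hne) h1 h2
    have hrinj : ∀ z ∈ X1, ∀ z' ∈ X1, z ≠ z' → r z ≠ r z' := by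
      intro z hz z' hz' hne h
      have h3 := hb1inj z hz z' hz' hne
      have h4 := (hP1 z hz).2.1
      have h5 := (hP1 z' hz').2.1
      have hyAB : y ∉ A ∩ B := by simp [hyA]
      simp only [r] at h
      split_ifs at h with e1 e2 e2
      · exact h3 (e1.trans e2.symm)
      · rw [Finset.mem_insert, ← h] at h5
        exact hyAB (h5.resolve_left (fun h' => e2 (h ▸ h')))
      · rw [Finset.mem_insert, h] at h4
        exact hyAB (h4.resolve_left (fun h' => e1 (h ▸ h')))
      · exact h3 h
    -- intersections
    have hinter : ∀ z ∈ X1, ∀ z' ∈ X1, ∀ w, w ∈ S1 z → w ∈ S2 (r z') → w = b1 z ∧ z = z' := by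
      intro z hz z' hz' w hw hw'
      have hwA := hS1A z hz hw
      have hwB := hS2B _ (hr z' hz') hw'
      have h1 := (hP1 z hz).2.2 w hw (by simp [hwA, hwB])
      have h2 := hself _ (hr z' hz') w hw' (by simp [hwA, hwB])
      refine ⟨h1, ?_⟩
      by_contra hne
      apply hrinj z hz z' hz' hne
      rw [← h2, h1]
      have : b1 z ≠ x := by rw [← h1]; rintro rfl; exact hxB hwB
      simp [r, this]
    have hfin : ∀ z, ∃ τ, z ∈ X1 → SP g z (b2 (r z)) τ (S1 z ∪ S2 (r z)) := by
      intro z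
      by_cases hz : z ∈ X1
      swap
      · exact ⟨false, fun h => absurd h hz⟩
      have hp1 := (hP1 z hz).1.mono hg'
      have hp2 := (hP2 _ (hr z hz)).1.mono hg'
      by_cases hbx : b1 z = x
      · have hrz : r z = y := by simp [r, hbx]
        rw [hrz] at hp2 ⊢
        rw [hbx] at hp1
        have hd : ∀ w, w ∈ S1 z → w ∉ S2 y := by
          intro w hw hw'
          have := hinter z hz z hz w hw (hrz ▸ hw')
          have h2 := hS2B y (by simp) hw'
          rw [this.1, hbx] at h2
          exact hxB h2
        have hp3 := SP.cons hgxy hp2 (fun h => hxB (hS2B y (by simp) h))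
        have := hp1.append hp3 (by
          intro w hw hw'
          rw [Finset.mem_insert] at hw'
          exact hw'.resolve_right (hd w hw))
        have e : S1 z ∪ insert x (S2 y) = S1 z ∪ S2 y := by
          have := hp1.right_mem
          ext w; simp; rintro rfl; exact .inl this
        rw [e] at this
        exact ⟨_, fun _ => this⟩
      · have hrz : r z = b1 z := by simp [r, hbx]
        rw [hrz] at hp2 ⊢
        exact ⟨_, fun _ => hp1.append hp2 (fun w hw hw' => (hinter z hz z hz w hw (hrz ▸ hw')).1)⟩
    choose τ hτ using hfin
    refine ⟨X1, hX1, hX1c, links_of (fun z => S1 z ∪ S2 (r z)) (fun z => b2 (r z)) τ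
      (fun z hz => ⟨hτ z hz, (hP2 _ (hr z hz)).2.1⟩) ?_⟩
    intro z hz z' hz' hne
    rw [Finset.disjoint_left]
    intro w hw hw'
    rw [Finset.mem_union] at hw hw'
    rcases hw with hw | hw <;> rcases hw' with hw' | hw'
    · exact Finset.disjoint_left.1 (hd1 z hz z' hz' hne) hw hw'
    · exact hne (hinter z hz z' hz' w hw hw').2
    · exact hne (hinter z' hz' z hz w hw' hw).2.symm
    · exact Finset.disjoint_left.1 (hd2 _ (hr z hz) _ (hr z' hz') (hrinj z hz z' hz' hne)) hw hw'

/-- Menger's theorem, `X` of size exactly `k` -/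
theorem menger {V : Type} [Fintype V] [DecidableEq V] (g : V → V → Bool → Prop)
    (hsym : ∀ u v σ, g u v σ → g v u σ) (X Y : Finset V)
    (h : ∀ A B, Sep g A B → X ⊆ A → Y ⊆ B → X.card ≤ (A ∩ B).card) : Links g X Y := by
  obtain ⟨X', h1, h2, h3⟩ := menger_aux _ g hsym le_rfl X Y X.card h
  have : X' = X := Finset.eq_of_subset_of_card_le h1 h2.ge
  exact this ▸ h3

end SGP

namespace SGP

/-- system of distinct representatives -/
theorem sdr {ι V : Type} [Fintype ι] [DecidableEq V] (M : ι → Finset V)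
    (h : ∀ i, Fintype.card ι ≤ (M i).card) : ∃ f : ι → V, Function.Injective f ∧ ∀ i, f i ∈ M i := by
  classical
  rw [← Finset.all_card_le_biUnion_card_iff_exists_injective]
  intro s
  rcases s.eq_empty_or_nonempty with rfl | ⟨i, hi⟩
  · simp
  · exact (Finset.card_le_univ s).trans ((h i).trans (Finset.card_le_card (Finset.subset_biUnion_of_mem M hi)))

/-- unsigned paths -/
def PT {V : Type} [DecidableEq V] (D : V → V → Prop) (a b : V) (S : Finset V) : Prop :=
  ∃ σ, SP (fun u v _ => D u v) a b σ S

section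
variable {V : Type} [DecidableEq V] {D : V → V → Prop}

theorem PT.cons {a b c : V} {S : Finset V} (h : D a b) (p : PT D b c S) (ha : a ∉ S) :
    PT D a c (insert a S) := by
  obtain ⟨σ, p⟩ := p
  exact ⟨_, SP.cons (σ := false) (g := fun u v _ => D u v) h p ha⟩

theorem PT.nil (a : V) : PT D a a {a} := ⟨_, .nil a⟩

theorem PT.reverse (hs : ∀ u v, D u v → D v u) {a b : V} {S : Finset V} (p : PT D a b S) :
    PT D b a S := by
  obtain ⟨σ, p⟩ := p
  exact ⟨σ, p.reverse (fun u v _ h => hs u v h)⟩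

theorem PT.ind {P : V → V → Finset V → Prop} (h0 : ∀ a, P a a {a})
    (h1 : ∀ a b c S, D a b → PT D b c S → a ∉ S → P b c S → P a c (insert a S))
    {a b : V} {S : Finset V} (p : PT D a b S) : P a b S := by
  obtain ⟨σ, p⟩ := p
  induction p with
  | nil a => exact h0 a
  | cons h p h3 ih => exact h1 _ _ _ _ h ⟨_, p⟩ h3 ih

variable [DecidableRel D]

theorem PT.attach {a b u : V} {S : Finset V} (p : PT D a b S) (hu : u ∉ S)
    (hm : 1 ≤ (S.filter (D u)).card) :
    ∃ S' ⊆ insert u S, PT D u b S' ∧ S'.card + (S.filter (D u)).card ≤ S.card + 2 := by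
  revert hu hm
  refine PT.ind (P := fun a b S => u ∉ S → 1 ≤ (S.filter (D u)).card →
    ∃ S' ⊆ insert u S, PT D u b S' ∧ S'.card + (S.filter (D u)).card ≤ S.card + 2) ?_ ?_ p
  · intro a hu hm
    have h1 : D u a := by
      by_contra h
      rw [Finset.filter_singleton, if_neg h] at hm
      simp at hm
    refine ⟨insert u {a}, subset_rfl, PT.cons h1 (.nil a) hu, ?_⟩
    rw [Finset.filter_singleton, if_pos h1]
    have := Finset.card_insert_le u {a}
    simp at this ⊢
    omega
  · intro a a' b S hd p ha ih hu hm
    rw [Finset.mem_insert, not_or] at hu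
    have hle : ((insert a S).filter (D u)).card ≤ (S.filter (D u)).card + 1 := by
      rw [Finset.filter_insert]
      split_ifs
      · exact Finset.card_insert_le _ _
      · omega
    by_cases h1 : 1 ≤ (S.filter (D u)).card
    · obtain ⟨S', hs, hp, hc⟩ := ih hu.2 h1
      refine ⟨S', hs.trans (Finset.insert_subset_insert _ (Finset.subset_insert _ _)), hp, ?_⟩
      rw [Finset.card_insert_of_notMem ha]
      omega
    · have h2 : D u a := by
        by_contra h
        rw [Finset.filter_insert, if_neg h] at hm
        exact h1 hm
      refine ⟨insert u (insert a S), subset_rfl, PT.cons h2 (PT.cons hd p ha) (by simp [hu]), ?_⟩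
      have := Finset.card_insert_le u (insert a S)
      omega

theorem PT.shortcut (hsym : ∀ u v, D u v → D v u) {a b u : V} {S : Finset V} (p : PT D a b S) (hu : u ∉ S)
    (hm : 1 ≤ (S.filter (D u)).card) :
    ∃ S' ⊆ insert u S, PT D a b S' ∧ S'.card + (S.filter (D u)).card ≤ S.card + 3 := by
  revert hu hm
  refine PT.ind (P := fun a b S => u ∉ S → 1 ≤ (S.filter (D u)).card →
    ∃ S' ⊆ insert u S, PT D a b S' ∧ S'.card + (S.filter (D u)).card ≤ S.card + 3) ?_ ?_ p
  · intro a hu hm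
    refine ⟨{a}, by simp, .nil a, ?_⟩
    have := Finset.card_filter_le {a} (D u)
    simp at this ⊢
    omega
  · intro a a' b S hd p ha ih hu hm
    rw [Finset.mem_insert, not_or] at hu
    have hc := Finset.card_insert_of_notMem ha
    rw [Finset.filter_insert] at hm ⊢
    by_cases h2 : D u a
    · rw [if_pos h2] at hm ⊢
      rw [Finset.card_insert_of_notMem (by simp [ha])]
      by_cases h1 : 1 ≤ (S.filter (D u)).card
      · obtain ⟨S', hs, hp, hc'⟩ := p.attach hu.2 h1
        have haS' : a ∉ S' := fun h => by
          have := hs h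
          rw [Finset.mem_insert] at this
          rcases this with h | h
          · exact hu.1 h.symm
          · exact ha h
        refine ⟨insert a S', ?_, PT.cons (hsym _ _ h2) hp haS', ?_⟩
        · rw [Finset.insert_comm]; exact Finset.insert_subset_insert _ hs
        · have := Finset.card_insert_le a S'
          omega
      · exact ⟨insert a S, Finset.subset_insert _ _, PT.cons hd p ha, by omega⟩
    · rw [if_neg h2] at hm ⊢
      obtain ⟨S', hs, hp, hc'⟩ := ih hu.2 hm
      have haS' : a ∉ S' := fun h => by
          have := hs h
          rw [Finset.mem_insert] at this
          rcases this with h | h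
          · exact hu.1 h.symm
          · exact ha h
      refine ⟨insert a S', ?_, PT.cons hd hp haS', ?_⟩
      · rw [Finset.insert_comm]; exact Finset.insert_subset_insert _ hs
      · have := Finset.card_insert_le a S'
        omega

/-- every choice of terminals in `L` can be linked inside `L` -/
def NLinked (D : V → V → Prop) (ι : Type) [Fintype ι] (L : Finset V) : Prop :=
  2 * Fintype.card ι ≤ L.card ∧ ∀ x : ι × Bool → V, Function.Injective x → (∀ p, x p ∈ L) →
    ∃ S : ι → Finset V, (∀ i, S i ⊆ L ∧ PT D (x (i, false)) (x (i, true)) (S i)) ∧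
      ∀ i j, i ≠ j → Disjoint (S i) (S j)

theorem nlinked_of_dense (hsym : ∀ u v, D u v → D v u) (hirr : ∀ v, ¬ D v v) (ι : Type) [Fintype ι]
    (C : Finset V) (hC : 2 * Fintype.card ι ≤ C.card)
    (hdeg : ∀ v ∈ C, C.card + 3 * Fintype.card ι ≤ 2 * (C.filter (D v)).card + 2) :
    NLinked D ι C := by
  classical
  refine ⟨hC, fun x hx hxC => ?_⟩
  let T : Finset V := Finset.univ.image x
  have hT : T.card = 2 * Fintype.card ι := by
    rw [Finset.card_image_of_injective _ hx, Finset.card_univ, Fintype.card_prod, Fintype.card_bool, mul_comm]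
  obtain ⟨f, hf, hfM⟩ := sdr (fun i => ((C.filter (D (x (i, false)))) ∩ (C.filter (D (x (i, true))))) \ T) (by
    intro i
    have ha := hdeg _ (hxC (i, false))
    have hb := hdeg _ (hxC (i, true))
    set Na := C.filter (D (x (i, false)))
    set Nb := C.filter (D (x (i, true)))
    have h1 : (Na ∪ Nb).card ≤ C.card := Finset.card_le_card (by
      intro z hz; simp [Na, Nb] at hz; tauto)
    have h2 := Finset.card_union_add_card_inter Na Nb
    have h3 : (Na ∩ Nb) \ T = (Na ∩ Nb) \ (T \ {x (i, false), x (i, true)}) := by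
      ext z
      simp only [Finset.mem_sdiff, Finset.mem_inter, Finset.mem_insert, Finset.mem_singleton, Na, Nb, Finset.mem_filter]
      constructor
      · tauto
      · rintro ⟨h, h'⟩
        refine ⟨h, fun hz => h' ⟨hz, ?_⟩⟩
        rintro (rfl | rfl)
        · exact hirr _ h.1.2
        · exact hirr _ h.2.2
    rw [h3]
    have h4 := Finset.le_card_sdiff (T \ {x (i, false), x (i, true)}) (Na ∩ Nb)
    have h5 : (T \ {x (i, false), x (i, true)}).card + 2 = T.card := by
      rw [← Finset.card_pair (a := x (i, false)) (b := x (i, true)) (fun h => by simpa using hx h)]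
      apply Finset.card_sdiff_add_card_eq_card
      intro z hz
      simp at hz
      rcases hz with rfl | rfl <;> simp [T]
    omega)
  simp only [Finset.mem_sdiff, Finset.mem_inter, Finset.mem_filter] at hfM
  refine ⟨fun i => {x (i, false), f i, x (i, true)}, fun i => ⟨?_, ?_⟩, ?_⟩
  · intro z hz
    simp at hz
    rcases hz with rfl | rfl | rfl
    · exact hxC _
    · exact (hfM i).1.1.1
    · exact hxC _
  · have h1 : f i ∉ T := (hfM i).2
    have h2 : ∀ p, x p ∈ T := fun p => Finset.mem_image_of_mem _ (Finset.mem_univ _)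
    refine PT.cons (hfM i).1.1.2 (PT.cons (hsym _ _ (hfM i).1.2.2) (.nil _) ?_) ?_
    · simp; intro h; exact h1 (h ▸ h2 _)
    · simp; refine ⟨fun h => h1 (h ▸ h2 _), fun h => by simpa using hx h⟩
  · intro i j hij
    have h1 : ∀ i, f i ∉ T := fun i => (hfM i).2
    have h2 : ∀ p, x p ∈ T := fun p => Finset.mem_image_of_mem _ (Finset.mem_univ _)
    rw [Finset.disjoint_left]
    intro z hz hz'
    simp at hz hz'
    have hne : ∀ i p, f i ≠ x p := fun i p h => h1 i (h ▸ h2 p)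
    rcases hz with rfl | rfl | rfl <;> rcases hz' with h | h | h
    · exact hij (by simpa using hx h)
    · exact hne _ _ h.symm
    · simpa using hx h
    · exact hne _ _ h
    · exact hij (hf h)
    · exact hne _ _ h
    · simpa using hx h
    · exact hne _ _ h.symm
    · exact hij (by simpa using hx h)

end

end SGP

namespace SGP

section
variable {V : Type} [DecidableEq V] {D : V → V → Prop} [DecidableRel D]

/-- a partial linkage of the terminals `x` in `W` by short paths -/
structure PLink (D : V → V → Prop) {ι : Type} (W : Finset V) (x : ι × Bool → V)
    (J : Finset ι) (S : ι → Finset V) : Prop where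
  sub : ∀ i, S i ⊆ W
  disj : ∀ i j, i ≠ j → Disjoint (S i) (S j)
  path : ∀ i ∈ J, PT D (x (i, false)) (x (i, true)) (S i) ∧ (S i).card ≤ 8
  un : ∀ i, i ∉ J → S i = {x (i, false), x (i, true)}

theorem exists_nlinked [Fintype V] (hsym : ∀ u v, D u v → D v u) (hirr : ∀ v, ¬ D v v)
    (ι : Type) [Fintype ι] (W : Finset V) (r N : ℕ) (hN : N = Fintype.card ι) (hNpos : 1 ≤ N)
    (hW : W.Nonempty) (hr : r ≤ 2 * N)
    (hc : W.card + r + 5 ≤ 22 * N) (hdeg : ∀ v ∈ W, 11 * N ≤ (W.filter (D v)).card + r + 2) :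
    ∃ L ⊆ W, NLinked D ι L := by
  classical
  by_cases hlink : NLinked D ι W
  · exact ⟨W, subset_rfl, hlink⟩
  have hWc : 2 * N ≤ W.card := by
    obtain ⟨v, hv⟩ := hW
    have := hdeg v hv
    have := Finset.card_filter_le W (D v)
    omega
  unfold NLinked at hlink
  rw [← hN] at hlink
  simp only [hWc, true_and] at hlink
  push Not at hlink
  obtain ⟨x, hx, hxW, hno⟩ := hlink
  -- extremal partial linkage
  obtain ⟨⟨J0, S0⟩, hmem0, hmax0⟩ := Set.exists_max_image
    {p : Finset ι × (ι → Finset V) | PLink D W x p.1 p.2} (fun p => p.1.card) (Set.toFinite _)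
    ⟨(∅, fun i => {x (i, false), x (i, true)}), by
      refine ⟨fun i z hz => ?_, fun i j hij => ?_, by simp, by simp⟩
      · simp at hz
        rcases hz with rfl | rfl <;> exact hxW _
      · rw [Finset.disjoint_left]
        intro z hz hz'
        simp at hz hz'
        rcases hz with rfl | rfl <;> rcases hz' with h | h <;> exact hij (by simpa using congrArg Prod.fst (hx h))⟩
  obtain ⟨⟨J, S⟩, ⟨hmem, hJ⟩, hmin⟩ := Set.exists_min_image
    {p : Finset ι × (ι → Finset V) | PLink D W x p.1 p.2 ∧ p.1.card = J0.card} (fun p => ∑ i, (p.2 i).card)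
    (Set.toFinite _) ⟨(J0, S0), hmem0, rfl⟩
  have hmax : ∀ J' S', PLink D W x J' S' → J'.card ≤ J.card := fun J' S' h => by
    have := hmax0 (J', S') h
    simp only at this hJ
    omega
  replace hmin : ∀ S', PLink D W x J S' → ∑ i, (S i).card ≤ ∑ i, (S' i).card := fun S' h =>
    hmin (J, S') ⟨h, hJ⟩
  simp only at hmem
  clear hmax0 hmem0 hJ
  obtain ⟨i0, hi0⟩ : ∃ i0, i0 ∉ J := by
    by_contra h
    push Not at h
    obtain ⟨i, j, hij, hd⟩ := hno S (fun i => ⟨hmem.sub i, (hmem.path i (h i)).1⟩)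
    exact hd (hmem.disj i j hij)
  set a := x (i0, false) with ha
  set b := x (i0, true) with hb
  have hS0 : S i0 = {a, b} := hmem.un i0 hi0
  have hxS : ∀ i c, x (i, c) ∈ S i := by
    intro i c
    by_cases h : i ∈ J
    · obtain ⟨σ, hp⟩ := (hmem.path i h).1
      cases c
      · exact hp.left_mem
      · exact hp.right_mem
    · rw [hmem.un i h]; cases c <;> simp
  have hS2 : ∀ i, 2 ≤ (S i).card := by
    intro i
    have : ({x (i, false), x (i, true)} : Finset V).card = 2 :=
      Finset.card_pair (fun h => by simpa using hx h)
    rw [← this]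
    apply Finset.card_le_card
    intro z hz
    simp at hz
    rcases hz with rfl | rfl <;> exact hxS _ _
  have hS8 : ∀ i, (S i).card ≤ 8 := by
    intro i
    by_cases h : i ∈ J
    · exact (hmem.path i h).2
    · rw [hmem.un i h]
      have := Finset.card_le_two (a := x (i, false)) (b := x (i, true))
      omega
  set U := Finset.univ.biUnion S with hU
  set W' := W \ U with hW'
  have hUW : U ⊆ W := by
    intro z hz
    simp [U] at hz
    obtain ⟨i, hi⟩ := hz
    exact hmem.sub i hi
  have hUc : 2 * N ≤ U.card := by
    rw [hU, Finset.card_biUnion (fun i _ j _ hij => hmem.disj i j hij)]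
    have := Finset.sum_le_sum (fun i (_ : i ∈ Finset.univ) => hS2 i)
    simp at this
    omega
  have hW'c : W'.card + r + 5 ≤ 20 * N := by
    have := Finset.card_sdiff_add_card_eq_card hUW
    rw [← hW'] at this
    omega
  -- degree splitting
  have hsplit : ∀ u (w : ℕ → ℕ), (W.filter (D u)).card ≤ (W'.filter (D u)).card + ∑ i, ((S i).filter (D u)).card := by
    intro u _
    have h1 : W.filter (D u) ⊆ W'.filter (D u) ∪ Finset.univ.biUnion (fun i => (S i).filter (D u)) := by
      intro z hz
      simp only [Finset.mem_filter] at hz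
      by_cases h : z ∈ U
      · obtain ⟨i, hi⟩ : ∃ i, z ∈ S i := by simpa [U] using h
        simp; right; exact ⟨⟨i, hi⟩, hz.2⟩
      · simp [W', h, hz]
    refine (Finset.card_le_card h1).trans ((Finset.card_union_le _ _).trans ?_)
    have := Finset.card_biUnion_le (s := Finset.univ) (t := fun i => (S i).filter (D u))
    omega
  have hsum : ∀ (f : ι → ℕ) (m c : ℕ), (∀ i, f i ≤ m) → f i0 ≤ c → ∑ i, f i + m ≤ m * N + c := by
    intro f m c h1 h2
    rw [← Finset.add_sum_erase _ _ (Finset.mem_univ i0)]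
    have h3 := Finset.sum_le_card_nsmul (Finset.univ.erase i0) f m (fun i _ => h1 i)
    rw [Finset.card_erase_of_mem (Finset.mem_univ _), Finset.card_univ, ← hN, smul_eq_mul] at h3
    obtain ⟨N', rfl⟩ : ∃ N', N = N' + 1 := ⟨N - 1, by omega⟩
    simp only [Nat.add_sub_cancel] at h3
    nlinarith
  have hdegW' : ∀ u ∈ W', 8 * N ≤ (W'.filter (D u)).card + r + 1 := by
    intro u hu
    have huW : u ∈ W := (Finset.mem_sdiff.1 hu).1
    have huU : ∀ i, u ∉ S i := fun i h => (Finset.mem_sdiff.1 hu).2 (by simp [U]; exact ⟨i, h⟩)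
    have h1 := hdeg u huW
    have h2 := hsplit u id
    have h3 := hsum (fun i => ((S i).filter (D u)).card) 3 2 (fun i => by
      by_cases hiJ : i ∈ J
      swap
      · refine (Finset.card_filter_le _ _).trans ?_
        rw [hmem.un i hiJ]
        have := Finset.card_le_two (a := x (i, false)) (b := x (i, true))
        omega
      by_contra hcon
      push Not at hcon
      obtain ⟨S', hs, hp, hc'⟩ := (hmem.path i hiJ).1.shortcut hsym (huU i) (by omega)
      have hlt : S'.card < (S i).card := by omega
      have hnew : PLink D W x J (Function.update S i S') := by
        have hdisj : ∀ j, j ≠ i → Disjoint S' (S j) := by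
          intro j hj
          refine Finset.disjoint_of_subset_left hs ?_
          rw [Finset.disjoint_insert_left]
          exact ⟨huU j, hmem.disj i j (Ne.symm hj)⟩
        refine ⟨fun j => ?_, fun j j' hjj => ?_, fun j hj => ?_, fun j hj => ?_⟩
        · by_cases hji : j = i
          · subst hji
            simp only [Function.update_self]
            exact hs.trans (Finset.insert_subset huW (hmem.sub j))
          · rw [Function.update_of_ne hji]; exact hmem.sub j
        · by_cases h1 : j = i
          · subst h1
            rw [Function.update_self, Function.update_of_ne (Ne.symm hjj)]
            exact hdisj j' (Ne.symm hjj)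
          · by_cases h2 : j' = i
            · subst h2
              rw [Function.update_self, Function.update_of_ne hjj]
              exact (hdisj j hjj).symm
            · rw [Function.update_of_ne h1, Function.update_of_ne h2]
              exact hmem.disj j j' hjj
        · by_cases hji : j = i
          · subst hji
            simp only [Function.update_self]
            exact ⟨hp, by have := hS8 j; omega⟩
          · rw [Function.update_of_ne hji]; exact hmem.path j hj
        · rw [Function.update_of_ne (by rintro rfl; exact hj hiJ)]; exact hmem.un j hj
      have := hmin _ hnew
      have h5 : ∑ j, (Function.update S i S' j).card < ∑ j, (S j).card := by
        apply Finset.sum_lt_sum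
        · intro j _
          by_cases hji : j = i
          · subst hji; simp only [Function.update_self]; omega
          · rw [Function.update_of_ne hji]
        · exact ⟨i, Finset.mem_univ _, by simp only [Function.update_self]; omega⟩
      omega) (by
        refine (Finset.card_filter_le _ _).trans ?_
        rw [hS0]
        exact Finset.card_le_two)
    omega
  have hnbr : ∀ c, ∃ u ∈ W', D (x (i0, c)) u := by
    intro c
    have h1 := hdeg _ (hxW (i0, c))
    have h2 := hsplit (x (i0, c)) id
    have h3 := hsum (fun i => ((S i).filter (D (x (i0, c)))).card) 8 1 (fun i =>
      (Finset.card_filter_le _ _).trans (hS8 i)) (by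
        have : (S i0).filter (D (x (i0, c))) ⊆ {x (i0, !c)} := by
          intro z hz
          rw [hmem.un i0 hi0] at hz
          simp only [Finset.mem_filter, Finset.mem_insert, Finset.mem_singleton] at hz ⊢
          obtain ⟨rfl | rfl, h2⟩ := hz <;> cases c <;> first | rfl | exact absurd h2 (hirr _)
        simpa using Finset.card_le_card this)
    have h4 : 0 < (W'.filter (D (x (i0, c)))).card := by omega
    obtain ⟨u, hu⟩ := Finset.card_pos.1 h4
    simp at hu
    exact ⟨u, hu⟩
  have haW' : a ∉ W' := fun h => (Finset.mem_sdiff.1 h).2 (by simp [U]; exact ⟨i0, hxS _ _⟩)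
  have hbW' : b ∉ W' := fun h => (Finset.mem_sdiff.1 h).2 (by simp [U]; exact ⟨i0, hxS _ _⟩)
  have hab : a ≠ b := fun h => by simpa using hx h
  -- balls around `a`
  let R : ℕ → Finset V := fun j => W'.filter (fun u => ∃ T ⊆ insert a W', T.card ≤ j + 2 ∧ PT D u a T)
  have hRW : ∀ j, R j ⊆ W' := fun j => Finset.filter_subset _ _
  have hRmono : ∀ j j', j ≤ j' → R j ⊆ R j' := by
    intro j j' hj u hu
    simp only [R, Finset.mem_filter] at hu ⊢
    obtain ⟨h1, T, h2, h3, h4⟩ := hu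
    exact ⟨h1, T, h2, by omega, h4⟩
  have hRstep : ∀ j u v, u ∈ R j → v ∈ W' → D v u → v ∈ R (j + 1) := by
    intro j u v hu hv huv
    simp only [R, Finset.mem_filter] at hu ⊢
    obtain ⟨h1, T, h2, h3, h4⟩ := hu
    refine ⟨hv, ?_⟩
    by_cases hvT : v ∈ T
    · obtain ⟨σ, hp⟩ := h4
      obtain ⟨τ, T', hT', hp'⟩ := hp.suffix hvT
      exact ⟨T', hT'.trans h2, by have := Finset.card_le_card hT'; omega, τ, hp'⟩
    · refine ⟨insert v T, Finset.insert_subset (Finset.mem_insert_of_mem hv) h2, ?_, PT.cons huv h4 hvT⟩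
      have := Finset.card_insert_le v T
      omega
  have hb5 : ∀ u ∈ R 5, ¬ D b u := by
    intro u hu hbu
    simp only [R, Finset.mem_filter] at hu
    obtain ⟨h1, T, h2, h3, h4⟩ := hu
    have hbT : b ∉ T := fun h => by
      have := h2 h
      rw [Finset.mem_insert] at this
      rcases this with h | h
      · exact hab h.symm
      · exact hbW' h
    have hp := (PT.cons hbu h4 hbT).reverse hsym
    have hsubW : insert b T ⊆ W := by
      refine Finset.insert_subset (hxW _) (h2.trans (Finset.insert_subset (hxW _) Finset.sdiff_subset))
    have hdisj : ∀ j, j ≠ i0 → Disjoint (insert b T) (S j) := by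
      intro j hj
      rw [Finset.disjoint_left]
      intro z hz hzj
      have h5 : z ∈ S i0 ∨ z ∈ W' := by
        rw [Finset.mem_insert] at hz
        rcases hz with rfl | hz
        · exact .inl (hxS _ _)
        · have := h2 hz
          rw [Finset.mem_insert] at this
          rcases this with rfl | h
          · exact .inl (hxS _ _)
          · exact .inr h
      rcases h5 with h5 | h5
      · exact Finset.disjoint_left.1 (hmem.disj i0 j (Ne.symm hj)) h5 hzj
      · exact (Finset.mem_sdiff.1 h5).2 (by simp [U]; exact ⟨j, hzj⟩)
    have := hmax (insert i0 J) (Function.update S i0 (insert b T)) (by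
      refine ⟨fun j => ?_, fun j j' hjj => ?_, fun j hj => ?_, fun j hj => ?_⟩
      · by_cases hji : j = i0
        · subst hji; simp only [Function.update_self]; exact hsubW
        · rw [Function.update_of_ne hji]; exact hmem.sub j
      · by_cases h1 : j = i0
        · subst h1
          rw [Function.update_self, Function.update_of_ne (Ne.symm hjj)]
          exact hdisj j' (Ne.symm hjj)
        · by_cases h2 : j' = i0
          · subst h2
            rw [Function.update_self, Function.update_of_ne hjj]
            exact (hdisj j hjj).symm
          · rw [Function.update_of_ne h1, Function.update_of_ne h2]
            exact hmem.disj j j' hjj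
      · by_cases hji : j = i0
        · subst hji; simp only [Function.update_self]
          exact ⟨hp, by have := Finset.card_insert_le b T; omega⟩
        · rw [Function.update_of_ne hji]
          exact hmem.path j ((Finset.mem_insert.1 hj).resolve_left hji)
      · rw [Finset.mem_insert, not_or] at hj
        rw [Function.update_of_ne hj.1]
        exact hmem.un j hj.2)
    rw [Finset.card_insert_of_notMem hi0] at this
    omega
  obtain ⟨p1, hp1W, hp1⟩ := hnbr false
  obtain ⟨w, hwW, hw⟩ := hnbr true
  have hp1R : p1 ∈ R 0 := by
    simp only [R, Finset.mem_filter]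
    refine ⟨hp1W, insert p1 {a}, ?_, ?_, PT.cons (hsym _ _ hp1) (.nil a) ?_⟩
    · intro z hz; simp at hz; rcases hz with rfl | rfl <;> simp [hp1W]
    · have := Finset.card_insert_le p1 {a}
      simpa using this
    · simp; rintro rfl; exact haW' hp1W
  have hwR : w ∉ R 5 := fun h => hb5 w h hw
  have hclosed : R 3 ⊆ R 2 := by
    by_contra hcon
    rw [Finset.not_subset] at hcon
    obtain ⟨z, hz3, hz2⟩ := hcon
    have hzW := hRW _ hz3
    let Nb : V → Finset V := fun u => insert u (W'.filter (D u))
    have hNb : ∀ u ∈ W', 8 * N ≤ (Nb u).card + r := by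
      intro u hu
      have := hdegW' u hu
      have h2 : (Nb u).card = (W'.filter (D u)).card + 1 := by
        apply Finset.card_insert_of_notMem
        simp [hirr]
      omega
    have hNbW : ∀ u ∈ W', Nb u ⊆ W' := fun u hu => Finset.insert_subset hu (Finset.filter_subset _ _)
    have hNbR : ∀ u v j, u ∈ W' → v ∈ Nb u → v ∈ R j → u ∈ R (j + 1) := by
      intro u v j hu hv hvR
      rw [Finset.mem_insert, Finset.mem_filter] at hv
      rcases hv with rfl | hv
      · exact hRmono j (j + 1) (by omega) hvR
      · exact hRstep j v u hvR hu hv.2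
    have hNbR' : ∀ u v j, u ∈ R j → v ∈ Nb u → v ∈ R (j + 1) := by
      intro u v j hu hv
      have hv' := hNbW u (hRW _ hu) hv
      rw [Finset.mem_insert, Finset.mem_filter] at hv
      rcases hv with rfl | hv
      · exact hRmono j (j + 1) (by omega) hu
      · exact hRstep j u v hu hv' (hsym _ _ hv.2)
    have d1 : Disjoint (Nb p1) (Nb z) := by
      rw [Finset.disjoint_left]
      intro v h1 h2
      exact hz2 (hNbR z v 1 hzW h2 (hNbR' p1 v 0 hp1R h1))
    have d2 : Disjoint (Nb p1 ∪ Nb z) (Nb w) := by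
      rw [Finset.disjoint_left]
      intro v h1 h2
      apply hwR
      apply hNbR w v 4 hwW h2
      rw [Finset.mem_union] at h1
      rcases h1 with h1 | h1
      · exact hRmono 1 4 (by omega) (hNbR' p1 v 0 hp1R h1)
      · exact hNbR' z v 3 hz3 h1
    have h1 := Finset.card_union_of_disjoint d1
    have h2 := Finset.card_union_of_disjoint d2
    have h3 : (Nb p1 ∪ Nb z ∪ Nb w).card ≤ W'.card := Finset.card_le_card
      (Finset.union_subset (Finset.union_subset (hNbW _ hp1W) (hNbW _ hzW)) (hNbW _ hwW))
    have := hNb p1 hp1W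
    have := hNb z hzW
    have := hNb w hwW
    omega
  -- the smaller side
  have hcl : ∀ u ∈ R 2, ∀ v ∈ W', D u v → v ∈ R 2 := fun u hu v hv huv =>
    hclosed (hRstep 2 u v hu hv (hsym _ _ huv))
  have hfin : ∀ C : Finset V, C ⊆ W' → C.Nonempty → (∀ u ∈ C, ∀ v ∈ W', D u v → v ∈ C) →
      2 * C.card ≤ W'.card → NLinked D ι C := by
    intro C hCW hCne hCcl hC2
    have hd : ∀ u ∈ C, C.filter (D u) = W'.filter (D u) := by
      intro u hu
      ext v
      simp only [Finset.mem_filter]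
      exact ⟨fun h => ⟨hCW h.1, h.2⟩, fun h => ⟨hCcl u hu v h.1 h.2, h.2⟩⟩
    obtain ⟨u0, hu0⟩ := hCne
    apply nlinked_of_dense hsym hirr
    · have h1 := hdegW' u0 (hCW hu0)
      rw [← hd u0 hu0] at h1
      have h2 : (C.filter (D u0)).card ≤ C.card := Finset.card_filter_le _ _
      omega
    · intro v hv
      have h1 := hdegW' v (hCW hv)
      rw [hd v hv]
      omega
  have hsub : W' ⊆ W := Finset.sdiff_subset
  by_cases hsm : 2 * (R 2).card ≤ W'.card
  · exact ⟨R 2, (hRW _).trans hsub, hfin (R 2) (hRW _) ⟨p1, hRmono 0 2 (by omega) hp1R⟩ hcl hsm⟩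
  · refine ⟨W' \ R 2, Finset.sdiff_subset.trans hsub, hfin _ Finset.sdiff_subset ⟨w, ?_⟩ ?_ ?_⟩
    · exact Finset.mem_sdiff.2 ⟨hwW, fun h => hwR (hRmono 2 5 (by omega) h)⟩
    · intro u hu v hv huv
      rw [Finset.mem_sdiff] at hu ⊢
      exact ⟨hv, fun h => hu.2 (hcl v h u hu.1 (hsym _ _ huv))⟩
    · have := Finset.card_sdiff_add_card_eq_card (hRW 2)
      omega

end

end SGP

namespace SGP

section
variable {V : Type} [DecidableEq V] {g : V → V → Bool → Prop}

theorem SP.map {κ : Type} [DecidableEq κ] {h : κ → κ → Bool → Prop} (c : κ → V) {a b : κ} {σ : Bool} {S : Finset κ}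
    (p : SP h a b σ S) (hinj : ∀ u ∈ S, ∀ v ∈ S, c u = c v → u = v)
    (hm : ∀ u ∈ S, ∀ v ∈ S, ∀ σ, h u v σ → g (c u) (c v) σ) : SP g (c a) (c b) σ (S.image c) := by
  induction p with
  | nil a => simpa using SP.nil (c a)
  | @cons a a' b σ τ S h1 hp h3 ih =>
    rw [Finset.image_insert]
    refine .cons (hm a (by simp) a' (by simp [hp.left_mem]) _ h1)
      (ih (fun u hu v hv => hinj u (by simp [hu]) v (by simp [hv]))
        (fun u hu v hv => hm u (by simp [hu]) v (by simp [hv]))) ?_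
    intro h
    rw [Finset.mem_image] at h
    obtain ⟨z, hz, hz'⟩ := h
    have := hinj z (by simp [hz]) a (by simp) hz'
    exact h3 (this ▸ hz)

theorem SP.sub_of_edges {B : Finset V} (he : ∀ u v σ, g u v σ → u ∈ B ∧ v ∈ B) {a b : V} {σ : Bool}
    {S : Finset V} (h : SP g a b σ S) (ha : a ∈ B) : S ⊆ B := by
  induction h with
  | nil a => simpa using ha
  | cons h1 _ _ ih => exact Finset.insert_subset ha (ih (he _ _ _ h1).2)

/-- lifting a path along a contraction -/
theorem SP.lift {g' : V → V → Bool → Prop} (π : V → V)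
    (hπ : ∀ p q, π p = π q → p ≠ q → g p q false)
    (hg' : ∀ u v σ, g' u v σ → ∃ u0 v0, π u0 = u ∧ π v0 = v ∧ g u0 v0 σ)
    {a b : V} {σ : Bool} {S : Finset V} (p : SP g' a b σ S) :
    ∀ a0 b0, π a0 = a → π b0 = b → ∃ T : Finset V, (∀ z ∈ T, π z ∈ S) ∧ SP g a0 b0 σ T := by
  induction p with
  | nil a =>
    rintro a0 b0 h1 h2
    by_cases h : a0 = b0
    · subst h; exact ⟨{a0}, by simp [h1], .nil a0⟩
    · exact ⟨{a0, b0}, by simp [h1, h2], SP.single (hπ _ _ (h1.trans h2.symm) h) h⟩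
  | @cons a a' b σ τ S h1 hp h3 ih =>
    intro a0 b0 ha0 hb0
    obtain ⟨a1, a1', e1, e2, hg⟩ := hg' _ _ _ h1
    obtain ⟨T, hT, hp'⟩ := ih a1' b0 e2 hb0
    have h4 : ∀ z, π z = a → z ∉ T := fun z hz hzT => h3 (hz ▸ hT z hzT)
    have hp1 := SP.cons hg hp' (h4 a1 e1)
    by_cases h : a0 = a1
    · subst h
      refine ⟨_, ?_, hp1⟩
      intro z hz
      rw [Finset.mem_insert] at hz ⊢
      rcases hz with rfl | hz
      · exact .inl ha0
      · exact .inr (hT z hz)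
    · have hp2 := SP.cons (hπ a0 a1 (ha0.trans e1.symm) h) hp1 (by
        rw [Finset.mem_insert, not_or]; exact ⟨h, h4 a0 ha0⟩)
      rw [Bool.false_xor] at hp2
      refine ⟨_, ?_, hp2⟩
      intro z hz
      rw [Finset.mem_insert, Finset.mem_insert] at hz
      rw [Finset.mem_insert]
      rcases hz with rfl | rfl | hz
      · exact .inl ha0
      · exact .inl e1
      · exact .inr (hT z hz)

/-- the terminals can be linked with arbitrary signs -/
def Linked {ι : Type} (g : V → V → Bool → Prop) (x : ι × Bool → V) : Prop :=
  ∀ σ : ι → Bool, ∃ S : ι → Finset V, (∀ i, SP g (x (i, false)) (x (i, true)) (σ i) (S i)) ∧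
    ∀ i j, i ≠ j → Disjoint (S i) (S j)

theorem join_links {ι : Type} (hsym : ∀ u v σ, g u v σ → g v u σ) (x : ι × Bool → V)
    (hx : Function.Injective x) (P : V → Finset V) (b : V → V) (τ : V → Bool) (Y : Finset V)
    (hP : ∀ p, SP g (x p) (b (x p)) (τ (x p)) (P (x p)) ∧ b (x p) ∈ Y ∧ ∀ z ∈ P (x p), z ∈ Y → z = b (x p))
    (hPd : ∀ p q, p ≠ q → Disjoint (P (x p)) (P (x q)))
    (σ : ι → Bool) (S' : ι → Finset V)
    (hS' : ∀ i, SP g (b (x (i, false))) (b (x (i, true)))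
      (xor (τ (x (i, false))) (xor (σ i) (τ (x (i, true))))) (S' i))
    (hS'd : ∀ i j, i ≠ j → Disjoint (S' i) (S' j))
    (hmeet : ∀ p i z, z ∈ P (x p) → z ∈ S' i → z ∈ Y) :
    ∃ S : ι → Finset V, (∀ i, SP g (x (i, false)) (x (i, true)) (σ i) (S i)) ∧
      ∀ i j, i ≠ j → Disjoint (S i) (S j) := by
  have hbS' : ∀ i c, b (x (i, c)) ∈ S' i := by
    intro i c
    cases c
    · exact (hS' i).left_mem
    · exact (hS' i).right_mem
  have hPS : ∀ p i z, z ∈ P (x p) → z ∈ S' i → z = b (x p) ∧ p.1 = i := by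
    intro p i z h1 h2
    have h3 := (hP p).2.2 z h1 (hmeet p i z h1 h2)
    refine ⟨h3, ?_⟩
    by_contra hne
    exact Finset.disjoint_left.1 (hS'd _ _ hne) (hbS' p.1 p.2) (h3 ▸ h2)
  refine ⟨fun i => P (x (i, false)) ∪ (S' i ∪ P (x (i, true))), fun i => ?_, fun i j hij => ?_⟩
  · have h1 := (hS' i).append ((hP (i, true)).1.reverse hsym) (fun z hz hz' => (hPS (i, true) i z hz' hz).1)
    have h2 := (hP (i, false)).1.append h1 (fun z hz hz' => by
      rw [Finset.mem_union] at hz'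
      rcases hz' with hz' | hz'
      · exact (hPS (i, false) i z hz hz').1
      · exact absurd hz' (Finset.disjoint_left.1 (hPd (i, false) (i, true) (by simp)) hz))
    have e : (xor (τ (x (i, false))) (xor (xor (τ (x (i, false))) (xor (σ i) (τ (x (i, true))))) (τ (x (i, true))))) = σ i := by
      cases τ (x (i, false)) <;> cases τ (x (i, true)) <;> cases σ i <;> rfl
    rw [e] at h2
    exact h2
  · have hd : ∀ c c', Disjoint (P (x (i, c))) (P (x (j, c'))) := fun c c' => hPd _ _ (fun h => hij (by simpa using congrArg Prod.fst h))
    have hd2 : ∀ c, Disjoint (P (x (i, c))) (S' j) := fun c => Finset.disjoint_left.2 (fun z h1 h2 => hij (hPS _ _ z h1 h2).2)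
    have hd3 : ∀ c, Disjoint (S' i) (P (x (j, c))) := fun c => Finset.disjoint_left.2 (fun z h1 h2 => hij (hPS _ _ z h2 h1).2.symm)
    simp only [Finset.disjoint_union_left, Finset.disjoint_union_right]
    exact ⟨⟨hd _ _, hd3 _, hd _ _⟩, ⟨hd2 _, hS'd i j hij, hd2 _⟩, ⟨hd _ _, hd3 _, hd _ _⟩⟩

/-- connected inside `B` by positive edges -/
def PC (g : V → V → Bool → Prop) (B : Finset V) : V → V → Prop :=
  Relation.ReflTransGen (fun u v => u ∈ B ∧ v ∈ B ∧ g u v false)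

structure RH {ι κ : Type} [Fintype ι] (g : V → V → Bool → Prop) (x : ι × Bool → V) (I : Finset κ)
    (D : κ → κ → Prop) (Bg : κ → Finset V) : Prop where
  sym : ∀ u v σ, g u v σ → g v u σ
  inj : Function.Injective x
  h1 : ∀ i ∈ I, ∀ j ∈ I, i ≠ j → Disjoint (Bg i) (Bg j)
  h2 : ∀ i ∈ I, ∀ y ∈ Bg i, ∀ z ∈ Bg i, PC g (Bg i) y z ∨ ∃ w ∈ Bg i, w ∈ Finset.univ.image x ∧ PC g (Bg i) y w
  h3 : ∀ i ∈ I, (Bg i).Nonempty → Disjoint (Bg i) (Finset.univ.image x) → ∀ j ∈ I, D i j → ∀ σ,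
    ∃ u ∈ Bg i, ∃ v ∈ Bg j, g u v σ
  h4 : ∃ i ∈ I, (Bg i).Nonempty ∧ Disjoint (Bg i) (Finset.univ.image x)
  h5 : ∀ A B, Sep g A B → Finset.univ.image x ⊆ A → (A ∩ B).card < 2 * Fintype.card ι →
    ∀ i ∈ I, (Bg i).Nonempty → Bg i ⊆ B \ A → False

theorem PC.exists_edge {B : Finset V} {y z : V} (h : PC g B y z) (hne : y ≠ z) :
    ∃ u ∈ B, ∃ v ∈ B, u ≠ v ∧ g u v false := by
  by_contra hcon
  push Not at hcon
  apply hne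
  induction h with
  | refl => rfl
  | @tail b' c' _ h2 ih =>
    by_cases hy : y = b'
    · refine hy.trans ?_
      by_contra hn
      exact hcon _ h2.1 _ h2.2.1 hn h2.2.2
    · exact absurd (ih hy) hy

end

section
variable {V : Type} [Fintype V] [DecidableEq V]

theorem rooting_single {ι κ : Type} [Fintype ι] [Fintype κ] [DecidableEq κ] (N : ℕ) (hN : N = Fintype.card ι) (hNpos : 1 ≤ N)
    (I : Finset κ) (D : κ → κ → Prop) [DecidableRel D] (hDs : ∀ i j, D i j → D j i) (hDi : ∀ i, ¬ D i i)
    (hIc : I.card + 5 ≤ 22 * N) (hdeg : ∀ i ∈ I, 11 * N ≤ (I.filter (D i)).card + 2)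
    (g : V → V → Bool → Prop) (x : ι × Bool → V) (Bg : κ → Finset V) (h : RH g x I D Bg)
    (hs : ∀ i ∈ I, (Bg i).Nonempty → Disjoint (Bg i) (Finset.univ.image x) → (Bg i).card ≤ 1) :
    Linked g x := by
  classical
  set X := Finset.univ.image x with hX
  have hXc : X.card = 2 * N := by
    rw [hX, Finset.card_image_of_injective _ h.inj, Finset.card_univ, Fintype.card_prod, Fintype.card_bool, mul_comm, hN]
  set Al := I.filter (fun i => (Bg i).Nonempty ∧ Disjoint (Bg i) X) with hAl
  set Mt := I.filter (fun i => ¬ Disjoint (Bg i) X) with hMt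
  have hMtc : Mt.card ≤ 2 * N := by
    rw [← hXc]
    have hw : ∀ i ∈ Mt, ∃ w, w ∈ Bg i ∧ w ∈ X := by
      intro i hi
      rw [hMt, Finset.mem_filter, Finset.not_disjoint_iff] at hi
      exact hi.2
    have : Nonempty V := by
      obtain ⟨i, _, ⟨c, _⟩, _⟩ := h.h4
      exact ⟨c⟩
    choose! f hf using hw
    refine Finset.card_le_card_of_injOn f (fun i hi => (hf i hi).2) ?_
    intro i hi j hj hij
    by_contra hne
    have h1 := (hf i hi).1
    rw [hij] at h1
    exact Finset.disjoint_left.1 (h.h1 i (Finset.mem_filter.1 hi).1 j (Finset.mem_filter.1 hj).1 hne) h1 (hf j hj).1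
  have hsum : Al.card + Mt.card ≤ I.card := by
    rw [← Finset.card_union_of_disjoint]
    · exact Finset.card_le_card (Finset.union_subset (Finset.filter_subset _ _) (Finset.filter_subset _ _))
    · rw [Finset.disjoint_left]
      intro i h1 h2
      exact (Finset.mem_filter.1 h2).2 (Finset.mem_filter.1 h1).2.2
  obtain ⟨L, hLW, hL2, hL⟩ := exists_nlinked hDs hDi ι Al Mt.card N hN hNpos (by
      obtain ⟨i, hi, h4⟩ := h.h4
      exact ⟨i, Finset.mem_filter.2 ⟨hi, h4⟩⟩) hMtc (by omega) (by
      intro v hv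
      rw [hAl, Finset.mem_filter] at hv
      have h1 := hdeg v hv.1
      have h2 : I.filter (D v) ⊆ Al.filter (D v) ∪ Mt := by
        intro j hj
        rw [Finset.mem_filter] at hj
        obtain ⟨u, _, w, hw, _⟩ := h.h3 v hv.1 hv.2.1 hv.2.2 j hj.1 hj.2 false
        by_cases hd : Disjoint (Bg j) X
        · simp [Al, hj, hd]; exact .inl ⟨w, hw⟩
        · simp [Mt, hj, hd]
      have h3 := (Finset.card_le_card h2).trans (Finset.card_union_le _ _)
      omega)
  have halive : ∀ i ∈ L, i ∈ I ∧ (Bg i).Nonempty ∧ Disjoint (Bg i) X := fun i hi => Finset.mem_filter.1 (hLW hi)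
  have hc : ∀ i : κ, ∃ c : V, i ∈ L → Bg i = {c} := by
    intro i
    by_cases hi : i ∈ L
    · obtain ⟨h1, h2, h3⟩ := halive i hi
      have h4 := hs i h1 h2 h3
      have h5 := Finset.card_pos.2 h2
      obtain ⟨c, hc⟩ := Finset.card_eq_one.1 (show (Bg i).card = 1 by omega)
      exact ⟨c, fun _ => hc⟩
    · obtain ⟨j, _, ⟨c, _⟩, _⟩ := h.h4
      exact ⟨c, fun h => absurd h hi⟩
  choose c hc using hc
  have hcinj : ∀ i ∈ L, ∀ j ∈ L, c i = c j → i = j := by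
    intro i hi j hj hij
    by_contra hne
    have := h.h1 i (halive i hi).1 j (halive j hj).1 hne
    rw [hc i hi, hc j hj, hij] at this
    simp at this
  have hgc : ∀ i ∈ L, ∀ j ∈ L, D i j → ∀ σ, g (c i) (c j) σ := by
    intro i hi j hj hij σ
    obtain ⟨u, hu, v, hv, hg⟩ := h.h3 i (halive i hi).1 (halive i hi).2.1 (halive i hi).2.2 j (halive j hj).1 hij σ
    rw [hc i hi, Finset.mem_singleton] at hu
    rw [hc j hj, Finset.mem_singleton] at hv
    subst hu; subst hv; exact hg
  have hlinks : Links g X (L.image c) := by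
    apply menger g h.sym
    intro A B hsep hXA hLB
    by_contra hlt
    push Not at hlt
    have h1 : (A ∩ B).card < (L.image c).card := by
      rw [Finset.card_image_of_injOn (fun i hi j hj => hcinj i hi j hj)]
      omega
    obtain ⟨z, hz, hz'⟩ := Finset.exists_mem_notMem_of_card_lt_card h1
    have hzB := hLB hz
    obtain ⟨i, hi, rfl⟩ := Finset.mem_image.1 hz
    refine h.h5 A B hsep hXA (by omega) i (halive i hi).1 (halive i hi).2.1 ?_
    rw [hc i hi, Finset.singleton_subset_iff, Finset.mem_sdiff]
    refine ⟨hzB, fun hA => hz' (Finset.mem_inter.2 ⟨hA, hzB⟩)⟩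
  obtain ⟨P, b, τ, hP, hPd⟩ := hlinks
  have hxX : ∀ p, x p ∈ X := fun p => Finset.mem_image_of_mem _ (Finset.mem_univ _)
  have hk : ∀ p, ∃ k ∈ L, c k = b (x p) := fun p => Finset.mem_image.1 (hP (x p) (hxX p)).2.1
  choose k hkL hk using hk
  have hPd' : ∀ p q, p ≠ q → Disjoint (P (x p)) (P (x q)) := fun p q hpq =>
    hPd _ (hxX p) _ (hxX q) (fun e => hpq (h.inj e))
  have hkinj : Function.Injective k := by
    intro p q hpq
    by_contra hne
    have h1 := (hP (x p) (hxX p)).1.right_mem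
    have h2 := (hP (x q) (hxX q)).1.right_mem
    rw [← hk, hpq, hk] at h1
    exact Finset.disjoint_left.1 (hPd' p q hne) h1 h2
  obtain ⟨S, hS, hSd⟩ := hL k hkinj hkL
  intro σ
  refine join_links h.sym x h.inj P b τ (L.image c) (fun p => hP _ (hxX p)) hPd' σ (fun i => (S i).image c) ?_ ?_ ?_
  · intro i
    obtain ⟨hSL, σ', hp⟩ := hS i
    have hp' := hp.anysign (fun u v _ _ h => h) (fun e => by simpa using hkinj e)
      (xor (τ (x (i, false))) (xor (σ i) (τ (x (i, true)))))
    rw [← hk, ← hk]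
    exact hp'.map c (fun u hu v hv => hcinj u (hSL hu) v (hSL hv))
      (fun u hu v hv σ hd => hgc u (hSL hu) v (hSL hv) hd σ)
  · intro i j hij
    rw [Finset.disjoint_left]
    intro z hz hz'
    obtain ⟨u, hu, rfl⟩ := Finset.mem_image.1 hz
    obtain ⟨v, hv, huv⟩ := Finset.mem_image.1 hz'
    have := hcinj v ((hS j).1 hv) u ((hS i).1 hu) huv
    subst this
    exact Finset.disjoint_left.1 (hSd i j hij) hu hv
  · intro p i z _ hz
    exact Finset.image_subset_image (hS i).1 hz

end

end SGP

namespace SGP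

section
variable {V : Type} [Fintype V] [DecidableEq V]

/-- number of non-isolated vertices -/
noncomputable def mu (g : V → V → Bool → Prop) : ℕ := {u | ∃ v σ, g u v σ}.ncard

theorem mu_lt {g g' : V → V → Bool → Prop} (h : ∀ u v σ, g' u v σ → ∃ v' σ', g u v' σ') (w : V)
    (hw : ∃ v σ, g w v σ) (hw' : ∀ v σ, ¬ g' w v σ) : mu g' < mu g := by
  apply Set.ncard_lt_ncard _ (Set.toFinite _)
  refine ⟨fun u ⟨v, σ, hu⟩ => h u v σ hu, fun hsub => ?_⟩
  obtain ⟨v, σ, hv⟩ := hsub hw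
  exact hw' v σ hv

theorem rigid_step {ι κ : Type} [Fintype ι] (I : Finset κ) (D : κ → κ → Prop)
    (g : V → V → Bool → Prop) (x : ι × Bool → V) (Bg : κ → Finset V) (h : RH g x I D Bg)
    (A B : Finset V) (hsep : Sep g A B) (hXA : Finset.univ.image x ⊆ A)
    (hc : (A ∩ B).card = 2 * Fintype.card ι) (hne : A ∩ B ≠ Finset.univ.image x)
    (j : κ) (hj : j ∈ I) (hjn : (Bg j).Nonempty) (hjB : Bg j ⊆ B \ A) :
    ∃ (g' : V → V → Bool → Prop) (x' : ι × Bool → V) (Bg' : κ → Finset V), RH g' x' I D Bg' ∧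
      mu g' < mu g ∧ (Linked g' x' → Linked g x) := by
  classical
  set X := Finset.univ.image x with hX
  have hXc : X.card = 2 * Fintype.card ι := by
    rw [hX, Finset.card_image_of_injective _ h.inj, Finset.card_univ, Fintype.card_prod, Fintype.card_bool, mul_comm]
  have hxX : ∀ p, x p ∈ X := fun p => Finset.mem_image_of_mem _ (Finset.mem_univ _)
  have hlinks : Links g X (A ∩ B) := by
    apply menger g h.sym
    intro A1 B1 hs1 hXA1 hYB1
    by_contra hlt
    push Not at hlt
    have hAB : ∀ z, z ∈ A → z ∈ B → z ∈ B1 := fun z h1 h2 => hYB1 (Finset.mem_inter.2 ⟨h1, h2⟩)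
    refine h.h5 (A1 ∩ A) (B1 ∪ B) ⟨fun v => ?_, fun u v σ hg => ?_⟩ (Finset.subset_inter hXA1 hXA) ?_ j hj hjn ?_
    · have := hsep.cover v
      have := hs1.cover v
      simp; tauto
    · have := hsep.edge u v σ hg
      have := hs1.edge u v σ hg
      simp; tauto
    · refine lt_of_le_of_lt (Finset.card_le_card ?_) (hXc ▸ hlt)
      intro z hz
      have := hAB z
      simp at hz ⊢; tauto
    · intro z hz
      have := hjB hz
      simp at this ⊢; tauto
  obtain ⟨P, b, τ, hP, hPd⟩ := hlinks
  have hP' : ∀ p, _ := fun p => hP _ (hxX p)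
  have hPd' : ∀ p q, p ≠ q → Disjoint (P (x p)) (P (x q)) := fun p q hpq =>
    hPd _ (hxX p) _ (hxX q) (fun e => hpq (h.inj e))
  have hPA : ∀ p, P (x p) ⊆ A := by
    intro p
    apply (hP' p).1.sub_of_sep hsep.edge (hXA (hxX p))
    intro z hz h1 h2
    exact (hP' p).2.2 z hz (Finset.mem_inter.2 ⟨h1, h2⟩)
  let x' : ι × Bool → V := fun p => b (x p)
  have hx'inj : Function.Injective x' := by
    intro p q hpq
    by_contra hne
    have h1 := (hP' p).1.right_mem
    have h2 := (hP' q).1.right_mem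
    have : b (x p) = b (x q) := hpq
    rw [this] at h1
    exact Finset.disjoint_left.1 (hPd' p q hne) h1 h2
  have hX' : Finset.univ.image x' = A ∩ B := by
    apply Finset.eq_of_subset_of_card_le
    · intro z hz
      obtain ⟨p, _, rfl⟩ := Finset.mem_image.1 hz
      exact (hP' p).2.1
    · rw [hc, Finset.card_image_of_injective _ hx'inj, Finset.card_univ, Fintype.card_prod, Fintype.card_bool, mul_comm]
  let g' : V → V → Bool → Prop := fun u v σ => g u v σ ∧ u ∈ B ∧ v ∈ B
  let Bg' : κ → Finset V := fun i => Bg i ∩ B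
  -- walking inside a bag
  have hwalk : ∀ i y z, y ∈ B → y ∈ Bg i → PC g (Bg i) y z → (z ∈ B ∧ PC g' (Bg' i) y z) ∨
      ∃ w ∈ Bg' i, w ∈ A ∩ B ∧ PC g' (Bg' i) y w := by
    intro i y z hy hyi hp
    induction hp with
    | refl => exact .inl ⟨hy, .refl⟩
    | @tail u v _ h2 ih =>
      rcases ih with ⟨hu, ih⟩ | ih
      · by_cases hv : v ∈ B
        · refine .inl ⟨hv, ih.tail ⟨Finset.mem_inter.2 ⟨h2.1, hu⟩, Finset.mem_inter.2 ⟨h2.2.1, hv⟩, h2.2.2, hu, hv⟩⟩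
        · rcases hsep.edge _ _ _ h2.2.2 with h3 | h3
          · exact .inr ⟨u, Finset.mem_inter.2 ⟨h2.1, hu⟩, Finset.mem_inter.2 ⟨h3.1, hu⟩, ih⟩
          · exact absurd h3.2 hv
      · exact .inr ih
  have hwalkA : ∀ i ∈ I, ∀ y ∈ Bg i, y ∈ B → ∀ z ∈ Bg i, (z ∈ B ∧ PC g' (Bg' i) y z) ∨
      ∃ w ∈ Bg' i, w ∈ A ∩ B ∧ PC g' (Bg' i) y w := by
    intro i hi y hy hyB z hz
    rcases h.h2 i hi y hy z hz with hp | ⟨w, hw, hwX, hp⟩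
    · exact hwalk i y z hyB hy hp
    · rcases hwalk i y w hyB hy hp with ⟨h1, h2⟩ | h1
      · exact .inr ⟨w, Finset.mem_inter.2 ⟨hw, h1⟩, Finset.mem_inter.2 ⟨hXA hwX, h1⟩, h2⟩
      · exact .inr h1
  -- bags that are alive afterwards
  have halive : ∀ i ∈ I, (Bg' i).Nonempty → Disjoint (Bg' i) (A ∩ B) → Bg i ⊆ B \ A := by
    intro i hi ⟨y, hy⟩ hd z hz
    have hy' := Finset.mem_inter.1 hy
    rcases hwalkA i hi y hy'.1 hy'.2 z hz with ⟨h1, h2⟩ | ⟨w, h1, h2, _⟩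
    · refine Finset.mem_sdiff.2 ⟨h1, fun hA => ?_⟩
      exact Finset.disjoint_left.1 hd (Finset.mem_inter.2 ⟨hz, h1⟩) (Finset.mem_inter.2 ⟨hA, h1⟩)
    · exact absurd h2 (Finset.disjoint_left.1 hd h1)
  have hdisjX : ∀ i, Bg i ⊆ B \ A → Disjoint (Bg i) X := by
    intro i hi
    rw [Finset.disjoint_left]
    intro z hz hzX
    exact (Finset.mem_sdiff.1 (hi hz)).2 (hXA hzX)
  refine ⟨g', x', Bg', ⟨?_, hx'inj, ?_, ?_, ?_, ?_, ?_⟩, ?_, ?_⟩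
  · rintro u v σ ⟨h1, h2, h3⟩
    exact ⟨h.sym _ _ _ h1, h3, h2⟩
  · intro i hi j hj hij
    exact Finset.disjoint_of_subset_left Finset.inter_subset_left
      (Finset.disjoint_of_subset_right Finset.inter_subset_left (h.h1 i hi j hj hij))
  · intro i hi y hy z hz
    rw [hX']
    have hy' := Finset.mem_inter.1 hy
    have hz' := Finset.mem_inter.1 hz
    rcases hwalkA i hi y hy'.1 hy'.2 z hz'.1 with ⟨_, h2⟩ | h2
    · exact .inl h2
    · exact .inr h2
  · intro i hi hn hd j hj hij σ
    rw [hX'] at hd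
    have hi' := halive i hi hn hd
    have hin : (Bg i).Nonempty := hn.mono Finset.inter_subset_left
    obtain ⟨u, hu, v, hv, hg⟩ := h.h3 i hi hin (hdisjX i hi') j hj hij σ
    have huB := Finset.mem_sdiff.1 (hi' hu)
    have hvB : v ∈ B := by
      rcases hsep.edge _ _ _ hg with h1 | h1
      · exact absurd h1.1 huB.2
      · exact h1.2
    exact ⟨u, Finset.mem_inter.2 ⟨hu, huB.1⟩, v, Finset.mem_inter.2 ⟨hv, hvB⟩, hg, huB.1, hvB⟩
  · refine ⟨j, hj, ?_, ?_⟩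
    · obtain ⟨z, hz⟩ := hjn
      exact ⟨z, Finset.mem_inter.2 ⟨hz, (Finset.mem_sdiff.1 (hjB hz)).1⟩⟩
    · rw [hX', Finset.disjoint_left]
      intro z hz hz'
      exact (Finset.mem_sdiff.1 (hjB (Finset.mem_inter.1 hz).1)).2 (Finset.mem_inter.1 hz').1
  · intro A2 B2 hs2 hXA2 hlt i hi hn hsub
    rw [hX'] at hXA2
    have hAB2 : ∀ z, z ∈ A → z ∈ B → z ∈ A2 := fun z h1 h2 => hXA2 (Finset.mem_inter.2 ⟨h1, h2⟩)
    have hi' : Bg i ⊆ B \ A := halive i hi hn (by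
      rw [Finset.disjoint_left]
      intro z hz hz'
      exact (Finset.mem_sdiff.1 (hsub hz)).2 (hXA2 hz'))
    refine h.h5 (A ∪ A2) (B2 ∩ B) ⟨fun v => ?_, fun u v σ hg => ?_⟩ (hXA.trans Finset.subset_union_left) ?_ i hi
      (hn.mono Finset.inter_subset_left) ?_
    · have := hsep.cover v
      have := hs2.cover v
      simp; tauto
    · rcases hsep.edge u v σ hg with h1 | h1
      · simp [h1]
      · have := hs2.edge u v σ ⟨hg, h1⟩
        simp; tauto
    · refine lt_of_le_of_lt (Finset.card_le_card ?_) hlt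
      intro z hz
      have := hAB2 z
      simp at hz ⊢; tauto
    · intro z hz
      have h1 := hi' hz
      have h2 := hsub (Finset.mem_inter.2 ⟨hz, (Finset.mem_sdiff.1 h1).1⟩)
      simp at h1 h2 ⊢; tauto
  · -- measure
    obtain ⟨w, hwX, hwB⟩ : ∃ w ∈ X, w ∉ B := by
      by_contra hcon
      push Not at hcon
      apply hne
      symm
      apply Finset.eq_of_subset_of_card_le
      · exact fun z hz => Finset.mem_inter.2 ⟨hXA hz, hcon z hz⟩
      · omega
    refine mu_lt (fun u v σ h => ⟨v, σ, h.1⟩) w ?_ (fun v σ h => hwB h.2.1)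
    have h1 := (hP w hwX).1
    have h2 := (hP w hwX).2.1
    generalize b w = bw at h1 h2
    generalize τ w = tw at h1
    generalize P w = Pw at h1
    cases h1 with
    | nil => exact absurd (Finset.mem_inter.1 h2).2 hwB
    | cons hg _ _ => exact ⟨_, _, hg⟩
  · intro hl σ
    obtain ⟨S', hS', hSd'⟩ := hl (fun i => xor (τ (x (i, false))) (xor (σ i) (τ (x (i, true)))))
    refine join_links h.sym x h.inj P b τ (A ∩ B) hP' hPd' σ S' (fun i => (hS' i).mono (fun u v σ h => h.1)) hSd' ?_
    intro p i z hz hz'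
    have : S' i ⊆ B := (hS' i).sub_of_edges (fun u v σ h => h.2) (Finset.mem_inter.1 (hP' (i, false)).2.1).2
    exact Finset.mem_inter.2 ⟨hPA p hz, this hz'⟩

theorem contract_step {ι κ : Type} [Fintype ι] (I : Finset κ) (D : κ → κ → Prop)
    (g : V → V → Bool → Prop) (x : ι × Bool → V) (Bg : κ → Finset V) (h : RH g x I D Bg)
    (hnr : ∀ A B, Sep g A B → Finset.univ.image x ⊆ A → (A ∩ B).card = 2 * Fintype.card ι →
      A ∩ B ≠ Finset.univ.image x → ∀ j ∈ I, (Bg j).Nonempty → Bg j ⊆ B \ A → False)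
    (i0 : κ) (hi0 : i0 ∈ I) (hd0 : Disjoint (Bg i0) (Finset.univ.image x)) (hc0 : 1 < (Bg i0).card) :
    ∃ (g' : V → V → Bool → Prop) (x' : ι × Bool → V) (Bg' : κ → Finset V), RH g' x' I D Bg' ∧
      mu g' < mu g ∧ (Linked g' x' → Linked g x) := by
  classical
  set X := Finset.univ.image x with hX
  have hxX : ∀ p, x p ∈ X := fun p => Finset.mem_image_of_mem _ (Finset.mem_univ _)
  obtain ⟨y, hy, z, hz, hyz⟩ := Finset.one_lt_card.1 hc0
  obtain ⟨u, hu, v, hv, huv, hg⟩ : ∃ u ∈ Bg i0, ∃ v ∈ Bg i0, u ≠ v ∧ g u v false := by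
    rcases h.h2 i0 hi0 y hy z hz with hp | ⟨w, hw, hwX, _⟩
    · exact hp.exists_edge hyz
    · exact absurd hwX (Finset.disjoint_left.1 hd0 hw)
  have hvX : v ∉ X := Finset.disjoint_left.1 hd0 hv
  let π : V → V := fun w => if w = v then u else w
  have hπv : π v = u := by simp [π]
  have hπn : ∀ w, w ≠ v → π w = w := fun w hw => by simp [π, hw]
  have hπne : ∀ w, π w ≠ v := by
    intro w
    by_cases hw : w = v
    · rw [hw, hπv]; exact huv
    · rw [hπn w hw]; exact hw
  have hπX : ∀ w ∈ X, π w = w := fun w hw => hπn w (by rintro rfl; exact hvX hw)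
  let g' : V → V → Bool → Prop := fun a b σ => ∃ a0 b0, π a0 = a ∧ π b0 = b ∧ g a0 b0 σ
  let Bg' : κ → Finset V := fun i => (Bg i).erase v
  have hother : ∀ i ∈ I, i ≠ i0 → v ∉ Bg i := fun i hi hne hvi =>
    Finset.disjoint_left.1 (h.h1 i hi i0 hi0 hne) hvi hv
  have hπB : ∀ i ∈ I, ∀ w ∈ Bg i, π w ∈ Bg' i := by
    intro i hi w hw
    rw [Finset.mem_erase]
    refine ⟨hπne w, ?_⟩
    by_cases hwv : w = v
    · subst hwv
      have : i = i0 := by by_contra hne; exact hother i hi hne hw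
      subst this
      rw [hπv]; exact hu
    · rw [hπn w hwv]; exact hw
  have hPC : ∀ i ∈ I, ∀ a b, PC g (Bg i) a b → PC g' (Bg' i) (π a) (π b) := by
    intro i hi a b hp
    induction hp with
    | refl => exact .refl
    | @tail c d _ hab ih => exact ih.tail ⟨hπB i hi c hab.1, hπB i hi d hab.2.1, c, d, rfl, rfl, hab.2.2⟩
  have halive : ∀ i ∈ I, Disjoint (Bg' i) X → Disjoint (Bg i) X := by
    intro i hi hd
    rw [Finset.disjoint_left] at hd ⊢
    intro w hw hwX
    have := hπB i hi w hw
    rw [hπX w hwX] at this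
    exact hd this hwX
  refine ⟨g', x, Bg', ⟨?_, h.inj, ?_, ?_, ?_, ?_, ?_⟩, ?_, ?_⟩
  · rintro a b σ ⟨a0, b0, h1, h2, h3⟩
    exact ⟨b0, a0, h2, h1, h.sym _ _ _ h3⟩
  · intro i hi j hj hij
    exact Finset.disjoint_of_subset_left (Finset.erase_subset _ _)
      (Finset.disjoint_of_subset_right (Finset.erase_subset _ _) (h.h1 i hi j hj hij))
  · intro i hi y hy z hz
    rw [Finset.mem_erase] at hy hz
    rcases h.h2 i hi y hy.2 z hz.2 with hp | ⟨w, hw, hwX, hp⟩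
    · left
      have := hPC i hi y z hp
      rwa [hπn y hy.1, hπn z hz.1] at this
    · right
      have h1 := hPC i hi y w hp
      have h2 := hπB i hi w hw
      rw [hπX w hwX] at h1 h2
      rw [hπn y hy.1] at h1
      exact ⟨w, h2, hwX, h1⟩
  · intro i hi hn hd j hj hij σ
    obtain ⟨a, ha, b, hb, hab⟩ := h.h3 i hi (hn.mono (Finset.erase_subset _ _)) (halive i hi hd) j hj hij σ
    exact ⟨π a, hπB i hi a ha, π b, hπB j hj b hb, a, b, rfl, rfl, hab⟩
  · obtain ⟨i, hi, ⟨w, hw⟩, hd⟩ := h.h4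
    exact ⟨i, hi, ⟨π w, hπB i hi w hw⟩, Finset.disjoint_of_subset_left (Finset.erase_subset _ _) hd⟩
  · intro A' B' hs' hXA' hlt i hi hn hsub
    let A := Finset.univ.filter (fun w => π w ∈ A')
    let B := Finset.univ.filter (fun w => π w ∈ B')
    have hs : Sep g A B := by
      refine ⟨fun w => by simpa [A, B] using hs'.cover (π w), fun a b σ hab => ?_⟩
      simpa [A, B] using hs'.edge (π a) (π b) σ ⟨a, b, rfl, rfl, hab⟩
    have hXA : X ⊆ A := by
      intro w hw
      simp only [A, Finset.mem_filter, Finset.mem_univ, true_and]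
      rw [hπX w hw]
      exact hXA' hw
    have hBi : Bg i ⊆ B \ A := by
      intro w hw
      have := hsub (hπB i hi w hw)
      simpa [A, B] using this
    have hin : (Bg i).Nonempty := hn.mono (Finset.erase_subset _ _)
    have hsubv : A ∩ B ⊆ insert v (A' ∩ B') := by
      intro w hw
      simp only [A, B, Finset.mem_inter, Finset.mem_filter, Finset.mem_univ, true_and] at hw
      by_cases hwv : w = v
      · simp [hwv]
      · rw [hπn w hwv] at hw
        simp [hw]
    have hle : (A ∩ B).card ≤ (A' ∩ B').card + 1 := (Finset.card_le_card hsubv).trans (Finset.card_insert_le _ _)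
    by_cases hlt2 : (A ∩ B).card < 2 * Fintype.card ι
    · exact h.h5 A B hs hXA hlt2 i hi hin hBi
    · refine hnr A B hs hXA (by omega) ?_ i hi hin hBi
      intro heq
      have hvAB : v ∉ A ∩ B := by rw [heq]; exact hvX
      have : A ∩ B ⊆ A' ∩ B' := by
        intro w hw
        have := hsubv hw
        rw [Finset.mem_insert] at this
        exact this.resolve_left (by rintro rfl; exact hvAB hw)
      have := Finset.card_le_card this
      omega
  · refine mu_lt (w := v) ?_ ⟨u, false, h.sym _ _ _ hg⟩ ?_
    · rintro a b σ ⟨a0, b0, h1, h2, h3⟩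
      by_cases ha : a0 = v
      · rw [ha, hπv] at h1
        subst h1
        exact ⟨v, false, hg⟩
      · rw [hπn _ ha] at h1
        subst h1
        exact ⟨b0, σ, h3⟩
    · rintro b σ ⟨a0, b0, h1, _, _⟩
      exact hπne a0 h1
  · intro hl σ
    obtain ⟨S', hS', hSd'⟩ := hl σ
    have hlift : ∀ i, ∃ T : Finset V, (∀ z ∈ T, π z ∈ S' i) ∧ SP g (x (i, false)) (x (i, true)) (σ i) T := by
      intro i
      refine (hS' i).lift (g := g) π ?_ (fun a b σ h => h) _ _ (hπX _ (hxX _)) (hπX _ (hxX _))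
      intro p q hpq hne
      by_cases hp : p = v
      · by_cases hq : q = v
        · exact absurd (hp.trans hq.symm) hne
        · rw [hp, hπv, hπn q hq] at hpq
          rw [hp, ← hpq]; exact h.sym _ _ _ hg
      · by_cases hq : q = v
        · rw [hq, hπv, hπn p hp] at hpq
          rw [hq, hpq]; exact hg
        · rw [hπn p hp, hπn q hq] at hpq
          exact absurd hpq hne
    choose T hT hT' using hlift
    refine ⟨T, hT', fun i j hij => ?_⟩
    rw [Finset.disjoint_left]
    intro z hz hz'
    exact Finset.disjoint_left.1 (hSd' i j hij) (hT i z hz) (hT j z hz')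

theorem rooting {ι κ : Type} [Fintype ι] [Fintype κ] [DecidableEq κ] (N : ℕ) (hN : N = Fintype.card ι) (hNpos : 1 ≤ N)
    (I : Finset κ) (D : κ → κ → Prop) [DecidableRel D] (hDs : ∀ i j, D i j → D j i) (hDi : ∀ i, ¬ D i i)
    (hIc : I.card + 5 ≤ 22 * N) (hdeg : ∀ i ∈ I, 11 * N ≤ (I.filter (D i)).card + 2) (n : ℕ) :
    ∀ (g : V → V → Bool → Prop) (x : ι × Bool → V) (Bg : κ → Finset V), RH g x I D Bg → mu g ≤ n →
    Linked g x := by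
  induction n using Nat.strong_induction_on with
  | _ n ih =>
    intro g x Bg h hn
    have hred : (∃ (g' : V → V → Bool → Prop) (x' : ι × Bool → V) (Bg' : κ → Finset V), RH g' x' I D Bg' ∧
      mu g' < mu g ∧ (Linked g' x' → Linked g x)) → Linked g x := by
      rintro ⟨g', x', Bg', h1, h2, h3⟩
      exact h3 (ih (mu g') (by omega) g' x' Bg' h1 le_rfl)
    by_cases hr : ∀ A B, Sep g A B → Finset.univ.image x ⊆ A → (A ∩ B).card = 2 * Fintype.card ι →
      A ∩ B ≠ Finset.univ.image x → ∀ j ∈ I, (Bg j).Nonempty → Bg j ⊆ B \ A → False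
    swap
    · push Not at hr
      obtain ⟨A, B, h1, h2, h3, h4, j, h5, h6, h7, _⟩ := hr
      exact hred (rigid_step I D g x Bg h A B h1 h2 h3 h4 j h5 h6 h7)
    by_cases hs : ∀ i ∈ I, (Bg i).Nonempty → Disjoint (Bg i) (Finset.univ.image x) → (Bg i).card ≤ 1
    · exact rooting_single N hN hNpos I D hDs hDi hIc hdeg g x Bg h hs
    · push Not at hs
      obtain ⟨i, hi, _, h2, h3⟩ := hs
      exact hred (contract_step I D g x Bg h hr i hi h2 h3)

end

end SGP

namespace SGP

section
variable {V : Type} [DecidableEq V]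

/-- validity of a signed colouring on a set -/
def Valid (g : V → V → Bool → Prop) (U : Finset V) (f : V → ℕ × Bool) : Prop :=
  ∀ u ∈ U, ∀ v ∈ U, ∀ σ, g u v σ → (f u).1 = (f v).1 → σ = xor (f u).2 (f v).2

def ColS (g : V → V → Bool → Prop) (U : Finset V) (C : Finset ℕ) : Prop :=
  ∃ f : V → ℕ × Bool, (∀ u ∈ U, (f u).1 ∈ C) ∧ Valid g U f

theorem ColS.transfer {g : V → V → Bool → Prop} {U : Finset V} {C C' : Finset ℕ} (h : ColS g U C)
    (hc : C.card ≤ C'.card) : ColS g U C' := by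
  obtain ⟨f, h1, h2⟩ := h
  obtain ⟨e, he, hinj⟩ : ∃ e : ℕ → ℕ, (∀ c ∈ C, e c ∈ C') ∧ ∀ c ∈ C, ∀ c' ∈ C, e c = e c' → c = c' := by
    have h3 : Fintype.card C ≤ Fintype.card C' := by simpa using hc
    obtain ⟨e⟩ := Function.Embedding.nonempty_of_card_le h3
    refine ⟨fun c => if h : c ∈ C then e ⟨c, h⟩ else 0, fun c hc => by simp [hc], ?_⟩
    intro c hc c' hc' heq
    simp only [hc, hc', dite_true] at heq
    have := e.injective (Subtype.ext heq)
    simpa using this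
  refine ⟨fun v => (e (f v).1, (f v).2), fun u hu => he _ (h1 u hu), ?_⟩
  intro u hu v hv σ hg heq
  exact h2 u hu v hv σ hg (hinj _ (h1 u hu) _ (h1 v hv) heq)

theorem ColS.add {g : V → V → Bool → Prop} (hsym : ∀ u v σ, g u v σ → g v u σ) (hl : ∀ v σ, g v v σ → σ = false)
    {R : Finset V} {d : ℕ} (h : ColS g R (Finset.range d)) (K : Finset V) :
    ColS g (R ∪ K) (Finset.range (d + K.card)) := by
  induction K using Finset.induction_on with
  | empty => simpa using h
  | @insert a K ha ih =>
    obtain ⟨f, h1, h2⟩ := ih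
    rw [Finset.card_insert_of_notMem ha]
    simp only [Finset.mem_range] at h1
    refine ⟨Function.update f a (d + K.card, false), fun u hu => ?_, ?_⟩
    · by_cases hua : u = a
      · subst hua; simp
      · rw [Function.update_of_ne hua, Finset.mem_range]
        have := h1 u (by simp [hua] at hu ⊢; tauto)
        omega
    · intro u hu v hv σ hg heq
      by_cases hua : u = a <;> by_cases hva : v = a
      · subst hua; subst hva
        simp; exact hl _ _ hg
      · subst hua
        rw [Function.update_self, Function.update_of_ne hva] at heq
        have := h1 v (by simp [hva] at hv ⊢; tauto)
        simp at heq; omega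
      · subst hva
        rw [Function.update_self, Function.update_of_ne hua] at heq
        have := h1 u (by simp [hua] at hu ⊢; tauto)
        simp at heq; omega
      · rw [Function.update_of_ne hua, Function.update_of_ne hva] at heq ⊢
        exact h2 u (by simp [hua] at hu ⊢; tauto) v (by simp [hva] at hv ⊢; tauto) σ hg heq

theorem connectivity [Fintype V] (g : V → V → Bool → Prop) (T s : ℕ)
    (hno : ¬ ColS g Finset.univ (Finset.range T)) :
    ∃ U Z : Finset V, Z ⊆ U ∧ Z.card ≤ s ∧ ¬ ColS g (U \ Z) (Finset.range (T - s)) ∧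
      ∀ A B : Finset V, A ∪ B = U → (∀ u ∈ U, ∀ v ∈ U, ∀ σ, g u v σ → (u ∈ A ∧ v ∈ A) ∨ (u ∈ B ∧ v ∈ B)) →
        2 * (A ∩ B).card ≤ s → A \ B ⊆ Z ∨ B \ A ⊆ Z := by
  classical
  let Bad : Finset V → Finset V → (V → ℕ × Bool) → Prop := fun U Z φ =>
    Z ⊆ U ∧ Z.card ≤ s ∧ (∀ z ∈ Z, (φ z).1 < T) ∧ Valid g Z φ ∧
      ¬ ∃ f : V → ℕ × Bool, (∀ u ∈ U, (f u).1 < T) ∧ Valid g U f ∧ ∀ z ∈ Z, f z = φ z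
  obtain ⟨U, ⟨Z, φ, hZU, hZs, hφT, hφ, hbad⟩, hmin⟩ := Set.exists_min_image
    {U : Finset V | ∃ Z φ, Bad U Z φ} (fun U => U.card) (Set.toFinite _)
    ⟨Finset.univ, ∅, fun _ => (0, false), by simp, by simp, by simp, by intro u hu; simp at hu, by
      rintro ⟨f, h1, h2, _⟩
      exact hno ⟨f, fun u hu => Finset.mem_range.2 (h1 u hu), h2⟩⟩
  have hext : ∀ U' Z' φ', U'.card < U.card → Z' ⊆ U' → Z'.card ≤ s → (∀ z ∈ Z', (φ' z).1 < T) → Valid g Z' φ' →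
      ∃ f : V → ℕ × Bool, (∀ u ∈ U', (f u).1 < T) ∧ Valid g U' f ∧ ∀ z ∈ Z', f z = φ' z := by
    intro U' Z' φ' h1 h2 h3 h4 h5
    by_contra hcon
    have := hmin U' ⟨Z', φ', h2, h3, h4, h5, hcon⟩
    omega
  refine ⟨U, Z, hZU, hZs, ?_, ?_⟩
  · intro hcol
    let K := Z.image (fun z => (φ z).1)
    have hK : K.card ≤ s := Finset.card_image_le.trans hZs
    obtain ⟨f, h1, h2⟩ := hcol.transfer (C' := Finset.range T \ K) (by
      have := Finset.le_card_sdiff K (Finset.range T)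
      simp at this ⊢
      omega)
    apply hbad
    have hfK : ∀ u ∈ U, u ∉ Z → ∀ z ∈ Z, (f u).1 ≠ (φ z).1 := by
      intro u hu hz z hz' heq
      have := h1 u (Finset.mem_sdiff.2 ⟨hu, hz⟩)
      rw [Finset.mem_sdiff, heq] at this
      exact this.2 (Finset.mem_image_of_mem _ hz')
    refine ⟨fun v => if v ∈ Z then φ v else f v, ?_, ?_, fun z hz => by simp [hz]⟩
    · intro u hu
      by_cases h : u ∈ Z
      · simp [h, hφT u h]
      · have := h1 u (Finset.mem_sdiff.2 ⟨hu, h⟩)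
        simp at this
        simp [h, this]
    · intro u hu v hv σ hg heq
      by_cases hu' : u ∈ Z <;> by_cases hv' : v ∈ Z <;> simp only [hu', hv', if_true, if_false] at heq ⊢
      · exact hφ u hu' v hv' σ hg heq
      · exact absurd heq.symm (hfK v hv hv' u hu')
      · exact absurd heq (hfK u hu hu' v hv')
      · exact h2 u (Finset.mem_sdiff.2 ⟨hu, hu'⟩) v (Finset.mem_sdiff.2 ⟨hv, hv'⟩) σ hg heq
  · -- main gluing argument
    have key : ∀ A B : Finset V, A ∪ B = U → (∀ u ∈ U, ∀ v ∈ U, ∀ σ, g u v σ → (u ∈ A ∧ v ∈ A) ∨ (u ∈ B ∧ v ∈ B)) →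
        2 * (A ∩ B).card ≤ s → (Z ∩ (B \ A)).card ≤ (Z ∩ (A \ B)).card → ¬ A \ B ⊆ Z → ¬ B \ A ⊆ Z → False := by
      intro A B hAB hedge hc hle h1 h2
      have hAU : A ⊆ U := hAB ▸ Finset.subset_union_left
      have hBU : B ⊆ U := hAB ▸ Finset.subset_union_right
      obtain ⟨f1, hf1T, hf1, hf1φ⟩ := hext (A ∪ Z) Z φ (by
        apply Finset.card_lt_card
        rw [Finset.not_subset] at h2
        obtain ⟨w, hw, hwZ⟩ := h2
        rw [Finset.mem_sdiff] at hw
        refine ⟨Finset.union_subset hAU hZU, fun h => ?_⟩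
        have := h (hBU hw.1)
        rw [Finset.mem_union] at this
        tauto) Finset.subset_union_right hZs hφT hφ
      let Z' := (Z ∩ (B \ A)) ∪ (A ∩ B)
      have hZ'sub : Z' ⊆ A ∪ Z := by
        intro z hz
        simp [Z'] at hz ⊢
        tauto
      have hZ'B : Z' ⊆ B := by
        intro z hz
        simp [Z'] at hz
        tauto
      have hdj : Disjoint (Z ∩ (B \ A)) (Z ∩ (A \ B)) := by
        rw [Finset.disjoint_left]
        intro z hz hz'
        simp at hz hz'
        tauto
      have hc2 : (Z ∩ (B \ A)).card + (Z ∩ (A \ B)).card ≤ Z.card := by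
        rw [← Finset.card_union_of_disjoint hdj]
        exact Finset.card_le_card (Finset.union_subset Finset.inter_subset_left Finset.inter_subset_left)
      have hc3 : Z'.card ≤ s := by
        have := Finset.card_union_le (Z ∩ (B \ A)) (A ∩ B)
        simp only [Z']
        omega
      obtain ⟨f2, hf2T, hf2, hf2φ⟩ := hext B Z' f1 (by
        apply Finset.card_lt_card
        rw [Finset.not_subset] at h1
        obtain ⟨w, hw, hwZ⟩ := h1
        rw [Finset.mem_sdiff] at hw
        exact ⟨hBU, fun h => hw.2 (h (hAU hw.1))⟩) hZ'B hc3 (fun z hz => hf1T z (hZ'sub hz))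
        (fun u hu v hv => hf1 u (hZ'sub hu) v (hZ'sub hv))
      apply hbad
      let f : V → ℕ × Bool := fun v => if v ∈ A then f1 v else f2 v
      have hfA : ∀ v ∈ A, f v = f1 v := fun v hv => by simp [f, hv]
      have hfB : ∀ v ∈ B, f v = f2 v := by
        intro v hv
        by_cases hvA : v ∈ A
        · rw [hfA v hvA, hf2φ v (by simp [Z', hv, hvA])]
        · simp [f, hvA]
      refine ⟨f, ?_, ?_, ?_⟩
      · intro u hu
        rw [← hAB, Finset.mem_union] at hu
        rcases hu with hu | hu
        · rw [hfA u hu]; exact hf1T u (by simp [hu])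
        · rw [hfB u hu]; exact hf2T u hu
      · intro u hu v hv σ hg
        rcases hedge u hu v hv σ hg with h | h
        · rw [hfA u h.1, hfA v h.2]
          exact hf1 u (by simp [h.1]) v (by simp [h.2]) σ hg
        · rw [hfB u h.1, hfB v h.2]
          exact hf2 u h.1 v h.2 σ hg
      · intro z hz
        by_cases hzA : z ∈ A
        · rw [hfA z hzA]; exact hf1φ z hz
        · have hzB : z ∈ B := by
            have := hZU hz
            rw [← hAB, Finset.mem_union] at this
            tauto
          rw [hfB z hzB, hf2φ z (by simp [Z', hz, hzA, hzB])]
          exact hf1φ z hz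
    intro A B hAB hedge hc
    by_contra hcon
    push Not at hcon
    rcases le_total (Z ∩ (B \ A)).card (Z ∩ (A \ B)).card with h | h
    · exact key A B hAB hedge hc h hcon.1 hcon.2
    · refine key B A (by rw [Finset.union_comm]; exact hAB) (fun u hu v hv σ hg => (hedge u hu v hv σ hg).symm)
        (by rw [Finset.inter_comm]; exact hc) h hcon.2 hcon.1

theorem mindeg (adj : V → V → Prop) [DecidableRel adj] (hsym : ∀ u v, adj u v → adj v u) (d : ℕ) (n : ℕ) :
    ∀ R : Finset V, R.card ≤ n →
    (¬ ∃ f : V → ℕ, (∀ v ∈ R, f v < d) ∧ ∀ u ∈ R, ∀ v ∈ R, u ≠ v → adj u v → f u ≠ f v) →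
    ∃ Y ⊆ R, Y.Nonempty ∧ ∀ v ∈ Y, d ≤ (Y.filter (fun u => u ≠ v ∧ adj v u)).card := by
  induction n with
  | zero =>
    intro R hR h
    exfalso; apply h
    have : R = ∅ := by simpa using hR
    subst this
    exact ⟨fun _ => 0, by simp, by simp⟩
  | succ n ih =>
    intro R hR h
    by_cases hd : ∀ v ∈ R, d ≤ (R.filter (fun u => u ≠ v ∧ adj v u)).card
    · refine ⟨R, subset_rfl, ?_, hd⟩
      by_contra hne
      rw [Finset.not_nonempty_iff_eq_empty] at hne
      subst hne
      exact h ⟨fun _ => 0, by simp, by simp⟩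
    push Not at hd
    obtain ⟨v, hv, hlt⟩ := hd
    obtain ⟨Y, hY, hne, hdeg⟩ := ih (R.erase v) (by rw [Finset.card_erase_of_mem hv]; omega) (by
      rintro ⟨f, hf, hp⟩
      apply h
      have : ((R.filter (fun u => u ≠ v ∧ adj v u)).image f).card < (Finset.range d).card := by
        rw [Finset.card_range]; exact lt_of_le_of_lt Finset.card_image_le hlt
      obtain ⟨c, hc, hc'⟩ := Finset.exists_mem_notMem_of_card_lt_card this
      have hcn : ∀ u ∈ R, u ≠ v → adj v u → f u ≠ c := fun u hu hne ha e =>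
        hc' (Finset.mem_image.2 ⟨u, Finset.mem_filter.2 ⟨hu, hne, ha⟩, e⟩)
      refine ⟨Function.update f v c, fun u hu => ?_, fun a ha b hb hab hadj => ?_⟩
      · by_cases huv : u = v
        · subst huv; simpa using hc
        · rw [Function.update_of_ne huv]; exact hf u (Finset.mem_erase.2 ⟨huv, hu⟩)
      · by_cases hav : a = v
        · subst hav
          rw [Function.update_self, Function.update_of_ne (Ne.symm hab)]
          exact (hcn b hb (Ne.symm hab) hadj).symm
        · by_cases hbv : b = v
          · subst hbv
            rw [Function.update_self, Function.update_of_ne hab]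
            exact hcn a ha hab (hsym _ _ hadj)
          · rw [Function.update_of_ne hav, Function.update_of_ne hbv]
            exact hp a (Finset.mem_erase.2 ⟨hav, ha⟩) b (Finset.mem_erase.2 ⟨hbv, hb⟩) hab hadj)
    exact ⟨Y, hY.trans (Finset.erase_subset _ _), hne, hdeg⟩

/-- switching -/
def sw (g : V → V → Bool → Prop) (s : V → Bool) : V → V → Bool → Prop :=
  fun u v σ => g u v (xor σ (xor (s u) (s v)))

theorem PC.mono {g g' : V → V → Bool → Prop} {B B' : Finset V} (hB : B ⊆ B')
    (h : ∀ u ∈ B, ∀ v ∈ B, g u v false → g' u v false) {a b : V} (p : PC g B a b) : PC g' B' a b := by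
  induction p with
  | refl => exact .refl
  | @tail c d _ h2 ih => exact ih.tail ⟨hB h2.1, hB h2.2.1, h c h2.1 d h2.2.1 h2.2.2⟩

theorem PC.symm {g : V → V → Bool → Prop} (hs : ∀ u v σ, g u v σ → g v u σ) {B : Finset V} {a b : V}
    (p : PC g B a b) : PC g B b a := by
  induction p with
  | refl => exact .refl
  | tail _ h2 ih => exact Relation.ReflTransGen.head ⟨h2.2.1, h2.1, hs _ _ _ h2.2.2⟩ ih

theorem sw_sym {g : V → V → Bool → Prop} (hs : ∀ u v σ, g u v σ → g v u σ) (s : V → Bool) :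
    ∀ u v σ, sw g s u v σ → sw g s v u σ := by
  intro u v σ h
  have := hs _ _ _ h
  unfold sw
  rwa [Bool.xor_comm (s v) (s u)]

theorem sw_congr {g : V → V → Bool → Prop} {s s' : V → Bool} {u v : V} {σ : Bool} (hu : s u = s' u) (hv : s v = s' v) :
    sw g s u v σ → sw g s' u v σ := by
  unfold sw; rw [hu, hv]; exact id

theorem blobs [Fintype V] (g : V → V → Bool → Prop) (hsym : ∀ u v σ, g u v σ → g v u σ) (hl : ∀ v σ, g v v σ → σ = false)
    (n : ℕ) : ∀ R : Finset V, R.card ≤ n → ∃ (s : V → Bool) (p : V → V),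
    (∀ u ∈ R, p u ∈ R) ∧
    (∀ u ∈ R, ∀ v ∈ R, p u = p v → PC (sw g s) (R.filter (fun w => p w = p u)) u v) ∧
    (∀ u ∈ R, ∀ v ∈ R, ∀ σ, sw g s u v σ → p u = p v → σ = false) ∧
    (∀ u ∈ R, ∀ v ∈ R, ∀ σ, sw g s u v σ → p u ≠ p v → ∀ τ, ∃ a ∈ R, ∃ b ∈ R, p a = p u ∧ p b = p v ∧ sw g s a b τ) := by
  classical
  induction n with
  | zero =>
    intro R hR
    have : R = ∅ := by simpa using hR
    subst this
    exact ⟨fun _ => false, id, by simp, by simp, by simp, by simp⟩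
  | succ n ih =>
    intro R hR
    rcases R.eq_empty_or_nonempty with rfl | ⟨r0, hr0⟩
    · exact ⟨fun _ => false, id, by simp, by simp, by simp, by simp⟩
    obtain ⟨⟨X, s1⟩, ⟨hXR, hXne, hXc, hXp⟩, hmax⟩ := Set.exists_max_image
      {q : Finset V × (V → Bool) | q.1 ⊆ R ∧ q.1.Nonempty ∧ (∀ u ∈ q.1, ∀ v ∈ q.1, PC (sw g q.2) q.1 u v) ∧
        ∀ u ∈ q.1, ∀ v ∈ q.1, ∀ σ, sw g q.2 u v σ → σ = false} (fun q => q.1.card) (Set.toFinite _)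
      ⟨({r0}, fun _ => false), by simpa using hr0, by simp, by
        intro u hu v hv
        simp at hu hv; subst hu; subst hv; exact .refl, by
        intro u hu v hv σ h
        simp at hu hv; subst hu; subst hv
        exact hl _ _ (by simpa [sw] using h)⟩
    simp only at hXR hXne hXc hXp hmax
    -- every outside vertex adjacent to X is joined by both signs
    have hboth : ∀ b ∈ R, b ∉ X → ∀ a ∈ X, ∀ σ, g a b σ → ∀ t : V → Bool, (∀ a ∈ X, t a = s1 a) → ∀ τ, ∃ a' ∈ X, sw g t a' b τ := by
      intro b hb hbX a ha σ hg t ht τ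
      let s2 : V → Bool := Function.update s1 b (xor σ (s1 a))
      have hs2 : ∀ w ∈ X, s2 w = s1 w := fun w hw => by
        simp only [s2]; rw [Function.update_of_ne (by rintro rfl; exact hbX hw)]
      have hs2b : s2 b = xor σ (s1 a) := by simp [s2]
      have hab : sw g s2 a b false := by
        unfold sw
        rw [hs2 a ha, hs2b]
        cases σ <;> cases h : s1 a <;> simpa [h] using hg
      have hPC : ∀ u ∈ X, ∀ v ∈ X, PC (sw g s2) (insert b X) u v := fun u hu v hv =>
        (hXc u hu v hv).mono (Finset.subset_insert _ _) (fun c hc d hd h => sw_congr (hs2 c hc).symm (hs2 d hd).symm h)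
      have hsy := sw_sym hsym s2
      have hstep : ∀ u ∈ X, PC (sw g s2) (insert b X) u b := fun u hu =>
        (hPC u hu a ha).tail ⟨by simp [ha], by simp, hab⟩
      by_contra hcon
      push Not at hcon
      -- then insert b X is consistent
      have hcard := hmax (insert b X, s2) ⟨Finset.insert_subset hb hXR, by simp, ?_, ?_⟩
      · simp only at hcard
        rw [Finset.card_insert_of_notMem hbX] at hcard
        omega
      · intro u hu v hv
        simp only [Finset.mem_insert] at hu hv
        rcases hu with rfl | hu <;> rcases hv with rfl | hv
        · exact .refl
        · exact (hstep v hv).symm hsy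
        · exact hstep u hu
        · exact hPC u hu v hv
      · -- all signs from X to b agree
        have hall : ∀ a' ∈ X, ∀ ρ, sw g s2 a' b ρ → ρ = false := by
          intro a' ha' ρ hρ
          have h1 := hcon a' ha'
          have h2 := hcon a ha
          unfold sw at h1 h2 hρ
          rw [ht a' ha'] at h1
          rw [ht a ha] at h2
          rw [hs2 a' ha', hs2b] at hρ
          have e1 : ∀ ρ', g a' b ρ' → ρ' = !(xor τ (xor (s1 a') (t b))) := by
            intro ρ' h'
            by_contra hne
            apply h1
            have : ρ' = xor τ (xor (s1 a') (t b)) := by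
              revert hne; cases ρ' <;> cases (xor τ (xor (s1 a') (t b))) <;> simp
            rwa [← this]
          have e2 : ∀ ρ', g a b ρ' → ρ' = !(xor τ (xor (s1 a) (t b))) := by
            intro ρ' h'
            by_contra hne
            apply h2
            have : ρ' = xor τ (xor (s1 a) (t b)) := by
              revert hne; cases ρ' <;> cases (xor τ (xor (s1 a) (t b))) <;> simp
            rwa [← this]
          have e3 := e1 _ hρ
          have e4 := e2 _ hg
          revert e3 e4
          cases ρ <;> cases σ <;> cases τ <;> cases s1 a <;> cases s1 a' <;> cases t b <;> simp
        intro u hu v hv ρ hρ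
        simp only [Finset.mem_insert] at hu hv
        rcases hu with rfl | hu <;> rcases hv with rfl | hv
        · exact hl _ _ (by simpa [sw] using hρ)
        · exact hall v hv ρ (hsy _ _ _ hρ)
        · exact hall u hu ρ hρ
        · exact hXp u hu v hv ρ (sw_congr (hs2 u hu) (hs2 v hv) hρ)
    obtain ⟨r, hr⟩ := hXne
    obtain ⟨s', p', hp1, hp2, hp3, hp4⟩ := ih (R \ X) (by
      have h1 := Finset.card_sdiff_add_card_eq_card hXR
      have h2 := Finset.card_pos.2 ⟨r, hr⟩
      omega)
    let s : V → Bool := fun v => if v ∈ X then s1 v else s' v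
    let p : V → V := fun v => if v ∈ X then r else p' v
    have hsX : ∀ v ∈ X, s v = s1 v := fun v hv => by simp [s, hv]
    have hsN : ∀ v, v ∉ X → s v = s' v := fun v hv => by simp [s, hv]
    have hpX : ∀ v ∈ X, p v = r := fun v hv => by simp [p, hv]
    have hpN : ∀ v, v ∉ X → p v = p' v := fun v hv => by simp [p, hv]
    have hsd : ∀ v ∈ R, v ∉ X → v ∈ R \ X := fun v h1 h2 => Finset.mem_sdiff.2 ⟨h1, h2⟩
    have hpne : ∀ v ∈ R, v ∉ X → p v ≠ r := by
      intro v hv hvX e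
      have := hp1 v (hsd v hv hvX)
      rw [hpN v hvX] at e
      rw [e] at this
      exact (Finset.mem_sdiff.1 this).2 hr
    refine ⟨s, p, ?_, ?_, ?_, ?_⟩
    · intro u hu
      by_cases h : u ∈ X
      · rw [hpX u h]; exact hXR hr
      · rw [hpN u h]; exact (Finset.mem_sdiff.1 (hp1 u (hsd u hu h))).1
    · intro u hu v hv huv
      by_cases hx : u ∈ X
      · have hvX : v ∈ X := by
          by_contra hvX
          exact hpne v hv hvX (huv ▸ hpX u hx)
        refine (hXc u hx v hvX).mono ?_ (fun c hc d hd h => sw_congr (hsX c hc).symm (hsX d hd).symm h)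
        intro w hw
        rw [Finset.mem_filter]
        exact ⟨hXR hw, by rw [hpX w hw, hpX u hx]⟩
      · have hvX : v ∉ X := fun hvX => hpne u hu hx (huv.trans (hpX v hvX))
        rw [hpN u hx, hpN v hvX] at huv
        refine (hp2 u (hsd u hu hx) v (hsd v hv hvX) huv).mono ?_ ?_
        · intro w hw
          rw [Finset.mem_filter, Finset.mem_sdiff] at hw
          rw [Finset.mem_filter]
          exact ⟨hw.1.1, by rw [hpN w hw.1.2, hpN u hx]; exact hw.2⟩
        · intro c hc d hd h
          rw [Finset.mem_filter, Finset.mem_sdiff] at hc hd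
          exact sw_congr (hsN c hc.1.2).symm (hsN d hd.1.2).symm h
    · intro u hu v hv σ hg huv
      by_cases hx : u ∈ X
      · have hvX : v ∈ X := by
          by_contra hvX
          exact hpne v hv hvX (huv ▸ hpX u hx)
        exact hXp u hx v hvX σ (sw_congr (hsX u hx) (hsX v hvX) hg)
      · have hvX : v ∉ X := fun hvX => hpne u hu hx (huv.trans (hpX v hvX))
        rw [hpN u hx, hpN v hvX] at huv
        exact hp3 u (hsd u hu hx) v (hsd v hv hvX) σ (sw_congr (hsN u hx) (hsN v hvX) hg) huv
    · intro u hu v hv σ hg huv τ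
      by_cases hx : u ∈ X <;> by_cases hvX : v ∈ X
      · exact absurd ((hpX u hx).trans (hpX v hvX).symm) huv
      · obtain ⟨a, ha, h⟩ := hboth v hv hvX u hx _ hg s hsX τ
        exact ⟨a, hXR ha, v, hv, (hpX a ha).trans (hpX u hx).symm, rfl, h⟩
      · obtain ⟨a, ha, h⟩ := hboth u hu hx v hvX _ (sw_sym hsym s _ _ _ hg) s hsX τ
        exact ⟨u, hu, a, hXR ha, rfl, (hpX a ha).trans (hpX v hvX).symm, sw_sym hsym s _ _ _ h⟩
      · rw [hpN u hx, hpN v hvX] at huv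
        obtain ⟨a, ha, b, hb, h1, h2, h3⟩ := hp4 u (hsd u hu hx) v (hsd v hv hvX) σ (sw_congr (hsN u hx) (hsN v hvX) hg) huv τ
        have ha' := Finset.mem_sdiff.1 ha
        have hb' := Finset.mem_sdiff.1 hb
        refine ⟨a, ha'.1, b, hb'.1, ?_, ?_, sw_congr (hsN a ha'.2).symm (hsN b hb'.2).symm h3⟩
        · rw [hpN a ha'.2, hpN u hx]; exact h1
        · rw [hpN b hb'.2, hpN v hvX]; exact h2

end

end SGP

namespace SGP

section
variable {V : Type} [DecidableEq V]

/-- the contraction map on labels -/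
def ctr (i j : V) (a : V) : V := if a = j then i else a

/-- Mader's local density argument for a class closed under deletion and contraction -/
theorem mader_abs (P : Finset V → Finset (V × V) → Prop) (c : ℕ) (hc : 1 ≤ c)
    (hin : ∀ I H, P I H → ∀ a b, (a, b) ∈ H → a ∈ I ∧ b ∈ I ∧ a ≠ b ∧ (b, a) ∈ H)
    (hdel : ∀ I H, P I H → ∀ I' H', I' ⊆ I → H' ⊆ H → (∀ a b, (a, b) ∈ H' → a ∈ I' ∧ b ∈ I' ∧ (b, a) ∈ H') → P I' H')
    (hctr : ∀ I H, P I H → ∀ i j, (i, j) ∈ H →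
      P (I.erase j) ((H.image (fun q => (ctr i j q.1, ctr i j q.2))).filter (fun q => q.1 ≠ q.2)))
    (hstart : ∃ I H, P I H ∧ I.Nonempty ∧ 2 * c * I.card ≤ H.card) :
    ∃ I H, P I H ∧ I.Nonempty ∧ I.card ≤ 2 * c + 1 ∧ ∀ i ∈ I, c + 1 ≤ (I.filter (fun b => (i, b) ∈ H)).card := by
  classical
  let Q : ℕ → Prop := fun n => ∃ I H, P I H ∧ I.Nonempty ∧ 2 * c * I.card ≤ H.card ∧ I.card + H.card = n
  have hQ : ∃ n, Q n := by
    obtain ⟨I, H, h1, h2, h3⟩ := hstart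
    exact ⟨_, I, H, h1, h2, h3, rfl⟩
  obtain ⟨I, H, hP, hI, hd, hn⟩ := Nat.find_spec hQ
  have hmin : ∀ I' H', P I' H' → I'.Nonempty → 2 * c * I'.card ≤ H'.card → I.card + H.card ≤ I'.card + H'.card := by
    intro I' H' h1 h2 h3
    rw [hn]
    exact Nat.find_min' hQ ⟨I', H', h1, h2, h3, rfl⟩
  clear_value Q
  have hin' := hin I H hP
  have hH : H.Nonempty := by
    rw [← Finset.card_pos]
    have := hI.card_pos
    have : 0 < 2 * c * I.card := by positivity
    omega
  -- edge deletion
  have hup : H.card ≤ 2 * c * I.card + 1 := by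
    by_contra hcon
    obtain ⟨⟨a, b⟩, hab⟩ := hH
    have h1 := hin' a b hab
    have hne : ((a, b) : V × V) ≠ (b, a) := by
      intro h; simp at h; exact h1.2.2.1 h.1
    have hsub : ({(a, b), (b, a)} : Finset (V × V)) ⊆ H := by
      intro q hq; simp at hq; rcases hq with rfl | rfl
      · exact hab
      · exact h1.2.2.2
    have hcard : (H \ {(a, b), (b, a)}).card = H.card - 2 := by
      rw [Finset.card_sdiff_of_subset hsub, Finset.card_pair hne]
    have := hmin I (H \ {(a, b), (b, a)}) ?_ hI (by omega)
    · omega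
    · apply hdel I H hP _ _ subset_rfl Finset.sdiff_subset
      intro a' b' h
      simp only [Finset.mem_sdiff, Finset.mem_insert, Finset.mem_singleton, Prod.mk.injEq] at h ⊢
      have := hin' a' b' h.1
      refine ⟨this.1, this.2.1, this.2.2.2, ?_⟩
      tauto
  -- contraction
  have hcom : ∀ i j, (i, j) ∈ H → c ≤ (I.filter (fun a => (i, a) ∈ H ∧ (j, a) ∈ H)).card := by
    intro i j hij
    by_contra hcon
    set C := I.filter (fun a => (i, a) ∈ H ∧ (j, a) ∈ H) with hC
    have h1 := hin' i j hij
    set H' := (H.image (fun q => (ctr i j q.1, ctr i j q.2))).filter (fun q => q.1 ≠ q.2) with hH'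
    let Bad : Finset (V × V) := ({(i, j), (j, i)} ∪ C.image (fun a => (j, a))) ∪ C.image (fun a => (a, j))
    have hBad : Bad.card ≤ 2 + C.card + C.card := by
      refine (Finset.card_union_le _ _).trans (add_le_add ((Finset.card_union_le _ _).trans (add_le_add Finset.card_le_two ?_)) ?_) <;>
        exact Finset.card_image_le
    have hmap : (H \ Bad).card ≤ H'.card := by
      apply Finset.card_le_card_of_injOn (fun q => (ctr i j q.1, ctr i j q.2))
      · rintro ⟨a, b⟩ hab
        simp only [Finset.coe_sdiff, Set.mem_sdiff, Finset.mem_coe] at hab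
        have h2 := hin' a b hab.1
        simp only [hH', Finset.coe_filter, Set.mem_ofPred_eq]
        refine ⟨Finset.mem_image.2 ⟨_, hab.1, rfl⟩, ?_⟩
        have h3 := hab.2
        simp only [Bad, Finset.mem_union, Finset.mem_insert, Finset.mem_singleton, Prod.mk.injEq] at h3
        unfold ctr
        intro h
        grind
      · rintro ⟨a, b⟩ hab ⟨a', b'⟩ hab' heq
        simp only [Finset.coe_sdiff, Set.mem_sdiff, Finset.mem_coe] at hab hab'
        have h2 := hin' a b hab.1
        have h2' := hin' a' b' hab'.1
        have h3 := hab.2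
        have h3' := hab'.2
        simp only [Bad, Finset.mem_union, Finset.mem_insert, Finset.mem_singleton, Prod.mk.injEq, Finset.mem_image, hC, Finset.mem_filter] at h3 h3'
        simp only [Prod.mk.injEq, ctr] at heq ⊢
        grind
    have h4 : H.card ≤ (H \ Bad).card + Bad.card := by
      have := Finset.card_le_card_sdiff_add_card (s := H) (t := Bad)
      omega
    have h5 : (I.erase j).card = I.card - 1 := Finset.card_erase_of_mem h1.2.1
    have h6 : (I.erase j).Nonempty := ⟨i, Finset.mem_erase.2 ⟨h1.2.2.1, h1.1⟩⟩
    have h7 := hmin (I.erase j) H' (hctr I H hP i j hij) h6 (by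
      rw [h5, Nat.mul_sub]; omega)
    have h8 : H'.card ≤ H.card := (Finset.card_filter_le _ _).trans Finset.card_image_le
    have := hI.card_pos
    omega
  -- degree one
  have hI2 : 2 ≤ I.card := by
    obtain ⟨⟨a, b⟩, hab⟩ := hH
    have h1 := hin' a b hab
    rw [← Finset.card_pair h1.2.2.1]
    apply Finset.card_le_card
    intro z hz; simp at hz; rcases hz with rfl | rfl
    · exact h1.1
    · exact h1.2.1
  have hpos : ∀ v ∈ I, ∃ w, (v, w) ∈ H := by
    intro v hv
    by_contra hcon
    push Not at hcon
    have h5 : (I.erase v).card = I.card - 1 := Finset.card_erase_of_mem hv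
    have := hmin (I.erase v) H ?_ (by rw [← Finset.card_pos]; omega) (by rw [h5, Nat.mul_sub]; omega)
    · omega
    · apply hdel I H hP _ _ (Finset.erase_subset _ _) subset_rfl
      intro a b hab
      have h1 := hin' a b hab
      refine ⟨Finset.mem_erase.2 ⟨?_, h1.1⟩, Finset.mem_erase.2 ⟨?_, h1.2.1⟩, h1.2.2.2⟩
      · rintro rfl; exact hcon _ hab
      · rintro rfl; exact hcon _ h1.2.2.2
  have hsum : H.card = ∑ v ∈ I, (I.filter (fun b => (v, b) ∈ H)).card := by
    rw [← Finset.card_sigma]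
    apply Finset.card_bij' (fun q _ => (⟨q.1, q.2⟩ : Σ _ : V, V)) (fun q _ => (q.1, q.2))
    · rintro ⟨a, b⟩ h
      have := hin' a b h
      simp [this.1, this.2.1, h]
    · rintro ⟨a, b⟩ h
      simp at h; exact h.2.2
    · simp
    · simp
  obtain ⟨v, hv, hdv⟩ : ∃ v ∈ I, (I.filter (fun b => (v, b) ∈ H)).card ≤ 2 * c := by
    by_contra hcon
    push Not at hcon
    have : ∑ v ∈ I, (2 * c + 1) ≤ ∑ v ∈ I, (I.filter (fun b => (v, b) ∈ H)).card :=
      Finset.sum_le_sum (fun v hv => hcon v hv)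
    rw [← hsum, Finset.sum_const, smul_eq_mul] at this
    have h2 : I.card * (2 * c + 1) = 2 * c * I.card + I.card := by ring
    omega
  set Nv := I.filter (fun b => (v, b) ∈ H) with hNv
  have hvN : v ∉ Nv := by
    simp only [hNv, Finset.mem_filter, not_and]
    intro _ h; exact (hin' v v h).2.2.1 rfl
  refine ⟨insert v Nv, H.filter (fun q => q.1 ∈ insert v Nv ∧ q.2 ∈ insert v Nv), ?_, ⟨v, by simp⟩, ?_, ?_⟩
  · apply hdel I H hP
    · intro z hz
      rcases Finset.mem_insert.1 hz with rfl | hz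
      · exact hv
      · exact (Finset.mem_filter.1 hz).1
    · exact Finset.filter_subset _ _
    · intro a b hab
      rw [Finset.mem_filter] at hab
      exact ⟨hab.2.1, hab.2.2, Finset.mem_filter.2 ⟨(hin' a b hab.1).2.2.2, hab.2.2, hab.2.1⟩⟩
  · rw [Finset.card_insert_of_notMem hvN]; omega
  · intro i hi
    rcases Finset.mem_insert.1 hi with rfl | hi'
    · obtain ⟨w, hw⟩ := hpos i hv
      have h1 := hcom i w hw
      have h2 : w ∉ I.filter (fun a => (i, a) ∈ H ∧ (w, a) ∈ H) := by
        simp only [Finset.mem_filter, not_and]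
        intro _ _ h; exact (hin' _ _ h).2.2.1 rfl
      calc c + 1 ≤ (insert w (I.filter (fun a => (i, a) ∈ H ∧ (w, a) ∈ H))).card := by
            rw [Finset.card_insert_of_notMem h2]; omega
        _ ≤ _ := by
            apply Finset.card_le_card
            intro z hz
            have hz' : (i, z) ∈ H := by
              rcases Finset.mem_insert.1 hz with rfl | hz
              · exact hw
              · exact (Finset.mem_filter.1 hz).2.1
            have : z ∈ Nv := Finset.mem_filter.2 ⟨(hin' _ _ hz').2.1, hz'⟩
            simp [this, hz']
    · have hvi : (v, i) ∈ H := (Finset.mem_filter.1 hi').2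
      have h1 := hcom v i hvi
      have h2 : v ∉ I.filter (fun a => (v, a) ∈ H ∧ (i, a) ∈ H) := by
        simp only [Finset.mem_filter, not_and]
        intro _ h; exact absurd rfl (hin' _ _ h).2.2.1
      calc c + 1 ≤ (insert v (I.filter (fun a => (v, a) ∈ H ∧ (i, a) ∈ H))).card := by
            rw [Finset.card_insert_of_notMem h2]; omega
        _ ≤ _ := by
            apply Finset.card_le_card
            intro z hz
            rcases Finset.mem_insert.1 hz with rfl | hz
            · simp [hi', (hin' _ _ hvi).2.2.2]
            · have h3 := (Finset.mem_filter.1 hz).2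
              have : z ∈ Nv := Finset.mem_filter.2 ⟨(hin' _ _ h3.1).2.1, h3.1⟩
              simp [this, hi', h3.2]


/-- a family of bags realizing the label graph `H` by digons -/
structure Fam (g : V → V → Bool → Prop) (R : Finset V) (Bg : V → Finset V) (I : Finset V)
    (H : Finset (V × V)) : Prop where
  edge : ∀ a b, (a, b) ∈ H → a ∈ I ∧ b ∈ I ∧ a ≠ b ∧ (b, a) ∈ H
  dig : ∀ a b, (a, b) ∈ H → ∀ σ, ∃ u ∈ Bg a, ∃ v ∈ Bg b, g u v σ
  disj : ∀ a ∈ I, ∀ b ∈ I, a ≠ b → Disjoint (Bg a) (Bg b)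
  ne : ∀ a ∈ I, (Bg a).Nonempty
  sub : ∀ a ∈ I, Bg a ⊆ R
  conn : ∀ a ∈ I, ∀ y ∈ Bg a, ∀ z ∈ Bg a, PC g (Bg a) y z

theorem Fam.contract {g : V → V → Bool → Prop} (hsym : ∀ u v σ, g u v σ → g v u σ) {R : Finset V} {Bg : V → Finset V} {I : Finset V}
    {H : Finset (V × V)} (h : Fam g R Bg I H) (i j : V) (hij : (i, j) ∈ H) :
    Fam g R (fun a => if a = i then Bg i ∪ Bg j else Bg a) (I.erase j)
      ((H.image (fun q => (ctr i j q.1, ctr i j q.2))).filter (fun q => q.1 ≠ q.2)) := by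
  have h0 := h.edge i j hij
  have hsub : ∀ a, a ∈ I → Bg a ⊆ (if ctr i j a = i then Bg i ∪ Bg j else Bg (ctr i j a)) := by
    intro a _
    unfold ctr
    by_cases h1 : a = j
    · subst h1; simp
    · by_cases h2 : a = i
      · subst h2; simp
      · simp [h1, h2]
  have hmem : ∀ a ∈ I, ctr i j a ∈ I.erase j := by
    intro a ha
    unfold ctr
    split_ifs with h1
    · exact Finset.mem_erase.2 ⟨h0.2.2.1, h0.1⟩
    · exact Finset.mem_erase.2 ⟨h1, ha⟩
  constructor
  · intro a b hab
    simp only [Finset.mem_filter, Finset.mem_image, Prod.mk.injEq, Prod.exists] at hab ⊢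
    obtain ⟨⟨a', b', hab', rfl, rfl⟩, hne⟩ := hab
    have h1 := h.edge _ _ hab'
    exact ⟨hmem _ h1.1, hmem _ h1.2.1, hne, ⟨b', a', h1.2.2.2, rfl, rfl⟩, hne.symm⟩
  · intro a b hab σ
    simp only [Finset.mem_filter, Finset.mem_image, Prod.mk.injEq, Prod.exists] at hab ⊢
    obtain ⟨⟨a', b', hab', rfl, rfl⟩, hne⟩ := hab
    have h1 := h.edge _ _ hab'
    obtain ⟨u, hu, v, hv, huv⟩ := h.dig _ _ hab' σ
    exact ⟨u, hsub _ h1.1 hu, v, hsub _ h1.2.1 hv, huv⟩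
  · intro a ha b hb hab
    simp only [Finset.mem_erase] at ha hb
    split_ifs with h1 h2 h2
    · exact absurd (h1.trans h2.symm) hab
    · rw [Finset.disjoint_union_left]
      exact ⟨h.disj _ h0.1 _ hb.2 (Ne.symm h2), h.disj _ h0.2.1 _ hb.2 (Ne.symm hb.1)⟩
    · rw [Finset.disjoint_union_right]
      exact ⟨h.disj _ ha.2 _ h0.1 h1, h.disj _ ha.2 _ h0.2.1 ha.1⟩
    · exact h.disj _ ha.2 _ hb.2 hab
  · intro a ha
    simp only [Finset.mem_erase] at ha
    split_ifs with h1
    · exact (h.ne _ h0.1).mono Finset.subset_union_left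
    · exact h.ne _ ha.2
  · intro a ha
    simp only [Finset.mem_erase] at ha
    split_ifs with h1
    · exact Finset.union_subset (h.sub _ h0.1) (h.sub _ h0.2.1)
    · exact h.sub _ ha.2
  · intro a ha
    simp only [Finset.mem_erase] at ha
    split_ifs with h1
    · obtain ⟨u, hu, v, hv, huv⟩ := h.dig _ _ hij false
      have hto : ∀ y ∈ Bg i ∪ Bg j, PC g (Bg i ∪ Bg j) y u := by
        intro y hy
        rcases Finset.mem_union.1 hy with hy | hy
        · exact PC.mono Finset.subset_union_left (fun _ _ _ _ h => h) (h.conn _ h0.1 y hy u hu)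
        · have h2 := PC.mono (g' := g) (B' := Bg i ∪ Bg j) Finset.subset_union_right (fun _ _ _ _ h => h) (h.conn _ h0.2.1 y hy v hv)
          exact Relation.ReflTransGen.tail h2 ⟨Finset.mem_union_right _ hv, Finset.mem_union_left _ hu, hsym _ _ _ huv⟩
      intro y hy z hz
      exact Relation.ReflTransGen.trans (hto y hy) (PC.symm hsym (hto z hz))
    · exact h.conn _ ha.2

theorem mader [Fintype V] (g : V → V → Bool → Prop) (hsym : ∀ u v σ, g u v σ → g v u σ) (hl : ∀ v σ, g v v σ → σ = false)
    (R : Finset V) (c : ℕ) (hc : 1 ≤ c) (hno : ¬ ColS g R (Finset.range (2 * c))) :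
    ∃ (s : V → Bool) (Bg : V → Finset V) (I : Finset V) (H : Finset (V × V)), Fam (sw g s) R Bg I H ∧ I.Nonempty ∧
      I.card ≤ 2 * c + 1 ∧ ∀ i ∈ I, c + 1 ≤ (I.filter (fun b => (i, b) ∈ H)).card := by
  classical
  obtain ⟨s, p, hp1, hp2, hp3, hp4⟩ := blobs g hsym hl _ R le_rfl
  have hss := sw_sym hsym s
  let adj : V → V → Prop := fun i j => i ≠ j ∧ ∃ a ∈ R, ∃ b ∈ R, p a = i ∧ p b = j ∧ ∃ σ, sw g s a b σ
  have hadj : ∀ u v, adj u v → adj v u := by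
    rintro u v ⟨h1, a, ha, b, hb, h2, h3, σ, h4⟩
    exact ⟨h1.symm, b, hb, a, ha, h3, h2, σ, hss _ _ _ h4⟩
  obtain ⟨Y, hYR, hYne, hY⟩ := mindeg adj hadj (2 * c) _ (R.image p) le_rfl (by
    rintro ⟨f, hf1, hf2⟩
    apply hno
    refine ⟨fun v => (f (p v), s v), fun u hu => Finset.mem_range.2 (hf1 _ (Finset.mem_image_of_mem _ hu)), ?_⟩
    intro u hu v hv σ huv heq
    simp only at heq
    have hsw : sw g s u v (xor σ (xor (s u) (s v))) := by
      unfold sw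
      rw [Bool.xor_assoc, Bool.xor_self, Bool.xor_false]; exact huv
    by_cases hpp : p u = p v
    · have := hp3 u hu v hv _ hsw hpp
      simp only
      revert this
      cases σ <;> cases s u <;> cases s v <;> simp
    · exact absurd heq (hf2 _ (Finset.mem_image_of_mem _ hu) _ (Finset.mem_image_of_mem _ hv) hpp
        ⟨hpp, u, hu, v, hv, rfl, rfl, _, hsw⟩))
  obtain ⟨I, H, ⟨Bg, hF⟩, h1, h2, h3⟩ := mader_abs (fun I H => ∃ Bg, Fam (sw g s) R Bg I H) c hc
    (fun I H ⟨Bg, hF⟩ => hF.edge)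
    (by
      rintro I H ⟨Bg, hF⟩ I' H' hI' hH' he
      exact ⟨Bg, fun a b hab => ⟨(he a b hab).1, (he a b hab).2.1, (hF.edge a b (hH' hab)).2.2.1, (he a b hab).2.2⟩,
        fun a b hab => hF.dig a b (hH' hab), fun a ha b hb => hF.disj a (hI' ha) b (hI' hb), fun a ha => hF.ne a (hI' ha),
        fun a ha => hF.sub a (hI' ha), fun a ha => hF.conn a (hI' ha)⟩)
    (fun I H ⟨Bg, hF⟩ i j hij => ⟨_, hF.contract hss i j hij⟩)
    (by
      refine ⟨Y, (Y ×ˢ Y).filter (fun q => adj q.1 q.2), ⟨fun a => R.filter (fun w => p w = a), ?_⟩, hYne, ?_⟩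
      · constructor
        · intro a b hab
          simp only [Finset.mem_filter, Finset.mem_product] at hab ⊢
          exact ⟨hab.1.1, hab.1.2, hab.2.1, ⟨hab.1.2, hab.1.1⟩, hadj _ _ hab.2⟩
        · intro a b hab σ
          simp only [Finset.mem_filter, Finset.mem_product] at hab ⊢
          obtain ⟨_, hne, u, hu, v, hv, rfl, rfl, τ, huv⟩ := hab
          obtain ⟨x, hx, y, hy, h1, h2, h3⟩ := hp4 u hu v hv τ huv hne σ
          exact ⟨x, ⟨hx, h1⟩, y, ⟨hy, h2⟩, h3⟩
        · intro a _ b _ hab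
          rw [Finset.disjoint_left]
          intro z hz hz'
          simp only [Finset.mem_filter] at hz hz'
          exact hab (hz.2.symm.trans hz'.2)
        · intro a ha
          obtain ⟨u, hu, rfl⟩ := Finset.mem_image.1 (hYR ha)
          exact ⟨u, by simp [hu]⟩
        · intro a _; exact Finset.filter_subset _ _
        · intro a _ y hy z hz
          simp only [Finset.mem_filter] at hy hz
          obtain ⟨hy, rfl⟩ := hy
          exact hp2 y hy z hz.1 hz.2.symm
      · have : ((Y ×ˢ Y).filter (fun q => adj q.1 q.2)).card = ∑ v ∈ Y, (Y.filter (fun u => adj v u)).card := by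
          rw [Finset.card_filter, Finset.sum_product]
          simp [Finset.card_filter]
        rw [this, mul_comm, ← smul_eq_mul, ← Finset.sum_const]
        apply Finset.sum_le_sum
        intro v hv
        refine (hY v hv).trans (Finset.card_le_card ?_)
        intro z hz
        simp only [Finset.mem_filter] at hz ⊢
        exact ⟨hz.1, hz.2.2⟩)
  exact ⟨s, Bg, I, H, hF, h1, h2, h3⟩

end

end SGP

namespace SGP

section
variable {V : Type} [DecidableEq V]

theorem SP.unsw {g : V → V → Bool → Prop} {s : V → Bool} {a b : V} {σ : Bool} {S : Finset V}
    (h : SP (sw g s) a b σ S) : SP g a b (xor σ (xor (s a) (s b))) S := by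
  induction h with
  | nil a => simpa using SP.nil a
  | @cons a b c σ τ S h1 _ h3 ih =>
    have h1' : g a b (xor σ (xor (s a) (s b))) := h1
    have := SP.cons h1' ih h3
    convert this using 1
    cases σ <;> cases τ <;> cases s a <;> cases s b <;> cases s c <;> rfl

set_option maxHeartbeats 1000000 in
theorem core [Fintype V] (g : V → V → Bool → Prop) (hsym : ∀ u v σ, g u v σ → g v u σ) (hl : ∀ v σ, g v v σ → σ = false)
    {ι : Type} [Fintype ι] [DecidableEq ι] (k N : ℕ) (hk : 1 ≤ k) (hN : N = Fintype.card ι) (hNpos : 1 ≤ N)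
    (ep : ι → Fin k × Fin k) (target : ι → Bool)
    (hno : ¬ ColS g Finset.univ (Finset.range (26 * N + 3 * k - 8))) :
    ∃ (φ : Fin k → V) (x : ι × Bool → V) (S : ι → Finset V) (α β γ : ι → Bool), Function.Injective φ ∧
      (∀ e, g (φ (ep e).1) (x (e, false)) (α e)) ∧ (∀ e, g (x (e, true)) (φ (ep e).2) (β e)) ∧
      (∀ e, SP g (x (e, false)) (x (e, true)) (γ e) (S e)) ∧ (∀ e, xor (α e) (xor (γ e) (β e)) = target e) ∧
      (∀ e f, e ≠ f → Disjoint (S e) (S f)) ∧ (∀ e i, φ i ∉ S e) := by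
  classical
  obtain ⟨U, Z, hZU, hZc, hcol, hconn⟩ := connectivity g (26 * N + 3 * k - 8) (4 * N + 2 * k - 2) hno
  have hTs : 26 * N + 3 * k - 8 - (4 * N + 2 * k - 2) = 22 * N - 6 + k := by omega
  rw [hTs] at hcol
  let adj : V → V → Prop := fun u v => ∃ σ, g u v σ
  obtain ⟨Y, hYU, hYne, hY⟩ := mindeg adj (fun u v ⟨σ, h⟩ => ⟨σ, hsym _ _ _ h⟩) (22 * N - 6 + k) _ (U \ Z) le_rfl (by
    rintro ⟨f, hf1, hf2⟩
    apply hcol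
    refine ⟨fun v => (f v, false), fun u hu => Finset.mem_range.2 (hf1 u hu), ?_⟩
    intro u hu v hv σ huv heq
    by_cases h : u = v
    · subst h; simpa using hl _ _ huv
    · exact absurd heq (hf2 u hu v hv h ⟨σ, huv⟩))
  obtain ⟨Br, hBrY, hBrc⟩ : ∃ Br ⊆ Y, Br.card = k := by
    apply Finset.exists_subset_card_eq
    obtain ⟨v, hv⟩ := hYne
    have := (hY v hv).trans (Finset.card_filter_le _ _)
    omega
  let φe := (Finset.equivFinOfCardEq hBrc).symm
  let φ : Fin k → V := fun i => (φe i : V)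
  have hφB : ∀ i, φ i ∈ Br := fun i => (φe i).2
  have hφinj : Function.Injective φ := fun i j h => φe.injective (Subtype.ext h)
  let M : ι × Bool → Finset V := fun q =>
    (Y.filter (fun u => u ≠ φ (if q.2 then (ep q.1).2 else (ep q.1).1) ∧ adj (φ (if q.2 then (ep q.1).2 else (ep q.1).1)) u)) \ Br
  obtain ⟨x, hxinj, hxM⟩ := sdr M (by
    intro q
    have h1 := hY (φ (if q.2 then (ep q.1).2 else (ep q.1).1)) (hBrY (hφB _))
    have h2 := Finset.le_card_sdiff Br (Y.filter (fun u => u ≠ φ (if q.2 then (ep q.1).2 else (ep q.1).1) ∧ adj (φ (if q.2 then (ep q.1).2 else (ep q.1).1)) u))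
    have h3 : Fintype.card (ι × Bool) = 2 * N := by
      rw [Fintype.card_prod, Fintype.card_bool, hN]; ring
    show _ ≤ (_ \ Br).card
    omega)
  have hxY : ∀ q, x q ∈ Y := fun q => (Finset.mem_filter.1 (Finset.mem_sdiff.1 (hxM q)).1).1
  have hxB : ∀ q, x q ∉ Br := fun q => (Finset.mem_sdiff.1 (hxM q)).2
  have hxa : ∀ q, adj (φ (if q.2 then (ep q.1).2 else (ep q.1).1)) (x q) :=
    fun q => (Finset.mem_filter.1 (Finset.mem_sdiff.1 (hxM q)).1).2.2
  set R := (U \ Z) \ Br with hR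
  have hRno : ¬ ColS g R (Finset.range (2 * (11 * N - 3))) := by
    intro h
    apply hcol
    have h1 := h.add hsym hl Br
    have h2 : R ∪ Br = U \ Z := by
      rw [hR]; exact Finset.sdiff_union_of_subset (hBrY.trans hYU)
    rw [h2, hBrc] at h1
    have h3 : 2 * (11 * N - 3) = 22 * N - 6 := by omega
    rwa [h3] at h1
  obtain ⟨s, Bg, I, H, hF, hIne, hIc, hdeg⟩ := mader g hsym hl R (11 * N - 3) (by omega) hRno
  let g1 : V → V → Bool → Prop := fun u v σ => sw g s u v σ ∧ u ∈ U \ Br ∧ v ∈ U \ Br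
  have hRU : R ⊆ U \ Br := by
    intro z hz
    simp only [hR, Finset.mem_sdiff] at hz ⊢
    exact ⟨hz.1.1, hz.2⟩
  have hXc : (Finset.univ.image x).card = 2 * N := by
    rw [Finset.card_image_of_injective _ hxinj, Finset.card_univ, Fintype.card_prod, Fintype.card_bool, hN]; ring
  have hRH : RH g1 x I (fun i j => (i, j) ∈ H) Bg := by
    refine ⟨?_, hxinj, hF.disj, ?_, ?_, ?_, ?_⟩
    · rintro u v σ ⟨h1, h2, h3⟩
      exact ⟨sw_sym hsym s _ _ _ h1, h3, h2⟩
    · intro i hi y hy z hz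
      left
      exact PC.mono subset_rfl (fun u hu v hv h => ⟨h, hRU (hF.sub i hi hu), hRU (hF.sub i hi hv)⟩) (hF.conn i hi y hy z hz)
    · intro i hi _ _ j hj hij σ
      obtain ⟨u, hu, v, hv, h⟩ := hF.dig i j hij σ
      exact ⟨u, hu, v, hv, h, hRU (hF.sub i hi hu), hRU (hF.sub j hj hv)⟩
    · by_contra hcon
      have h1 : ∀ i ∈ I, ∃ z, z ∈ Bg i ∧ z ∈ Finset.univ.image x := by
        intro i hi
        by_contra h2
        push Not at h2
        exact hcon ⟨i, hi, hF.ne i hi, Finset.disjoint_left.2 h2⟩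
      choose! z hz1 hz2 using h1
      have h2 : I.card ≤ (Finset.univ.image x).card := by
        apply Finset.card_le_card_of_injOn z (fun i hi => hz2 i hi)
        intro i hi j hj hij
        by_contra hne
        exact Finset.disjoint_left.1 (hF.disj i hi j hj hne) (hz1 i hi) (hij ▸ hz1 j hj)
      obtain ⟨i, hi⟩ := hIne
      have h3 := (hdeg i hi).trans (Finset.card_filter_le _ _)
      omega
    · intro A B hS hXA hcard i hi hne hsub
      have := hconn ((A ∩ U) ∪ Br) ((B ∩ U) ∪ Br) ?_ ?_ ?_
      · rcases this with h | h
        · obtain ⟨w, hw, hwB⟩ : ∃ w ∈ Finset.univ.image x, w ∉ B := by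
            by_contra hcon
            push Not at hcon
            have : Finset.univ.image x ⊆ A ∩ B := fun w hw => Finset.mem_inter.2 ⟨hXA hw, hcon w hw⟩
            have := Finset.card_le_card this
            omega
          have hwA := hXA hw
          obtain ⟨q, _, rfl⟩ := Finset.mem_image.1 hw
          have hu := Finset.mem_sdiff.1 (hYU (hxY q))
          apply hu.2
          apply h
          simp [hwA, hwB, hu.1, hxB q]
        · obtain ⟨y, hy⟩ := hne
          have h1 := hF.sub i hi hy
          have h2 := Finset.mem_sdiff.1 (hsub hy)
          simp only [hR, Finset.mem_sdiff] at h1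
          apply h1.1.2
          apply h
          simp [h2.1, h2.2, h1.1.1, h1.2]
      · ext z
        have h1 : z ∈ Br → z ∈ U := fun hz => (Finset.mem_sdiff.1 (hYU (hBrY hz))).1
        have h2 : z ∈ A ∨ z ∈ B := hS.cover z
        simp only [Finset.mem_union, Finset.mem_inter]
        tauto
      · intro u hu v hv σ huv
        have hcov : ∀ z, z ∈ A ∨ z ∈ B := hS.cover
        have h1 := hcov u
        have h2 := hcov v
        simp only [Finset.mem_union, Finset.mem_inter]
        by_cases hub : u ∈ Br
        · rcases h2 with h2 | h2
          · exact Or.inl ⟨Or.inr hub, Or.inl ⟨h2, hv⟩⟩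
          · exact Or.inr ⟨Or.inr hub, Or.inl ⟨h2, hv⟩⟩
        by_cases hvb : v ∈ Br
        · rcases h1 with h1 | h1
          · exact Or.inl ⟨Or.inl ⟨h1, hu⟩, Or.inr hvb⟩
          · exact Or.inr ⟨Or.inl ⟨h1, hu⟩, Or.inr hvb⟩
        have h3 : g1 u v (xor σ (xor (s u) (s v))) := by
          refine ⟨?_, Finset.mem_sdiff.2 ⟨hu, hub⟩, Finset.mem_sdiff.2 ⟨hv, hvb⟩⟩
          unfold sw
          rw [Bool.xor_assoc, Bool.xor_self, Bool.xor_false]; exact huv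
        rcases hS.edge _ _ _ h3 with h4 | h4
        · exact Or.inl ⟨Or.inl ⟨h4.1, hu⟩, Or.inl ⟨h4.2, hv⟩⟩
        · exact Or.inr ⟨Or.inl ⟨h4.1, hu⟩, Or.inl ⟨h4.2, hv⟩⟩
      · have h1 : (A ∩ U ∪ Br) ∩ (B ∩ U ∪ Br) ⊆ (A ∩ B) ∪ Br := by
          intro z
          simp only [Finset.mem_union, Finset.mem_inter]
          tauto
        have h2 := (Finset.card_le_card h1).trans (Finset.card_union_le _ _)
        rw [← hN] at hcard
        omega
  have hlink := rooting N hN hNpos I (fun i j => (i, j) ∈ H) (fun i j h => (hF.edge i j h).2.2.2)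
    (fun i h => (hF.edge i i h).2.2.1 rfl) (by omega) (fun i hi => by have := hdeg i hi; omega) _ g1 x Bg hRH le_rfl
  have hα : ∀ e, ∃ σ, g (φ (ep e).1) (x (e, false)) σ := fun e => by
    obtain ⟨σ, h⟩ := hxa (e, false)
    exact ⟨σ, by simpa using h⟩
  have hβ : ∀ e, ∃ σ, g (x (e, true)) (φ (ep e).2) σ := fun e => by
    obtain ⟨σ, h⟩ := hxa (e, true)
    exact ⟨σ, hsym _ _ _ (by simpa using h)⟩
  choose α hα using hα
  choose β hβ using hβ
  obtain ⟨S, hS1, hS2⟩ := hlink (fun e => xor (xor (α e) (xor (target e) (β e))) (xor (s (x (e, false))) (s (x (e, true)))))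
  refine ⟨φ, x, S, α, β, fun e => xor (α e) (xor (target e) (β e)), hφinj, hα, hβ, ?_, ?_, hS2, ?_⟩
  · intro e
    have h1 := (SP.mono (g' := sw g s) (fun u v σ h => h.1) (hS1 e)).unsw
    rwa [Bool.xor_assoc, Bool.xor_self, Bool.xor_false] at h1
  · intro e
    simp only
    cases α e <;> cases β e <;> cases target e <;> rfl
  · intro e i hi
    have hgen : ∀ a b σ (S : Finset V), SP g1 a b σ S → (a ∉ Br) → φ i ∉ S := by
      intro a b σ S h ha
      induction h with
      | nil a =>
        simp only [Finset.mem_singleton]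
        rintro rfl; exact ha (hφB i)
      | cons h1 _ _ ih =>
        rw [Finset.mem_insert, not_or]
        refine ⟨?_, ih (Finset.mem_sdiff.1 h1.2.2).2⟩
        rintro rfl; exact ha (hφB i)
    exact hgen _ _ _ _ (hS1 e) (hxB _) hi

end

end SGP

namespace SGP
open SGraph

section
variable {V : Type}

/-- the signed adjacency relation of a signed graph -/
def rel (G : SGraph V) (u v : V) (σ : Bool) : Prop := ∃ e, G.ends e = s(u, v) ∧ G.neg e = σ

theorem rel_sym (G : SGraph V) : ∀ u v σ, rel G u v σ → rel G v u σ := by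
  rintro u v σ ⟨e, h1, h2⟩
  exact ⟨e, by rw [h1, Sym2.eq_swap], h2⟩

theorem rel_loop (G : SGraph V) (h : ¬ G.HasNegLoop) : ∀ v σ, rel G v v σ → σ = false := by
  rintro v σ ⟨e, h1, h2⟩
  by_contra hc
  exact h ⟨e, ⟨v, h1⟩, by cases σ <;> simp_all⟩

theorem isNeg_cons {G : SGraph V} {u v w : V} (e : G.E) (h : G.ends e = s(u, v)) (p : G.Walk v w) :
    (Walk.cons e h p).isNeg = xor (G.neg e) p.isNeg := rfl

theorem start_mem {G : SGraph V} {u v : V} (p : G.Walk u v) : u ∈ p.support := by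
  cases p <;> simp [Walk.support]

theorem support_last {G : SGraph V} {u v : V} (p : G.Walk u v) : ∃ l, p.support = l ++ [v] := by
  induction p with
  | nil => exact ⟨[], rfl⟩
  | @cons u _ _ e h p ih =>
    obtain ⟨l, hl⟩ := ih
    exact ⟨u :: l, by simp [Walk.support, hl]⟩

theorem end_mem {G : SGraph V} {u v : V} (p : G.Walk u v) : v ∈ p.support := by
  obtain ⟨l, hl⟩ := support_last p
  rw [hl]; simp

theorem edge_ends {G : SGraph V} {u v : V} (p : G.Walk u v) : ∀ f ∈ p.edges, ∀ z ∈ G.ends f, z ∈ p.support := by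
  induction p with
  | nil => simp [Walk.edges]
  | @cons u v w e h p ih =>
    intro f hf z hz
    simp only [Walk.edges, List.mem_cons] at hf
    simp only [Walk.support, List.mem_cons]
    rcases hf with rfl | hf
    · rw [h, Sym2.mem_iff] at hz
      rcases hz with rfl | rfl
      · exact Or.inl rfl
      · exact Or.inr (start_mem p)
    · exact Or.inr (ih f hf z hz)

theorem dropLast_mem {G : SGraph V} {u v : V} (p : G.Walk u v) (hp : p.support.Nodup) :
    ∀ z ∈ p.support.dropLast, z ∈ p.support ∧ z ≠ v := by
  obtain ⟨l, hl⟩ := support_last p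
  rw [hl] at hp ⊢
  intro z hz
  simp only [List.dropLast_concat] at hz
  refine ⟨by simp [hz], ?_⟩
  rintro rfl
  rw [List.nodup_append] at hp
  exact hp.2.2 z hz z (by simp) rfl

theorem walk_of_SP [DecidableEq V] {G : SGraph V} {a b : V} {σ : Bool} {S : Finset V} (h : SP (rel G) a b σ S) :
    ∃ p : G.Walk a b, p.support.Nodup ∧ (∀ z, z ∈ p.support ↔ z ∈ S) ∧ p.isNeg = σ ∧
      ∀ f ∈ p.edges, ∃ z ∈ S, z ≠ b ∧ z ∈ G.ends f := by
  induction h with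
  | nil a => exact ⟨.nil, by simp [Walk.support], by simp [Walk.support], rfl, by simp [Walk.edges]⟩
  | @cons a b c σ τ S h1 h2 h3 ih =>
    obtain ⟨p, hp1, hp2, hp3, hp4⟩ := ih
    obtain ⟨e, he1, he2⟩ := h1
    refine ⟨.cons e he1 p, ?_, ?_, ?_, ?_⟩
    · simp only [Walk.support, List.nodup_cons, hp2]
      exact ⟨h3, hp1⟩
    · intro z; simp [Walk.support, hp2]
    · rw [isNeg_cons, he2, hp3]
    · intro f hf
      simp only [Walk.edges, List.mem_cons] at hf
      rcases hf with rfl | hf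
      · refine ⟨a, by simp, ?_, by rw [he1]; simp⟩
        rintro rfl; exact h3 h2.right_mem
      · obtain ⟨z, hz1, hz2⟩ := hp4 f hf
        exact ⟨z, by simp [hz1], hz2⟩

theorem colorable_of_ColS [Fintype V] [DecidableEq V] (G : SGraph V) (T : ℕ)
    (h : ColS (rel G) Finset.univ (Finset.range T)) : G.ColorableB T := by
  obtain ⟨f, h1, h2⟩ := h
  have h1' : ∀ u, (f u).1 < T := fun u => Finset.mem_range.1 (h1 u (Finset.mem_univ _))
  refine ⟨fun v => ⟨(f v).1, h1' v⟩, ?_⟩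
  intro i v p _ hX
  have key : ∀ (u v : V) (p : G.Walk u v), (∀ w ∈ p.support, (f w).1 = i) → p.isNeg = xor (f u).2 (f v).2 := by
    intro u v p
    induction p with
    | nil => intro _; simp [Walk.isNeg, Walk.edges]
    | @cons u v w e h p ih =>
      intro hs
      simp only [Walk.support, List.mem_cons, forall_eq_or_imp] at hs
      rw [isNeg_cons, ih hs.2]
      have := h2 u (Finset.mem_univ _) v (Finset.mem_univ _) (G.neg e) ⟨e, h, rfl⟩ (hs.1.trans (hs.2 _ (start_mem p)).symm)
      rw [this]
      cases (f u).2 <;> cases (f v).2 <;> cases (f w).2 <;> rfl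
  rw [key v v p (fun w hw => by have := hX w hw; simpa [Fin.ext_iff] using this)]
  simp

theorem not_colorable (G : SGraph V) (t n : ℕ) (ht : (t : ℕ∞) ≤ G.chromNumB) (hn : n < t) : ¬ G.ColorableB n := by
  intro h
  have h1 : G.chromNumB ≤ n := iInf₂_le n h
  have := ht.trans h1
  rw [Nat.cast_le] at this
  omega

theorem main_topminor [Fintype V] [DecidableEq V] (G : SGraph V) (hG : ¬ G.HasNegLoop) (k t : ℕ) (hk : 2 ≤ k)
    (ht : (t : ℕ∞) ≤ G.chromNumB) (hkt : 26 * (k * (k - 1)) + 3 * k - 8 < t) : (tildeK k).IsTopMinor G := by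
  classical
  refine ⟨fun _ => false, ?_⟩
  let ι := (⊤ : SimpleGraph (Fin k)).edgeSet × Bool
  have hcard : k * (k - 1) = Fintype.card ι := by
    have h1 : Fintype.card (⊤ : SimpleGraph (Fin k)).edgeSet = k.choose 2 := by
      rw [← SimpleGraph.edgeFinset_card, SimpleGraph.card_edgeFinset_top_eq_card_choose_two, Fintype.card_fin]
    show _ = Fintype.card (_ × Bool)
    rw [Fintype.card_prod, h1, Fintype.card_bool, Nat.choose_two_right]
    exact (Nat.div_mul_cancel (Nat.even_mul_pred_self k).two_dvd).symm
  let ep : ι → Fin k × Fin k := fun e => Quot.out (e.1 : Sym2 (Fin k))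
  have hep : ∀ e : ι, (e.1 : Sym2 (Fin k)) = s((ep e).1, (ep e).2) := fun e => (Quot.out_eq (e.1 : Sym2 (Fin k))).symm
  have hepne : ∀ e : ι, (ep e).1 ≠ (ep e).2 := by
    intro e h
    have h1 := e.1.2
    rw [hep e, SimpleGraph.mem_edgeSet] at h1
    exact h1.ne h
  have hno : ¬ ColS (rel G) Finset.univ (Finset.range (26 * (k * (k - 1)) + 3 * k - 8)) :=
    fun h => not_colorable G t _ ht hkt (colorable_of_ColS G _ h)
  have hpos : 1 ≤ k * (k - 1) := Nat.mul_pos (by omega) (by omega)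
  obtain ⟨φ, x, S, α, β, γ, hφ, hα, hβ, hγ, hsum, hdis, hφS⟩ := core (rel G) (rel_sym G) (rel_loop G hG) k _ (by omega)
    hcard hpos ep (((tildeK k).switch (fun _ => false)).neg) hno
  have hP : ∀ e : ι, ∃ p : G.Walk (φ (ep e).1) (φ (ep e).2), p.support.Nodup ∧
      (∀ z ∈ p.inner, z ∈ S e) ∧ (∀ z ∈ p.support, z ∈ S e ∨ z ∈ Set.range φ) ∧
      (∀ f ∈ p.edges, ∃ z ∈ S e, z ∈ G.ends f) ∧ p.isNeg = ((tildeK k).switch (fun _ => false)).neg e := by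
    intro e
    have h1 := (hγ e).snoc (hβ e) (hφS e _)
    obtain ⟨q, hq1, hq2, hq3, hq4⟩ := walk_of_SP h1
    obtain ⟨a, ha1, ha2⟩ := hα e
    refine ⟨.cons a ha1 q, ?_, ?_, ?_, ?_, ?_⟩
    · simp only [Walk.support, List.nodup_cons, hq2, Finset.mem_insert, not_or]
      exact ⟨⟨fun h => hepne e (hφ h), hφS e _⟩, hq1⟩
    · intro z hz
      simp only [Walk.inner, Walk.support, List.tail_cons] at hz
      have h2 := dropLast_mem q hq1 z hz
      rw [hq2, Finset.mem_insert] at h2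
      exact h2.1.resolve_left h2.2
    · intro z hz
      simp only [Walk.support, List.mem_cons, hq2, Finset.mem_insert] at hz
      rcases hz with rfl | rfl | hz
      · exact Or.inr ⟨_, rfl⟩
      · exact Or.inr ⟨_, rfl⟩
      · exact Or.inl hz
    · intro f hf
      simp only [Walk.edges, List.mem_cons] at hf
      rcases hf with rfl | hf
      · exact ⟨x (e, false), (hγ e).left_mem, by rw [ha1]; simp⟩
      · obtain ⟨z, hz1, hz2, hz3⟩ := hq4 f hf
        exact ⟨z, (Finset.mem_insert.1 hz1).resolve_left hz2, hz3⟩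
    · rw [isNeg_cons, ha2, hq3, ← hsum e]
  choose P hP1 hP2 hP3 hP4 hP5 using hP
  have hsd : ∀ e f : ι, e ≠ f → ∀ z ∈ S e, z ∉ (P f).support := by
    intro e f hef z hz hz'
    rcases hP3 f z hz' with h | ⟨i, rfl⟩
    · exact Finset.disjoint_left.1 (hdis e f hef) hz h
    · exact hφS e i hz
  refine ⟨φ, ep, hφ, hep, P, hP1, ?_, ?_, ?_, hP5⟩
  · intro e f hef z hz
    exact hsd e f hef z (hP2 e z hz)
  · rintro e z hz ⟨i, rfl⟩
    exact hφS e i (hP2 e _ hz)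
  · intro e f hef a ha ha'
    obtain ⟨z, hz, hza⟩ := hP4 e a ha
    exact hsd e f hef z hz (edge_ends _ a ha' z hza)

theorem topminor_one (G : SGraph V) [Nonempty V] : (tildeK 1).IsTopMinor G := by
  have hE : ∀ e : ((tildeK 1).switch (fun _ => false)).E, False := by
    rintro ⟨⟨e, he⟩, b⟩
    induction e using Sym2.ind with
    | _ x y =>
      rw [SimpleGraph.mem_edgeSet] at he
      exact he.ne (Subsingleton.elim _ _)
  refine ⟨fun _ => false, fun _ => Classical.arbitrary V, fun _ => (0, 0), fun _ _ _ => Subsingleton.elim _ _,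
    fun e => (hE e).elim, fun e => (hE e).elim, fun e => (hE e).elim, fun e => (hE e).elim, fun e => (hE e).elim,
    fun e => (hE e).elim, fun e => (hE e).elim⟩

theorem topminor_two (G : SGraph V) (hG : ¬ G.HasNegLoop) (h1 : ¬ G.ColorableB 1) : (tildeK 2).IsTopMinor G := by
  classical
  obtain ⟨v, p, hp, hn⟩ : ∃ (v : V) (p : G.Walk v v), p.IsCycle ∧ p.isNeg = true := by
    by_contra hcon
    push Not at hcon
    exact h1 ⟨fun _ => 0, fun i v p hp _ => by simpa using hcon v p hp⟩
  cases p with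
  | nil => exact absurd rfl hp.1
  | @cons _ v1 _ e h q =>
    have hq : q.support.Nodup := hp.2.2
    have heq : e ∉ q.edges := (List.nodup_cons.1 hp.2.1).1
    have hne : v ≠ v1 := by
      cases q with
      | nil =>
        exfalso
        apply hG
        refine ⟨e, ⟨v, h⟩, ?_⟩
        simpa [Walk.isNeg, Walk.edges] using hn
      | cons e' h' q' =>
        rintro rfl
        exact (List.nodup_cons.1 hq).1 (end_mem q')
    rw [isNeg_cons] at hn
    let φ : Fin 2 → V := fun i => if i = 0 then v else v1
    let ι := (⊤ : SimpleGraph (Fin 2)).edgeSet × Bool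
    have hι : ∀ a : ι, (a.1 : Sym2 (Fin 2)) = s(0, 1) := by
      rintro ⟨⟨a, ha⟩, b⟩
      induction a using Sym2.ind with
      | _ x y =>
        rw [SimpleGraph.mem_edgeSet] at ha
        have := ha.ne
        show s(x, y) = s(0, 1)
        fin_cases x <;> fin_cases y <;> simp_all [Sym2.eq_swap]
    have hι2 : ∀ a b : ι, a ≠ b → a.2 ≠ b.2 := by
      intro a b hab h2
      exact hab (Prod.ext (Subtype.ext ((hι a).trans (hι b).symm)) h2)
    let ep : ι → Fin 2 × Fin 2 := fun a => if a.2 = G.neg e then (0, 1) else (1, 0)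
    have hP : ∀ a : ι, ∃ w : G.Walk (φ (ep a).1) (φ (ep a).2), w.support.Nodup ∧ w.isNeg = a.2 ∧
        (∀ z ∈ w.inner, z ≠ v ∧ z ≠ v1) ∧
        (a.2 = G.neg e → w.inner = [] ∧ w.edges = [e] ∧ w.support = [v, v1]) ∧ (a.2 ≠ G.neg e → w.edges = q.edges) := by
      intro a
      by_cases ha : a.2 = G.neg e
      · have : ep a = (0, 1) := if_pos ha
        rw [this]
        refine ⟨(.cons e h .nil : G.Walk v v1), ?_, ?_, ?_, fun _ => ⟨rfl, rfl, rfl⟩, fun h => absurd ha h⟩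
        · show [v, v1].Nodup
          simp [hne]
        · rw [isNeg_cons, ha]; simp [Walk.isNeg, Walk.edges]
        · simp [Walk.inner, Walk.support]
      · have : ep a = (1, 0) := if_neg ha
        rw [this]
        refine ⟨(q : G.Walk v1 v), hq, ?_, ?_, fun h => absurd h ha, fun _ => rfl⟩
        · revert ha hn
          cases a.2 <;> cases G.neg e <;> cases q.isNeg <;> simp
        · intro z hz
          cases q with
          | nil => simp [Walk.inner, Walk.support] at hz
          | cons e' h' q' =>
            have hq' := List.nodup_cons.1 hq
            have h3 := dropLast_mem q' hq'.2 z hz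
            refine ⟨h3.2, ?_⟩
            rintro rfl
            exact hq'.1 h3.1
    choose P hP1 hP2 hP3 hP4 hP5 using hP
    refine ⟨fun _ => false, φ, ep, ?_, ?_, P, hP1, ?_, ?_, ?_, ?_⟩
    · intro i j hij
      fin_cases i <;> fin_cases j <;> simp_all [φ]
    · intro a
      refine (hι a).trans ?_
      by_cases ha : a.2 = G.neg e
      · have : ep a = (0, 1) := if_pos ha
        rw [this]
      · have : ep a = (1, 0) := if_neg ha
        rw [this, Sym2.eq_swap]
    · intro a b hab z hz hz'
      have hab' := hι2 a b hab
      by_cases ha : a.2 = G.neg e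
      · rw [(hP4 a ha).1] at hz; simp at hz
      · have hb : b.2 = G.neg e := by
          revert ha hab'
          cases a.2 <;> cases b.2 <;> cases G.neg e <;> simp
        rw [(hP4 b hb).2.2] at hz'
        have := hP3 a z hz
        simp [this.1, this.2] at hz'
    · rintro a z hz ⟨i, rfl⟩
      have := hP3 a _ hz
      by_cases hi : i = 0
      · exact this.1 (if_pos hi)
      · exact this.2 (if_neg hi)
    · intro a b hab f hf hf'
      have hab' := hι2 a b hab
      by_cases ha : a.2 = G.neg e
      · have hb : b.2 ≠ G.neg e := fun hb => hab' (ha.trans hb.symm)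
        rw [(hP4 a ha).2.1, List.mem_singleton] at hf
        rw [hP5 b hb] at hf'
        subst hf; exact heq hf'
      · have hb : b.2 = G.neg e := by
          revert ha hab'
          cases a.2 <;> cases b.2 <;> cases G.neg e <;> simp
        rw [(hP4 b hb).2.1, List.mem_singleton] at hf'
        rw [hP5 a ha] at hf
        subst hf'; exact heq hf
    · intro a
      rw [hP2 a]
      show a.2 = xor a.2 (Sym2.lift _ (a.1 : Sym2 (Fin 2)))
      rw [hι a]
      simp

theorem exists_topminor (t : ℕ) (ht : 1 ≤ t) : ∃ k : ℕ, Real.sqrt (2 * t / 79) ≤ (k : ℝ) ∧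
    ∀ (m : ℕ) (G : SGraph (Fin m)), ¬ G.HasNegLoop → (t : ℕ∞) ≤ G.chromNumB → (tildeK k).IsTopMinor G := by
  have htpos : (1 : ℝ) ≤ t := by exact_mod_cast ht
  have hpos : 0 < Real.sqrt (2 * t / 79) := Real.sqrt_pos.2 (by positivity)
  refine ⟨⌈Real.sqrt (2 * t / 79)⌉₊, Nat.le_ceil _, ?_⟩
  have hk1 : 1 ≤ ⌈Real.sqrt (2 * t / 79)⌉₊ := Nat.ceil_pos.2 hpos
  have hkt : 79 * (⌈Real.sqrt (2 * t / 79)⌉₊ - 1) ^ 2 < 2 * t := by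
    have h1 := Nat.ceil_lt_add_one hpos.le
    set k := ⌈Real.sqrt (2 * t / 79)⌉₊ with hk
    obtain ⟨j, hj⟩ : ∃ j, k = j + 1 := ⟨k - 1, by omega⟩
    rw [hj] at h1 ⊢
    have h2 : (j : ℝ) < Real.sqrt (2 * t / 79) := by push_cast at h1; linarith
    rw [Real.lt_sqrt (by positivity), lt_div_iff₀ (by norm_num)] at h2
    have h3 : ((j ^ 2 * 79 : ℕ) : ℝ) < ((2 * t : ℕ) : ℝ) := by push_cast; linarith
    have h4 := Nat.cast_lt.1 h3
    simp only [Nat.add_sub_cancel]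
    omega
  generalize ⌈Real.sqrt (2 * t / 79)⌉₊ = k at hk1 hkt
  intro m G hG hc
  obtain ⟨j, rfl⟩ : ∃ j, k = j + 1 := ⟨k - 1, by omega⟩
  simp only [Nat.add_sub_cancel] at hkt
  rcases j with _ | _ | j
  · have : Nonempty (Fin m) := by
      by_contra hne
      rw [not_nonempty_iff] at hne
      exact not_colorable G t 0 hc ht ⟨fun v => (hne.false v).elim, fun i => i.elim0⟩
    exact topminor_one G
  · exact topminor_two G hG (not_colorable G t 1 hc (by omega))
  · apply main_topminor G hG _ t (by omega) hc
    simp only [Nat.add_sub_cancel]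
    have h1 : 26 * ((j + 1 + 1 + 1) * (j + 1 + 1)) + 3 * (j + 1 + 1 + 1) < t + 8 := by nlinarith
    omega

theorem tildeK_noloop (t : ℕ) : ¬ (tildeK t).HasNegLoop := by
  rintro ⟨⟨⟨e, he⟩, b⟩, ⟨v, hv⟩, _⟩
  have hv' : e = s(v, v) := hv
  subst hv'
  rw [SimpleGraph.mem_edgeSet] at he
  exact he.ne rfl

theorem tildeK_chrom (t : ℕ) : (t : ℕ∞) ≤ (tildeK t).chromNumB := by
  refine le_iInf₂ ?_
  rintro n ⟨c, hc⟩
  rw [Nat.cast_le]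
  have hinj : Function.Injective c := by
    intro u v huv
    by_contra hne
    have hadj : s(u, v) ∈ (⊤ : SimpleGraph (Fin t)).edgeSet := by
      rw [SimpleGraph.mem_edgeSet]; exact hne
    let e1 : (tildeK t).E := (⟨s(u, v), hadj⟩, false)
    let e2 : (tildeK t).E := (⟨s(u, v), hadj⟩, true)
    have he : e1 ≠ e2 := by
      intro h
      have := congrArg Prod.snd h
      simp [e1, e2] at this
    let p : (tildeK t).Walk u u := .cons (v := v) e1 rfl (.cons (v := u) e2 Sym2.eq_swap .nil)
    have := hc (c u) u p ⟨by simp [p, Walk.edges], by simp [p, Walk.edges, he], by simp [p, Walk.support, Ne.symm hne]⟩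
      (by simp [p, Walk.support, huv])
    have h2 : p.isNeg = true := rfl
    rw [h2] at this
    exact absurd this (by simp)
  simpa using Fintype.card_le_of_injective c hinj

end

end SGP

/-- `TT(t) ≥ √(2t/79)`; that is, every signed graph with no negative
loop and balanced chromatic number at least `t` contains a subdivision of `K̃_k`
with `k ≥ √(2t/79)`. -/
theorem stmt17 (t : ℕ) (ht : 1 ≤ t) :
    Real.sqrt (2 * t / 79) ≤ (TT t : ℝ) ∧
    ∀ (m : ℕ) (G : SGraph (Fin m)), ¬ G.HasNegLoop → (t : ℕ∞) ≤ G.chromNumB →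
      ∃ k : ℕ, Real.sqrt (2 * t / 79) ≤ (k : ℝ) ∧ (tildeK k).IsTopMinor G := by
  obtain ⟨k, hk, h⟩ := SGP.exists_topminor t ht
  refine ⟨hk.trans ?_, fun m G h1 h2 => ⟨k, hk, h m G h1 h2⟩⟩
  rw [Nat.cast_le]
  refine le_csSup ⟨t, ?_⟩ h
  intro k' hk'
  obtain ⟨_, φ, _, hφ, _⟩ := hk' t (tildeK t) (SGP.tildeK_noloop t) (SGP.tildeK_chrom t)
  simpa using Fintype.card_le_of_injective φ hφ
end
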